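/- For fixed positive integers p, q with p - 2 not divisible by C(p,2) - q + 1, the generalized Ramsey number satisfies f(n, p, q) = O((n^{p-2}/log n)^{1/(C(p,2)-q+1)}). -/

import Mathlib

/-- The generalized Ramsey number `f(n,p,q)`: the minimum number `t` of colors in an
edge-coloring of `K_n` in which every `p`-clique receives at least `q` colors. -/
noncomputable def fRamsey (n p q : ℕ) : ℕ :=
  sInf {t | ∃ φ : Finset (Fin n) → Fin t,
    ∀ S : Finset (Fin n), S.card = p → q ≤ ((S.powersetCard 2).image φ).card}

set_option linter.unusedSectionVars false
set_option linter.unusedVariables false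
open Finset

section PhaseTwo

open scoped Classical

variable {E ι Col : Type} [Fintype E] [DecidableEq E] [Fintype ι] [Fintype Col] [DecidableEq Col]

structure HG (K : ι → Finset E) (col : ι → E → Col) (k : ℕ) : Prop where
  two : ∀ a, 2 ≤ (K a).card
  le : ∀ a, (K a).card ≤ k
  dag : ∀ a a' x, K a = K a' → x ∈ K a → (∀ y ∈ K a, y ≠ x → col a y = col a' y) → a = a'
  lin : ∀ a a' f g, f ≠ g → f ∈ K a → g ∈ K a → f ∈ K a' → g ∈ K a' → K a = K a'
  tri : ∀ a a1 a2 x x' g, x ≠ x' → x ∈ K a → x' ∈ K a → g ∉ K a → x ∈ K a1 → g ∈ K a1 →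
    x' ∈ K a2 → g ∈ K a2 → False
  quad : ∀ a a' a1 a1' f x x' g, f ∈ K a → f ∈ K a' → x ∈ K a → x' ∈ K a' → f ∉ K a1 →
    f ∉ K a1' → x ∈ K a1 → g ∈ K a1 → x' ∈ K a1' → g ∈ K a1' → g ∉ K a → g ∉ K a' → K a = K a'

noncomputable def qv (I : Finset E) (φ : E → Col) (p : E → Col → ℝ) (g : E) (c : Col) : ℝ :=
  if g ∈ I then (if φ g = c then 1 else 0) else 4 * p g c

noncomputable def hterm (K : ι → Finset E) (col : ι → E → Col) (I : Finset E) (φ : E → Col)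
    (p : E → Col → ℝ) (f : E) (a : ι) : ℝ :=
  if (K a).erase f ⊆ I then 0 else ∏ g ∈ (K a).erase f, qv I φ p g (col a g)

noncomputable def FS (K : ι → Finset E) (col : ι → E → Col) (f : E) (c : Col) : Finset ι :=
  Finset.univ.filter (fun a => f ∈ K a ∧ col a f = c)

noncomputable def Hs (K : ι → Finset E) (col : ι → E → Col) (I : Finset E) (φ : E → Col)
    (p : E → Col → ℝ) (f : E) (c : Col) : ℝ :=
  ∑ a ∈ FS K col f c, hterm K col I φ p f a

def linked (K : ι → Finset E) (I : Finset E) (g x : E) : Prop :=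
  ∃ a1, x ∈ K a1 ∧ g ∈ K a1 ∧ ((K a1).erase x).erase g ⊆ I

def kill (K : ι → Finset E) (col : ι → E → Col) (I : Finset E) (φ : E → Col) (g f : E)
    (c c' : Col) : Prop :=
  ∃ a, f ∈ K a ∧ g ∈ K a ∧ ((K a).erase f).erase g ⊆ I ∧
    (∀ y ∈ ((K a).erase f).erase g, φ y = col a y) ∧ col a f = c ∧ col a g = c'

noncomputable def kp (K : ι → Finset E) (col : ι → E → Col) (I : Finset E) (φ : E → Col) (g : E)
    (P : Col → ℝ) (f : E) (c : Col) : ℝ :=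
  ∑ c', if kill K col I φ g f c c' then P c' else 0

noncomputable def pn (K : ι → Finset E) (col : ι → E → Col) (I : Finset E) (φ : E → Col) (g : E)
    (P : Col → ℝ) (μ : ℝ) (p : E → Col → ℝ) (c' : Col) (f : E) (c : Col) : ℝ :=
  p f c * (if kill K col I φ g f c c' then 0 else 1 + (1 - μ) * kp K col I φ g P f c)

variable {K : ι → Finset E} {col : ι → E → Col} {I : Finset E} {φ : E → Col} {g : E}
  {P : Col → ℝ} {p : E → Col → ℝ} {μ : ℝ} {k : ℕ}

lemma kill_linked {f : E} {c c' : Col} (h : kill K col I φ g f c c') : linked K I g f := by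
  obtain ⟨a, h1, h2, h3, _⟩ := h
  exact ⟨a, h1, h2, h3⟩

lemma kp_unlinked {f : E} {c : Col} (h : ¬ linked K I g f) : kp K col I φ g P f c = 0 := by
  unfold kp
  apply Finset.sum_eq_zero
  intro c' _
  rw [if_neg (fun hk => h (kill_linked hk))]

lemma pn_unlinked {f : E} {c c' : Col} (h : ¬ linked K I g f) :
    pn K col I φ g P μ p c' f c = p f c := by
  unfold pn
  rw [if_neg (fun hk => h (kill_linked hk)), kp_unlinked h]; ring

lemma kill_uniq (hG : HG K col k) {f : E} {c c1 c2 : Col} (hfg : f ≠ g)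
    (h1 : kill K col I φ g f c c1) (h2 : kill K col I φ g f c c2) : c1 = c2 := by
  obtain ⟨a, a1, a2, a3, a4, a5, a6⟩ := h1
  obtain ⟨b, b1, b2, b3, b4, b5, b6⟩ := h2
  have hK := hG.lin a b f g hfg a1 a2 b1 b2
  have : a = b := by
    apply hG.dag a b g hK a2
    intro y hy hyg
    by_cases hyf : y = f
    · rw [hyf, a5, b5]
    · rw [← a4 y (by simp [hyg, hyf, hy]), b4 y (by rw [← hK]; simp [hyg, hyf, hy])]
  rw [← a6, ← b6, this]

lemma kill_uniq' (hG : HG K col k) {f : E} {c c1 c2 : Col} (hfg : f ≠ g)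
    (h1 : kill K col I φ g f c1 c) (h2 : kill K col I φ g f c2 c) : c1 = c2 := by
  obtain ⟨a, a1, a2, a3, a4, a5, a6⟩ := h1
  obtain ⟨b, b1, b2, b3, b4, b5, b6⟩ := h2
  have hK := hG.lin a b f g hfg a1 a2 b1 b2
  have : a = b := by
    apply hG.dag a b f hK a1
    intro y hy hyf
    by_cases hyg : y = g
    · rw [hyg, a6, b6]
    · rw [← a4 y (by simp [hyg, hyf, hy]), b4 y (by rw [← hK]; simp [hyg, hyf, hy])]
  rw [← a5, ← b5, this]

lemma kp_nonneg (hP : ∀ c, 0 ≤ P c) (f : E) (c : Col) : 0 ≤ kp K col I φ g P f c := by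
  unfold kp
  apply Finset.sum_nonneg
  intro c' _
  split_ifs <;> simp [hP]

lemma kp_le (hG : HG K col k) {B : ℝ} (hB : 0 ≤ B) (hPB : ∀ c, P c ≤ B)
    {f : E} (hfg : f ≠ g) (c : Col) : kp K col I φ g P f c ≤ B := by
  unfold kp
  by_cases h : ∃ c', kill K col I φ g f c c'
  · obtain ⟨c1, h1⟩ := h
    rw [Finset.sum_eq_single c1]
    · rw [if_pos h1]; exact hPB _
    · intro b _ hb
      rw [if_neg (fun hk => hb (kill_uniq hG hfg hk h1))]
    · simp
  · push Not at h
    rw [Finset.sum_eq_zero]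
    · exact hB
    · intro c' _; rw [if_neg (h c')]

lemma sum_kp_le (hG : HG K col k) (hP : ∀ c, 0 ≤ P c) (hP1 : ∑ c, P c = 1)
    {f : E} (hfg : f ≠ g) : ∑ c, kp K col I φ g P f c ≤ 1 := by
  unfold kp
  rw [Finset.sum_comm, ← hP1]
  apply Finset.sum_le_sum
  intro c' _
  by_cases h : ∃ c, kill K col I φ g f c c'
  · obtain ⟨c1, h1⟩ := h
    rw [Finset.sum_eq_single c1]
    · rw [if_pos h1]
    · intro b _ hb
      rw [if_neg (fun hk => hb (kill_uniq' hG hfg hk h1))]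
    · simp
  · push Not at h
    rw [Finset.sum_eq_zero]
    · exact hP _
    · intro c _; rw [if_neg (h c)]

lemma kp_le_one (hG : HG K col k) (hP : ∀ c, 0 ≤ P c) (hP1 : ∑ c, P c = 1)
    {f : E} (hfg : f ≠ g) (c : Col) : kp K col I φ g P f c ≤ 1 := by
  refine le_trans ?_ (sum_kp_le (I := I) (φ := φ) hG hP hP1 hfg)
  exact Finset.single_le_sum (f := fun c => kp K col I φ g P f c)
    (fun c _ => kp_nonneg hP f c) (Finset.mem_univ c)

lemma qv_nonneg (hp : ∀ f c, 0 ≤ p f c) (y : E) (c : Col) : 0 ≤ qv I φ p y c := by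
  unfold qv
  split_ifs <;> simp [hp]

lemma hterm_nonneg (hp : ∀ f c, 0 ≤ p f c) (f : E) (a : ι) : 0 ≤ hterm K col I φ p f a := by
  unfold hterm
  split_ifs
  · exact le_rfl
  · exact Finset.prod_nonneg (fun y _ => qv_nonneg hp _ _)

lemma pn_nonneg (hp : ∀ f c, 0 ≤ p f c) (hP : ∀ c, 0 ≤ P c) (hμ : μ ≤ 1) (c' : Col) (f : E)
    (c : Col) : 0 ≤ pn K col I φ g P μ p c' f c := by
  unfold pn
  apply mul_nonneg (hp _ _)
  split_ifs
  · exact le_rfl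
  · have := kp_nonneg (K := K) (col := col) (I := I) (φ := φ) (g := g) hP f c
    have : 0 ≤ (1 - μ) * kp K col I φ g P f c := mul_nonneg (by linarith) this
    linarith

/-- hyperedges through `g` -/
lemma stepA (hG : HG K col k) (hp : ∀ f c, 0 ≤ p f c) (hP : ∀ c, 0 ≤ P c) (hP1 : ∑ c, P c = 1)
    (hP2 : ∀ c, P c ≤ 2 * p g c) (hg : g ∉ I) {f : E} (hf : f ∉ I) (hfg : f ≠ g) {a : ι}
    (hfa : f ∈ K a) (hga : g ∈ K a) {η : ℝ} (hη : 0 ≤ η) (hη' : η ≤ 1 / 3) :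
    (∑ c', P c' * ((hterm K col (insert g I) (Function.update φ g c')
        (pn K col I φ g P μ p c') f a - hterm K col I φ p f a) +
      η * |hterm K col (insert g I) (Function.update φ g c')
        (pn K col I φ g P μ p c') f a - hterm K col I φ p f a|) ≤
      if (K a).erase f ⊆ insert g I then - (1 - η) * hterm K col I φ p f a else 0) := by
  by_cases hs : (K a).erase f ⊆ insert g I
  · rw [if_pos hs]
    have h1 : ∀ c', hterm K col (insert g I) (Function.update φ g c')
        (pn K col I φ g P μ p c') f a = 0 := fun c' => by unfold hterm; rw [if_pos hs]
    simp only [h1, zero_sub, abs_neg, abs_of_nonneg (hterm_nonneg hp f a)]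
    rw [← Finset.sum_mul, hP1]
    linarith
  · rw [if_neg hs]
    have hgf : g ∈ (K a).erase f := by simp [hga, hfg.symm]
    have hs' : ¬ (K a).erase f ⊆ I := fun h => hg (h hgf)
    set R : ℝ := ∏ y ∈ ((K a).erase f).erase g, qv I φ p y (col a y) with hR
    have hR0 : 0 ≤ R := Finset.prod_nonneg (fun y _ => qv_nonneg hp _ _)
    have hold : hterm K col I φ p f a = 4 * p g (col a g) * R := by
      unfold hterm
      rw [if_neg hs', ← Finset.mul_prod_erase _ _ hgf, ← hR]
      congr 1
      unfold qv
      rw [if_neg hg]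
    have hnew : ∀ c', hterm K col (insert g I) (Function.update φ g c')
        (pn K col I φ g P μ p c') f a = if c' = col a g then R else 0 := by
      intro c'
      unfold hterm
      rw [if_neg hs, ← Finset.mul_prod_erase _ _ hgf]
      have e1 : qv (insert g I) (Function.update φ g c') (pn K col I φ g P μ p c') g (col a g)
          = if c' = col a g then 1 else 0 := by
        unfold qv; simp
      have e2 : ∏ y ∈ ((K a).erase f).erase g,
          qv (insert g I) (Function.update φ g c') (pn K col I φ g P μ p c') y (col a y) = R := by
        apply Finset.prod_congr rfl
        intro y hy
        simp only [Finset.mem_erase] at hy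
        obtain ⟨hyg, hyf, hya⟩ := hy
        unfold qv
        by_cases hyI : y ∈ I
        · simp [hyI, hyg]
        · have : ¬ linked K I g y := by
            rintro ⟨a1, b1, b2, b3⟩
            have := hG.lin a1 a y g hyg b1 b2 hya hga
            apply hf
            apply b3
            rw [this]
            simp [hfa, hfg, Ne.symm hyf]
          simp [hyI, hyg, pn_unlinked this]
      rw [e1, e2]
      split_ifs <;> simp
    simp only [hnew, hold]
    have key : ∀ c', P c' * (((if c' = col a g then R else 0) - 4 * p g (col a g) * R) +
        η * |(if c' = col a g then R else 0) - 4 * p g (col a g) * R|) ≤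
        (1 + η) * (if c' = col a g then P c' * R else 0) - P c' * ((1 - η) * (4 * p g (col a g) * R)) := by
      intro c'
      have hw : 0 ≤ 4 * p g (col a g) * R := mul_nonneg (mul_nonneg (by norm_num) (hp _ _)) hR0
      have hx : (0:ℝ) ≤ (if c' = col a g then R else 0) := by split_ifs <;> simp [hR0]
      have h1 : |(if c' = col a g then R else 0) - 4 * p g (col a g) * R| ≤
        (if c' = col a g then R else 0) + 4 * p g (col a g) * R := by
        rw [abs_le]; constructor <;> linarith
      have h2 : (if c' = col a g then P c' * R else 0) = P c' * (if c' = col a g then R else 0) := by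
        split_ifs <;> simp
      rw [h2]
      have := mul_le_mul_of_nonneg_left (mul_le_mul_of_nonneg_left h1 hη) (hP c')
      nlinarith [hP c']
    refine (Finset.sum_le_sum (fun c' _ => key c')).trans ?_
    rw [Finset.sum_sub_distrib, ← Finset.mul_sum, ← Finset.sum_mul, hP1, Finset.sum_ite_eq']
    simp only [Finset.mem_univ, if_true]
    have h3 := mul_le_mul_of_nonneg_right (hP2 (col a g)) hR0
    have h4 : 0 ≤ p g (col a g) * R := mul_nonneg (hp _ _) hR0
    nlinarith

/-- hyperedges not through `g` -/
lemma stepB (hG : HG K col k) (hp : ∀ f c, 0 ≤ p f c) (hP : ∀ c, 0 ≤ P c) (hP1 : ∑ c, P c = 1)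
    {f : E} (hf : f ∉ I) {a : ι}
    (hga : g ∉ K a) (hfa : f ∈ K a) {η : ℝ} (hη : 0 ≤ η) (hμη : 2 * η ≤ μ) (hμ : μ ≤ 1) :
    (∑ c', P c' * ((hterm K col (insert g I) (Function.update φ g c')
        (pn K col I φ g P μ p c') f a - hterm K col I φ p f a) +
      η * |hterm K col (insert g I) (Function.update φ g c')
        (pn K col I φ g P μ p c') f a - hterm K col I φ p f a|) ≤ 0) ∧
    ((¬ ∃ x ∈ (K a).erase f, x ∉ I ∧ linked K I g x) → ∀ c', hterm K col (insert g I)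
      (Function.update φ g c') (pn K col I φ g P μ p c') f a = hterm K col I φ p f a) := by
  have hiff : (K a).erase f ⊆ insert g I ↔ (K a).erase f ⊆ I := by
    constructor
    · intro h y hy
      have := h hy
      simp only [Finset.mem_insert] at this
      rcases this with h1 | h1
      · subst h1; exact absurd (Finset.mem_of_mem_erase hy) hga
      · exact h1
    · intro h; exact h.trans (Finset.subset_insert _ _)
  have hq : ∀ c', ∀ y ∈ (K a).erase f, (y ∈ I ∨ ¬ linked K I g y) →
      qv (insert g I) (Function.update φ g c') (pn K col I φ g P μ p c') y (col a y) =
      qv I φ p y (col a y) := by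
    intro c' y hy h
    have hyg : y ≠ g := by rintro rfl; exact hga (Finset.mem_of_mem_erase hy)
    unfold qv
    by_cases hyI : y ∈ I
    · simp [hyI, hyg]
    · have : ¬ linked K I g y := by tauto
      simp [hyI, hyg, pn_unlinked this]
  have h2 : ((¬ ∃ x ∈ (K a).erase f, x ∉ I ∧ linked K I g x) → ∀ c', hterm K col (insert g I)
      (Function.update φ g c') (pn K col I φ g P μ p c') f a = hterm K col I φ p f a) := by
    intro h c'
    push Not at h
    unfold hterm
    simp only [hiff]
    split_ifs
    · rfl
    · apply Finset.prod_congr rfl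
      intro y hy
      exact hq c' y hy (by have := h y hy; tauto)
  refine ⟨?_, h2⟩
  by_cases hx : ∃ x ∈ (K a).erase f, x ∉ I ∧ linked K I g x
  swap
  · simp [h2 hx]
  obtain ⟨x, hxa, hxI, hxl⟩ := hx
  have hs' : ¬ (K a).erase f ⊆ I := fun h => hxI (h hxa)
  have hxg : x ≠ g := by rintro rfl; exact hga (Finset.mem_of_mem_erase hxa)
  set w := hterm K col I φ p f a with hw
  have hw0 : 0 ≤ w := hterm_nonneg hp f a
  have hnew : ∀ c', hterm K col (insert g I) (Function.update φ g c')
        (pn K col I φ g P μ p c') f a = w * (if kill K col I φ g x (col a x) c' then 0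
          else 1 + (1 - μ) * kp K col I φ g P x (col a x)) := by
    intro c'
    rw [hw]
    unfold hterm
    rw [if_neg hs', if_neg (by rwa [hiff]), ← Finset.mul_prod_erase _ _ hxa,
      ← Finset.mul_prod_erase _ (fun y => qv I φ p y (col a y)) hxa]
    have e2 : ∏ y ∈ ((K a).erase f).erase x,
          qv (insert g I) (Function.update φ g c') (pn K col I φ g P μ p c') y (col a y) =
          ∏ y ∈ ((K a).erase f).erase x, qv I φ p y (col a y) := by
      apply Finset.prod_congr rfl
      intro y hy
      apply hq c' y (Finset.mem_of_mem_erase hy)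
      by_contra hcon
      push Not at hcon
      obtain ⟨a1, u1, u2, u3⟩ := hcon.2
      obtain ⟨a2, v1, v2, v3⟩ := hxl
      simp only [Finset.mem_erase] at hy hxa
      exact hG.tri a a1 a2 y x g hy.1 hy.2.2 hxa.2 hga u1 u2 v1 v2
    rw [e2]
    have e1 : qv (insert g I) (Function.update φ g c') (pn K col I φ g P μ p c') x (col a x) =
      qv I φ p x (col a x) * (if kill K col I φ g x (col a x) c' then 0
          else 1 + (1 - μ) * kp K col I φ g P x (col a x)) := by
      unfold qv
      rw [if_neg (by simp [hxg, hxI]), if_neg hxI]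
      unfold pn
      ring
    rw [e1]; ring
  set κ := kp K col I φ g P x (col a x) with hκ
  have hκ0 : 0 ≤ κ := kp_nonneg hP _ _
  have hκ1 : κ ≤ 1 := kp_le_one hG hP hP1 hxg _
  have hμ0 : 0 ≤ μ := by linarith
  simp only [hnew]
  have key : ∀ c', P c' * ((w * (if kill K col I φ g x (col a x) c' then 0 else 1 + (1 - μ) * κ) - w)
      + η * |w * (if kill K col I φ g x (col a x) c' then 0 else 1 + (1 - μ) * κ) - w|) =
      (if kill K col I φ g x (col a x) c' then P c' else 0) * (w * (-1 + η - (1 + η) * ((1 - μ) * κ)))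
       + P c' * (w * ((1 + η) * ((1 - μ) * κ))) := by
    intro c'
    have h0 : 0 ≤ (1 - μ) * κ := mul_nonneg (by linarith) hκ0
    split_ifs
    · rw [mul_zero, zero_sub, abs_neg, abs_of_nonneg hw0]; ring
    · rw [abs_of_nonneg (by nlinarith)]; ring
  rw [Finset.sum_congr rfl (fun c' _ => key c'), Finset.sum_add_distrib, ← Finset.sum_mul,
    ← Finset.sum_mul, hP1]
  change κ * _ + _ ≤ 0
  have : κ * (w * (-1 + η - (1 + η) * ((1 - μ) * κ))) + 1 * (w * ((1 + η) * ((1 - μ) * κ))) =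
    w * κ * ((2 * η - μ) - η * μ - (1 + η) * ((1 - μ) * κ)) := by ring
  rw [this]
  apply mul_nonpos_of_nonneg_of_nonpos (mul_nonneg hw0 hκ0)
  have h0 : 0 ≤ (1 + η) * ((1 - μ) * κ) :=
    mul_nonneg (by linarith) (mul_nonneg (by linarith) hκ0)
  have : 0 ≤ η * μ := mul_nonneg hη hμ0
  linarith

/-- the kill probability is dominated -/
lemma kp_dom (hp : ∀ f c, 0 ≤ p f c) (hP : ∀ c, 0 ≤ P c)
    (hP2 : ∀ c, P c ≤ 2 * p g c) (hg : g ∉ I) {f : E} (hfg : f ≠ g) (c : Col) :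
    kp K col I φ g P f c ≤ ∑ a ∈ (FS K col f c).filter
      (fun a => g ∈ K a ∧ (K a).erase f ⊆ insert g I), (1 / 2) * hterm K col I φ p f a := by
  unfold kp
  set S := (FS K col f c).filter (fun a => g ∈ K a ∧ (K a).erase f ⊆ insert g I) with hS
  have hval : ∀ a ∈ S, hterm K col I φ p f a = 4 * p g (col a g) *
      ∏ y ∈ ((K a).erase f).erase g, qv I φ p y (col a y) := by
    intro a ha
    simp only [hS, FS, Finset.mem_filter, Finset.mem_univ, true_and] at ha
    obtain ⟨⟨h1, h2⟩, h3, h4⟩ := ha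
    have hgf : g ∈ (K a).erase f := by simp [h3, hfg.symm]
    unfold hterm
    rw [if_neg (fun h => hg (h hgf)), ← Finset.mul_prod_erase _ _ hgf]
    congr 1
    unfold qv; rw [if_neg hg]
  have h1 : ∀ c', (if kill K col I φ g f c c' then P c' else 0) ≤
      ∑ a ∈ S, if col a g = c' then P c' * ∏ y ∈ ((K a).erase f).erase g, qv I φ p y (col a y)
        else 0 := by
    intro c'
    have hnn : ∀ a ∈ S, (0:ℝ) ≤ if col a g = c' then P c' * ∏ y ∈ ((K a).erase f).erase g,
        qv I φ p y (col a y) else 0 := by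
      intro a _
      split_ifs
      · exact mul_nonneg (hP _) (Finset.prod_nonneg (fun y _ => qv_nonneg hp _ _))
      · exact le_rfl
    split_ifs with hk
    · obtain ⟨a, u1, u2, u3, u4, u5, u6⟩ := hk
      have haS : a ∈ S := by
        simp only [hS, FS, Finset.mem_filter, Finset.mem_univ, true_and]
        refine ⟨⟨u1, u5⟩, u2, ?_⟩
        intro y hy
        by_cases hyg : y = g
        · simp [hyg]
        · exact Finset.mem_insert_of_mem (u3 (Finset.mem_erase.2 ⟨hyg, hy⟩))
      refine le_trans ?_ (Finset.single_le_sum hnn haS)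
      rw [if_pos u6, Finset.prod_eq_one, mul_one]
      intro y hy
      unfold qv
      rw [if_pos (u3 hy), if_pos (u4 y hy)]
    · exact Finset.sum_nonneg hnn
  refine (Finset.sum_le_sum (fun c' _ => h1 c')).trans ?_
  rw [Finset.sum_comm]
  apply Finset.sum_le_sum
  intro a ha
  rw [Finset.sum_ite_eq]
  simp only [Finset.mem_univ, if_true]
  rw [hval a ha]
  have h3 : (0:ℝ) ≤ ∏ y ∈ ((K a).erase f).erase g, qv I φ p y (col a y) :=
    Finset.prod_nonneg (fun y _ => qv_nonneg hp _ _)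
  have := mul_le_mul_of_nonneg_right (hP2 (col a g)) h3
  linarith
lemma Wsum (hG : HG K col k) (hp : ∀ f c, 0 ≤ p f c) {B R : ℝ} (hB0 : 0 ≤ B)
    (hB : ∀ y, y ∉ I → ∀ c, p y c ≤ B) (hR : 4 * (Fintype.card Col : ℝ) * B ≤ R) (hR1 : 1 ≤ R)
    {f : E} {c : Col} (A : Finset ι) (K0 : Finset E) (hA : ∀ a ∈ A, K a = K0 ∧ col a f = c)
    (hf : f ∈ K0) : ∑ a ∈ A, hterm K col I φ p f a ≤ 4 * B * R ^ k := by
  have hRk : 0 ≤ 4 * B * R ^ k := by positivity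
  rcases A.eq_empty_or_nonempty with rfl | ⟨a0, ha0⟩
  · simpa using hRk
  by_cases hs : K0.erase f ⊆ I
  · rw [Finset.sum_eq_zero]
    · exact hRk
    · intro a ha
      unfold hterm
      rw [(hA a ha).1, if_pos hs]
  · obtain ⟨x, hx, hxI⟩ := Finset.not_subset.1 hs
    set S := (K0.erase f).erase x with hS
    have h1 : ∀ a ∈ A, hterm K col I φ p f a ≤ 4 * B * ∏ y ∈ S, qv I φ p y (col a y) := by
      intro a ha
      unfold hterm
      rw [(hA a ha).1, if_neg hs, ← Finset.mul_prod_erase _ _ hx]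
      apply mul_le_mul_of_nonneg_right
      · unfold qv; rw [if_neg hxI]; linarith [hB x hxI (col a x)]
      · exact Finset.prod_nonneg (fun y _ => qv_nonneg hp _ _)
    refine le_trans (Finset.sum_le_sum h1) ?_
    rw [← Finset.mul_sum]
    apply mul_le_mul_of_nonneg_left _ (by positivity)
    let j : ι → E → Col := fun a y => if y ∈ S then col a y else c
    let u : E → Col → ℝ := fun y c => if y ∈ S then qv I φ p y c else 1
    let T : E → Finset Col := fun y => if y ∈ S then Finset.univ else {c}
    have hu : ∀ y c, 0 ≤ u y c := by
      intro y c; simp only [u]; split_ifs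
      · exact qv_nonneg hp _ _
      · norm_num
    have hj : Set.InjOn j A := by
      intro a ha b hb hab
      have h2 : K a = K b := by rw [(hA a ha).1, (hA b hb).1]
      have hxK : x ∈ K a := by rw [(hA a ha).1]; exact Finset.mem_of_mem_erase hx
      apply hG.dag a b x h2 hxK
      intro y hy hyx
      by_cases hyf : y = f
      · rw [hyf, (hA a ha).2, (hA b hb).2]
      · have hyS : y ∈ S := by
          rw [hS]; simp only [Finset.mem_erase]
          exact ⟨hyx, hyf, by rw [← (hA a ha).1]; exact hy⟩
        have := congrFun hab y
        simpa [j, hyS] using this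
    have h2 : ∀ a, ∏ y ∈ S, qv I φ p y (col a y) = ∏ y, u y (j a y) := by
      intro a
      rw [← Finset.prod_subset (Finset.subset_univ S)]
      · apply Finset.prod_congr rfl
        intro y hy; simp [u, j, hy]
      · intro y _ hy; simp [u, hy]
    rw [Finset.sum_congr rfl (fun a _ => h2 a),
      ← Finset.sum_image (f := fun h : E → Col => ∏ y, u y (h y)) (g := j) hj]
    have h3 : A.image j ⊆ Fintype.piFinset T := by
      intro h hh
      obtain ⟨a, _, rfl⟩ := Finset.mem_image.1 hh
      rw [Fintype.mem_piFinset]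
      intro y
      by_cases hy : y ∈ S <;> simp [T, j, hy]
    refine le_trans (Finset.sum_le_sum_of_subset_of_nonneg h3
      (fun h _ _ => Finset.prod_nonneg (fun y _ => hu _ _))) ?_
    rw [← Finset.prod_univ_sum]
    have h4 : ∀ y, ∑ c ∈ T y, u y c ≤ if y ∈ S then R else 1 := by
      intro y
      by_cases hy : y ∈ S
      · simp only [T, u, hy, if_true]
        unfold qv
        by_cases hyI : y ∈ I
        · simp [hyI, hR1]
        · simp only [hyI, if_false]
          refine le_trans (Finset.sum_le_sum (fun c _ =>
            mul_le_mul_of_nonneg_left (hB y hyI c) (by norm_num))) ?_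
          simp only [Finset.sum_const, Finset.card_univ, nsmul_eq_mul]
          linarith
      · simp [T, u, hy]
    refine le_trans (Finset.prod_le_prod (fun y _ => Finset.sum_nonneg (fun c _ => hu _ _))
      (fun y _ => h4 y)) ?_
    rw [Finset.prod_ite_mem, Finset.univ_inter, Finset.prod_const]
    apply pow_le_pow_right₀ hR1
    refine le_trans (Finset.card_le_card (?_ : S ⊆ K0)) ?_
    · exact (Finset.erase_subset _ _).trans (Finset.erase_subset _ _)
    · rw [← (hA a0 ha0).1]; exact hG.le a0

lemma sum_same (hG : HG K col k) (hp : ∀ f c, 0 ≤ p f c) {B R : ℝ} (hB0 : 0 ≤ B)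
    (hB : ∀ y, y ∉ I → ∀ c, p y c ≤ B) (hR : 4 * (Fintype.card Col : ℝ) * B ≤ R) (hR1 : 1 ≤ R)
    {f : E} {c : Col} (A : Finset ι) (hA : A ⊆ FS K col f c)
    (hK : ∀ a ∈ A, ∀ b ∈ A, K a = K b) : ∑ a ∈ A, hterm K col I φ p f a ≤ 4 * B * R ^ k := by
  rcases A.eq_empty_or_nonempty with rfl | ⟨a0, ha0⟩
  · have hRk : 0 ≤ 4 * B * R ^ k := by positivity
    simpa using hRk
  · have h : ∀ a ∈ A, f ∈ K a ∧ col a f = c := by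
      intro a ha
      have := hA ha
      unfold FS at this
      simpa using this
    exact Wsum hG hp hB0 hB hR hR1 (c := c) A (K a0) (fun a ha => ⟨hK a ha a0 ha0, (h a ha).2⟩)
      (h a0 ha0).1

lemma pn_le (hG : HG K col k) (hp : ∀ f c, 0 ≤ p f c) (hP : ∀ c, 0 ≤ P c) (hP1 : ∑ c, P c = 1)
    (hμ0 : 0 ≤ μ) (hμ : μ ≤ 1) {f : E} (hfg : f ≠ g) (c c' : Col) :
    pn K col I φ g P μ p c' f c ≤ p f c * (1 + kp K col I φ g P f c) := by
  unfold pn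
  apply mul_le_mul_of_nonneg_left _ (hp _ _)
  have := kp_nonneg (K := K) (col := col) (I := I) (φ := φ) (g := g) hP f c
  split_ifs
  · linarith
  · nlinarith

lemma jump (hG : HG K col k) (hp : ∀ f c, 0 ≤ p f c) (hP : ∀ c, 0 ≤ P c) (hP1 : ∑ c, P c = 1)
    (hP2 : ∀ c, P c ≤ 2 * p g c) (hg : g ∉ I) {f : E} (hf : f ∉ I) (hfg : f ≠ g)
    (hμ0 : 0 ≤ μ) (hμ : μ ≤ 1) {B R : ℝ} (hB0 : 0 ≤ B)
    (hB : ∀ y, y ∉ I → ∀ c, p y c ≤ B) (hR : 8 * (Fintype.card Col : ℝ) * B ≤ R) (hR1 : 1 ≤ R)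
    (c c' : Col) :
    |kp K col I φ g P f c + Hs K col (insert g I) (Function.update φ g c')
        (pn K col I φ g P μ p c') f c - Hs K col I φ p f c| ≤ 34 * B * R ^ k := by
  have hκ0 := kp_nonneg (K := K) (col := col) (I := I) (φ := φ) (g := g) hP f c
  have hκ : kp K col I φ g P f c ≤ 2 * B :=
    kp_le hG (by linarith) (fun c => (hP2 c).trans (by linarith [hB g hg c])) hfg c
  have hRk : 1 ≤ R ^ k := one_le_pow₀ hR1
  set A := FS K col f c with hA
  have hAf : ∀ a ∈ A, f ∈ K a ∧ col a f = c := by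
    intro a ha
    rw [hA] at ha
    unfold FS at ha
    simpa using ha
  set A1 := A.filter (fun a => g ∈ K a) with hA1
  set A2 := A.filter (fun a => g ∉ K a ∧ ∃ x ∈ (K a).erase f, x ∉ I ∧ linked K I g x) with hA2
  have s1 : ∀ a ∈ A1, ∀ b ∈ A1, K a = K b := by
    intro a ha b hb
    rw [hA1, Finset.mem_filter] at ha hb
    exact hG.lin a b f g hfg (hAf a ha.1).1 ha.2 (hAf b hb.1).1 hb.2
  have s2 : ∀ a ∈ A2, ∀ b ∈ A2, K a = K b := by
    intro a ha b hb
    rw [hA2, Finset.mem_filter] at ha hb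
    obtain ⟨ha, hga, x, hx, hxI, a1, h1, h2, h3⟩ := ha
    obtain ⟨hb, hgb, x', hx', hxI', b1, h1', h2', h3'⟩ := hb
    rw [Finset.mem_erase] at hx hx'
    have n1 : f ∉ K a1 := fun h => hf (h3 (by simp [h, hfg, hx.1.symm]))
    have n2 : f ∉ K b1 := fun h => hf (h3' (by simp [h, hfg, hx'.1.symm]))
    exact hG.quad a b a1 b1 f x x' g (hAf a ha).1 (hAf b hb).1 hx.2 hx'.2 n1 n2 h1 h2 h1' h2'
      hga hgb
  have hp' : ∀ f c, 0 ≤ pn K col I φ g P μ p c' f c := fun f c => pn_nonneg hp hP hμ c' f c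
  have hB' : ∀ y, y ∉ insert g I → ∀ c, pn K col I φ g P μ p c' y c ≤ 2 * B := by
    intro y hy c
    rw [Finset.mem_insert, not_or] at hy
    refine (pn_le hG hp hP hP1 hμ0 hμ hy.1 c c').trans ?_
    have h1 := hB y hy.2 c
    have h2 := kp_le_one (I := I) (φ := φ) hG hP hP1 hy.1 c
    have h3 := hp y c
    nlinarith
  have hR' : 4 * (Fintype.card Col : ℝ) * B ≤ R := by
    have : 0 ≤ (Fintype.card Col : ℝ) * B := by positivity
    linarith
  have hR2 : 4 * (Fintype.card Col : ℝ) * (2 * B) ≤ R := by linarith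
  have sub1 : A1 ⊆ A := Finset.filter_subset _ _
  have sub2 : A2 ⊆ A := Finset.filter_subset _ _
  have b1 := sum_same (φ := φ) hG hp hB0 hB hR' hR1 A1 sub1 s1
  have b2 := sum_same (φ := φ) hG hp hB0 hB hR' hR1 A2 sub2 s2
  have b1' := sum_same (φ := Function.update φ g c') hG hp' (by linarith) hB' hR2 hR1 A1 sub1 s1
  have b2' := sum_same (φ := Function.update φ g c') hG hp' (by linarith) hB' hR2 hR1 A2 sub2 s2
  have key : |Hs K col (insert g I) (Function.update φ g c')
        (pn K col I φ g P μ p c') f c - Hs K col I φ p f c| ≤ 24 * B * R ^ k := by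
    unfold Hs
    rw [← hA, ← Finset.sum_sub_distrib]
    refine (Finset.abs_sum_le_sum_abs _ _).trans ?_
    set D : ι → ℝ := fun a => |hterm K col (insert g I) (Function.update φ g c')
        (pn K col I φ g P μ p c') f a - hterm K col I φ p f a| with hD
    have hle : ∀ a, D a ≤ hterm K col (insert g I) (Function.update φ g c')
        (pn K col I φ g P μ p c') f a + hterm K col I φ p f a := by
      intro a
      have h1 := hterm_nonneg (K := K) (col := col) (I := I) (φ := φ) hp f a
      have h2 := hterm_nonneg (K := K) (col := col) (I := insert g I)
        (φ := Function.update φ g c') hp' f a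
      simp only [hD]
      rw [abs_le]; constructor <;> linarith
    have hsplit : ∑ a ∈ A, D a ≤ ∑ a ∈ A1, D a + ∑ a ∈ A2, D a := by
      rw [← Finset.sum_filter_add_sum_filter_not A (fun a => g ∈ K a)]
      refine add_le_add le_rfl (le_of_eq ?_)
      symm
      apply Finset.sum_subset
      · intro a ha
        rw [hA2, Finset.mem_filter] at ha
        rw [Finset.mem_filter]; exact ⟨ha.1, ha.2.1⟩
      · intro a ha hn
        rw [Finset.mem_filter] at ha
        have := (stepB (φ := φ) (P := P) (p := p) (μ := μ) (η := 0) hG hp hP hP1 hf ha.2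
          (hAf a ha.1).1 le_rfl (by linarith) hμ).2
          (fun h => hn (by rw [hA2, Finset.mem_filter]; exact ⟨ha.1, ha.2, h⟩)) c'
        simp only [hD]
        rw [this]; simp
    refine hsplit.trans ?_
    have e1 := Finset.sum_le_sum (s := A1) (fun a _ => hle a)
    have e2 := Finset.sum_le_sum (s := A2) (fun a _ => hle a)
    rw [Finset.sum_add_distrib] at e1 e2
    linarith
  have t1 : 2 * B ≤ 2 * B * R ^ k := by nlinarith
  have t0 : 0 ≤ B * R ^ k := by positivity
  rw [abs_le] at key ⊢
  constructor <;> linarith [key.1, key.2]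

lemma exp_avg (P Δ : Col → ℝ) (hP : ∀ c, 0 ≤ P c) (hP1 : ∑ c, P c = 1) {l J : ℝ} (hl : 0 ≤ l)
    (hJ : ∀ c, |Δ c| ≤ J) (hlJ : l * J ≤ 1)
    (hE : ∑ c, P c * (Δ c + (l * J) * |Δ c|) ≤ 0) : ∑ c, P c * Real.exp (l * Δ c) ≤ 1 := by
  have h1 : ∀ c, Real.exp (l * Δ c) ≤ 1 + l * (Δ c + (l * J) * |Δ c|) := by
    intro c
    have ha : |l * Δ c| ≤ 1 := by
      rw [abs_mul, abs_of_nonneg hl]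
      exact (mul_le_mul_of_nonneg_left (hJ c) hl).trans hlJ
    have := (abs_le.1 (Real.abs_exp_sub_one_sub_id_le ha)).2
    have h2 : (l * Δ c) ^ 2 ≤ l * ((l * J) * |Δ c|) := by
      rw [← sq_abs, abs_mul, abs_of_nonneg hl]
      have : |Δ c| * |Δ c| ≤ J * |Δ c| := mul_le_mul_of_nonneg_right (hJ c) (abs_nonneg _)
      nlinarith [mul_nonneg hl hl]
    linarith
  calc ∑ c, P c * Real.exp (l * Δ c) ≤ ∑ c, P c * (1 + l * (Δ c + (l * J) * |Δ c|)) :=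
        Finset.sum_le_sum (fun c _ => mul_le_mul_of_nonneg_left (h1 c) (hP c))
    _ = ∑ c, P c + l * ∑ c, P c * (Δ c + (l * J) * |Δ c|) := by
        rw [Finset.mul_sum, ← Finset.sum_add_distrib]
        apply Finset.sum_congr rfl; intro c _; ring
    _ ≤ 1 := by rw [hP1]; nlinarith

lemma S_avg (hG : HG K col k) (hp : ∀ f c, 0 ≤ p f c) (hP : ∀ c, 0 ≤ P c) (hP1 : ∑ c, P c = 1)
    (hP2 : ∀ c, P c ≤ 2 * p g c) (hg : g ∉ I) {f : E} (hf : f ∉ I) (hfg : f ≠ g)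
    {B R l : ℝ} (hB0 : 0 ≤ B)
    (hB : ∀ y, y ∉ I → ∀ c, p y c ≤ B) (hR : 8 * (Fintype.card Col : ℝ) * B ≤ R) (hR1 : 1 ≤ R)
    (hl : 0 ≤ l) (hl3 : l * (34 * B * R ^ k) ≤ 1 / 3) (hμ : μ = 2 * (l * (34 * B * R ^ k)))
    (c : Col) :
    ∑ c', P c' * Real.exp (l * (kp K col I φ g P f c + Hs K col (insert g I)
      (Function.update φ g c') (pn K col I φ g P μ p c') f c - Hs K col I φ p f c)) ≤ 1 := by
  set J := 34 * B * R ^ k with hJ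
  have hJ0 : 0 ≤ J := by rw [hJ]; positivity
  have hη0 : 0 ≤ l * J := mul_nonneg hl hJ0
  apply exp_avg P _ hP hP1 hl (J := J) _ (by linarith)
  · set η := l * J with hη
    set A := FS K col f c with hA
    have hAf : ∀ a ∈ A, f ∈ K a ∧ col a f = c := by
      intro a ha
      rw [hA] at ha
      unfold FS at ha
      simpa using ha
    set κ := kp K col I φ g P f c with hκ
    have hκ0 : 0 ≤ κ := kp_nonneg hP f c
    set h' : Col → ι → ℝ := fun c' a => hterm K col (insert g I) (Function.update φ g c')
        (pn K col I φ g P μ p c') f a - hterm K col I φ p f a with hh'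
    have e1 : ∀ c', κ + Hs K col (insert g I)
      (Function.update φ g c') (pn K col I φ g P μ p c') f c - Hs K col I φ p f c =
        κ + ∑ a ∈ A, h' c' a := by
      intro c'
      simp only [hh']
      rw [Finset.sum_sub_distrib]
      unfold Hs
      ring
    simp only [e1]
    have e2 : ∀ c', P c' * (κ + ∑ a ∈ A, h' c' a + η * |κ + ∑ a ∈ A, h' c' a|) ≤
        P c' * ((1 + η) * κ) + ∑ a ∈ A, P c' * (h' c' a + η * |h' c' a|) := by
      intro c'
      rw [← Finset.mul_sum, ← mul_add]
      apply mul_le_mul_of_nonneg_left _ (hP c')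
      have a1 : |κ + ∑ a ∈ A, h' c' a| ≤ κ + ∑ a ∈ A, |h' c' a| := by
        refine (abs_add_le _ _).trans ?_
        rw [abs_of_nonneg hκ0]
        gcongr
        exact Finset.abs_sum_le_sum_abs _ _
      rw [Finset.sum_add_distrib, ← Finset.mul_sum]
      nlinarith [mul_le_mul_of_nonneg_left a1 hη0]
    refine (Finset.sum_le_sum (fun c' _ => e2 c')).trans ?_
    rw [Finset.sum_add_distrib, ← Finset.sum_mul, hP1, one_mul, Finset.sum_comm]
    have e3 : ∀ a ∈ A, ∑ c', P c' * (h' c' a + η * |h' c' a|) ≤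
        if g ∈ K a ∧ (K a).erase f ⊆ insert g I then - (1 - η) * hterm K col I φ p f a else 0 := by
      intro a ha
      by_cases hga : g ∈ K a
      · simpa [hga] using stepA (φ := φ) (μ := μ) hG hp hP hP1 hP2 hg hf hfg (hAf a ha).1 hga hη0 hl3
      · simpa [hga] using (stepB (φ := φ) (μ := μ) (p := p) hG hp hP hP1 hf hga (hAf a ha).1 hη0
          hμ.symm.le (by linarith)).1
    have e4 := Finset.sum_le_sum e3
    rw [← Finset.sum_filter, ← Finset.mul_sum] at e4
    have e5 := kp_dom (I := I) (φ := φ) (K := K) (col := col) hp hP hP2 hg hfg c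
    rw [← hκ, ← hA, ← Finset.mul_sum] at e5
    nlinarith
  · intro c'
    exact jump hG hp hP hP1 hP2 hg hf hfg (by linarith) (by linarith) hB0 hB hR hR1 c c'
lemma Z_avg (hG : HG K col k) (hp : ∀ f c, 0 ≤ p f c) (hP : ∀ c, 0 ≤ P c) (hP1 : ∑ c, P c = 1)
    (hP2 : ∀ c, P c ≤ 2 * p g c) (hg : g ∉ I) {f : E} (hf : f ∉ I) (hfg : f ≠ g)
    {B l : ℝ} (hB0 : 0 ≤ B) (hB : ∀ y, y ∉ I → ∀ c, p y c ≤ B) (hμ0 : 0 ≤ μ) (hμ : μ ≤ 1)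
    (hl : 0 ≤ l) (hlB : 2 * l * B ≤ 1) :
    ∑ c', P c' * Real.exp (-(l * (∑ c, pn K col I φ g P μ p c' f c - ∑ c, p f c))) ≤
      Real.exp ((l * B * (μ + 2 * B) + 4 * l ^ 2 * B ^ 2) * ∑ c, kp K col I φ g P f c) := by
  set κ : Col → ℝ := fun c => kp K col I φ g P f c with hκ
  have hκ0 : ∀ c, 0 ≤ κ c := fun c => kp_nonneg hP f c
  have hκ1 : ∑ c, κ c ≤ 1 := sum_kp_le hG hP hP1 hfg
  have hκB : ∀ c, κ c ≤ 2 * B := fun c =>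
    kp_le hG (by linarith) (fun c => (hP2 c).trans (by linarith [hB g hg c])) hfg c
  let kl : Col → Col → ℝ := fun c c' => if kill K col I φ g f c c' then 1 else 0
  have hkl0 : ∀ c c', 0 ≤ kl c c' := by intro c c'; simp only [kl]; split_ifs <;> norm_num
  have hkl1 : ∀ c', ∑ c, kl c c' ≤ 1 := by
    intro c'
    by_cases h : ∃ c, kill K col I φ g f c c'
    · obtain ⟨c1, h1⟩ := h
      rw [Finset.sum_eq_single c1]
      · simp [kl, h1]
      · intro b _ hb
        simp only [kl]
        rw [if_neg (fun hk => hb (kill_uniq' hG hfg hk h1))]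
      · simp
    · push Not at h
      simp [kl, h]
  have hklκ : ∀ c, ∑ c', P c' * kl c c' = κ c := by
    intro c
    simp only [kl, hκ, kp]
    apply Finset.sum_congr rfl
    intro c' _
    split_ifs <;> simp
  have hΔ : ∀ c', ∑ c, pn K col I φ g P μ p c' f c - ∑ c, p f c =
      ∑ c, p f c * ((1 - kl c c') * (1 - μ) * κ c - kl c c') := by
    intro c'
    rw [← Finset.sum_sub_distrib]
    apply Finset.sum_congr rfl
    intro c _
    simp only [pn, kl, hκ]
    split_ifs <;> ring
  set Δ : Col → ℝ := fun c' => ∑ c, pn K col I φ g P μ p c' f c - ∑ c, p f c with hΔd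
  have hkl1' : ∀ c c', kl c c' ≤ 1 := by intro c c'; simp only [kl]; split_ifs <;> norm_num
  have habs : ∀ c', |Δ c'| ≤ B * ∑ c, (kl c c' + κ c) := by
    intro c'
    simp only [hΔd, hΔ]
    refine (Finset.abs_sum_le_sum_abs _ _).trans ?_
    rw [Finset.mul_sum]
    apply Finset.sum_le_sum
    intro c _
    rw [abs_mul, abs_of_nonneg (hp f c)]
    apply mul_le_mul (hB f hf c) _ (abs_nonneg _) hB0
    have h1 : 0 ≤ (1 - kl c c') * (1 - μ) :=
      mul_nonneg (by linarith [hkl1' c c']) (by linarith)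
    have h2 : (1 - kl c c') * (1 - μ) ≤ 1 := by
      have := hkl0 c c'
      have := hkl1' c c'
      nlinarith
    have h3 := mul_nonneg h1 (hκ0 c)
    have h4 := mul_le_mul_of_nonneg_right h2 (hκ0 c)
    rw [abs_le]; constructor <;> linarith [hkl0 c c', hκ0 c]
  have habs2 : ∀ c', |Δ c'| ≤ 2 * B := by
    intro c'
    refine (habs c').trans ?_
    rw [Finset.sum_add_distrib]
    nlinarith [hkl1 c']
  have hEabs : ∑ c', P c' * |Δ c'| ≤ 2 * B * ∑ c, κ c := by
    calc ∑ c', P c' * |Δ c'| ≤ ∑ c', P c' * (B * ∑ c, (kl c c' + κ c)) :=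
          Finset.sum_le_sum (fun c' _ => mul_le_mul_of_nonneg_left (habs c') (hP c'))
      _ = B * (∑ c, ∑ c', P c' * kl c c' + (∑ c', P c') * ∑ c, κ c) := by
          rw [Finset.sum_comm, Finset.sum_mul, ← Finset.sum_add_distrib, Finset.mul_sum]
          apply Finset.sum_congr rfl
          intro c' _
          rw [Finset.sum_add_distrib, ← Finset.mul_sum]; ring
      _ = 2 * B * ∑ c, κ c := by
          rw [hP1, Finset.sum_congr rfl (fun c _ => hklκ c)]; ring
  have hEΔ : -(B * (μ + 2 * B) * ∑ c, κ c) ≤ ∑ c', P c' * Δ c' := by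
    have h1 : ∑ c', P c' * Δ c' = ∑ c, p f c * ((1 - κ c) * (1 - μ) * κ c - κ c) := by
      simp only [hΔd, hΔ, Finset.mul_sum]
      rw [Finset.sum_comm]
      apply Finset.sum_congr rfl
      intro c _
      have : ∀ c', P c' * (p f c * ((1 - kl c c') * (1 - μ) * κ c - kl c c')) =
          p f c * ((1 - μ) * κ c) * P c' - p f c * ((1 - μ) * κ c + 1) * (P c' * kl c c') := by
        intro c'; ring
      rw [Finset.sum_congr rfl (fun c' _ => this c'), Finset.sum_sub_distrib, ← Finset.mul_sum,
        ← Finset.mul_sum, hP1, hklκ]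
      ring
    rw [h1, Finset.mul_sum, ← Finset.sum_neg_distrib]
    apply Finset.sum_le_sum
    intro c _
    have h2 : p f c * (κ c * (μ + κ c)) ≤ B * (κ c * (μ + 2 * B)) := by
      apply mul_le_mul (hB f hf c) _ _ hB0
      · exact mul_le_mul_of_nonneg_left (by linarith [hκB c]) (hκ0 c)
      · exact mul_nonneg (hκ0 c) (by linarith [hκ0 c])
    have h3 : 0 ≤ p f c * (μ * κ c * κ c) :=
      mul_nonneg (hp f c) (mul_nonneg (mul_nonneg hμ0 (hκ0 c)) (hκ0 c))
    nlinarith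
  have hexp : ∀ c', Real.exp (-(l * Δ c')) ≤ 1 - l * Δ c' + l ^ 2 * (2 * B) * |Δ c'| := by
    intro c'
    have ha : |-(l * Δ c')| ≤ 1 := by
      rw [abs_neg, abs_mul, abs_of_nonneg hl]
      nlinarith [mul_le_mul_of_nonneg_left (habs2 c') hl]
    have := (abs_le.1 (Real.abs_exp_sub_one_sub_id_le ha)).2
    have h2 : (-(l * Δ c')) ^ 2 ≤ l ^ 2 * (2 * B) * |Δ c'| := by
      rw [← sq_abs, abs_neg, abs_mul, abs_of_nonneg hl]
      have : |Δ c'| * |Δ c'| ≤ 2 * B * |Δ c'| :=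
        mul_le_mul_of_nonneg_right (habs2 c') (abs_nonneg _)
      nlinarith [sq_nonneg l]
    linarith
  calc ∑ c', P c' * Real.exp (-(l * Δ c'))
      ≤ ∑ c', P c' * (1 - l * Δ c' + l ^ 2 * (2 * B) * |Δ c'|) :=
        Finset.sum_le_sum (fun c' _ => mul_le_mul_of_nonneg_left (hexp c') (hP c'))
    _ = ∑ c', P c' - l * ∑ c', P c' * Δ c' + l ^ 2 * (2 * B) * ∑ c', P c' * |Δ c'| := by
        rw [Finset.mul_sum, Finset.mul_sum, ← Finset.sum_sub_distrib, ← Finset.sum_add_distrib]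
        apply Finset.sum_congr rfl; intro c' _; ring
    _ ≤ (l * B * (μ + 2 * B) + 4 * l ^ 2 * B ^ 2) * ∑ c, κ c + 1 := by
        rw [hP1]
        have h5 := mul_le_mul_of_nonneg_left hEΔ hl
        have h6 := mul_le_mul_of_nonneg_left hEabs (by positivity : 0 ≤ l ^ 2 * (2 * B))
        nlinarith
    _ ≤ _ := Real.add_one_le_exp _

noncomputable def pot (K : ι → Finset E) (col : ι → E → Col) (l l' τ Y : ℝ) (I : Finset E)
    (φ : E → Col) (p L : E → Col → ℝ) : ℝ :=
  ∑ f ∈ Iᶜ, Real.exp (l' / 2 + 1 - l' * ∑ c, p f c - τ * ∑ c, L f c) +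
    ∑ f ∈ Iᶜ, ∑ c, Real.exp (l * (L f c + Hs K col I φ p f c - Y))

structure InvP (K : ι → Finset E) (col : ι → E → Col) (l l' τ Y : ℝ) (I : Finset E)
    (φ : E → Col) (p L : E → Col → ℝ) : Prop where
  pos : ∀ f c, 0 ≤ p f c
  Lpos : ∀ f c, 0 ≤ L f c
  le : ∀ f, f ∉ I → ∀ c, p f c ≤ Real.exp (L f c) / Fintype.card Col
  alive : ∀ f, f ∉ I → ∀ a, f ∈ K a → (K a).erase f ⊆ I → (∀ y ∈ (K a).erase f, φ y = col a y) →
    p f (col a f) = 0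
  nomat : ∀ a, K a ⊆ I → ∃ y ∈ K a, φ y ≠ col a y
  pot_lt : pot K col l l' τ Y I φ p L < 1

lemma InvP_step (hG : HG K col k) (ht : 0 < Fintype.card Col) {l l' τ X B R : ℝ} (hX : 1 ≤ X)
    (hl : 0 < l) (hl' : 0 < l') (hBd : B = X / Fintype.card Col) (hRd : R = 8 * X)
    (hμ : μ = 2 * (l * (34 * B * R ^ k))) (hτ : τ = l' * B * (μ + 2 * B) + 4 * l' ^ 2 * B ^ 2)
    (h1 : l * (34 * B * R ^ k) ≤ 1 / 3) (h2 : 2 * l' * B ≤ 1)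
    (h3 : τ * Fintype.card Col * Real.log X ≤ 1) {L : E → Col → ℝ} (hg : g ∉ I)
    (hI : InvP K col l l' τ (Real.log X) I φ p L) :
    ∃ φ' p' L', InvP K col l l' τ (Real.log X) (insert g I) φ' p' L' := by
  have htR : (0 : ℝ) < Fintype.card Col := by exact_mod_cast ht
  have hX0 : 0 < X := by linarith
  have hB0 : 0 ≤ B := by rw [hBd]; positivity
  have hR1 : 1 ≤ R := by rw [hRd]; linarith
  have hJ0 : 0 ≤ l * (34 * B * R ^ k) := by positivity
  have hμ0 : 0 ≤ μ := by linarith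
  have hμ1 : μ ≤ 1 := by linarith
  have hτ0 : 0 ≤ τ := by rw [hτ]; positivity
  have hpot := hI.pot_lt
  unfold pot at hpot
  have s1 : 0 ≤ ∑ f ∈ Iᶜ, Real.exp (l' / 2 + 1 - l' * ∑ c, p f c - τ * ∑ c, L f c) :=
    Finset.sum_nonneg (fun _ _ => (Real.exp_pos _).le)
  have s2 : 0 ≤ ∑ f ∈ Iᶜ, ∑ c, Real.exp (l * (L f c + Hs K col I φ p f c - Real.log X)) :=
    Finset.sum_nonneg (fun _ _ => Finset.sum_nonneg (fun _ _ => (Real.exp_pos _).le))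
  have hHs : ∀ f c, 0 ≤ Hs K col I φ p f c := fun f c =>
    Finset.sum_nonneg (fun a _ => hterm_nonneg hI.pos f a)
  have hL : ∀ f, f ∉ I → ∀ c, L f c ≤ Real.log X := by
    intro f hf c
    have : Real.exp (l * (L f c + Hs K col I φ p f c - Real.log X)) < 1 := by
      refine lt_of_le_of_lt ?_ (lt_of_le_of_lt (le_add_of_nonneg_left s1) hpot)
      refine le_trans ?_ (Finset.single_le_sum (f := fun f => ∑ c, Real.exp (l * (L f c +
        Hs K col I φ p f c - Real.log X))) (fun _ _ => Finset.sum_nonneg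
          (fun _ _ => (Real.exp_pos _).le)) (Finset.mem_compl.2 hf))
      exact Finset.single_le_sum (f := fun c => Real.exp (l * (L f c +
        Hs K col I φ p f c - Real.log X))) (fun _ _ => (Real.exp_pos _).le) (Finset.mem_univ c)
    rw [Real.exp_lt_one_iff] at this
    have := neg_of_mul_neg_right this hl.le
    linarith [hHs f c]
  have hZ : ∀ f, f ∉ I → 1 / 2 ≤ ∑ c, p f c := by
    intro f hf
    have : Real.exp (l' / 2 + 1 - l' * ∑ c, p f c - τ * ∑ c, L f c) < 1 := by
      refine lt_of_le_of_lt ?_ (lt_of_le_of_lt (le_add_of_nonneg_right s2) hpot)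
      exact Finset.single_le_sum (f := fun f => Real.exp (l' / 2 + 1 - l' * ∑ c, p f c -
        τ * ∑ c, L f c)) (fun _ _ => (Real.exp_pos _).le) (Finset.mem_compl.2 hf)
    rw [Real.exp_lt_one_iff] at this
    have h4 : ∑ c, L f c ≤ Fintype.card Col * Real.log X := by
      refine (Finset.sum_le_sum (fun c _ => hL f hf c)).trans ?_
      simp
    have h5 := mul_le_mul_of_nonneg_left h4 hτ0
    have h6 : l' * (1 / 2) < l' * ∑ c, p f c := by linarith
    exact (lt_of_mul_lt_mul_left h6 hl'.le).le
  have hB : ∀ y, y ∉ I → ∀ c, p y c ≤ B := by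
    intro y hy c
    refine (hI.le y hy c).trans ?_
    rw [hBd]
    apply div_le_div_of_nonneg_right _ htR.le
    rw [← Real.exp_log hX0]
    exact Real.exp_le_exp.2 (hL y hy c)
  set P : Col → ℝ := fun c => p g c / ∑ c, p g c with hPd
  have hZg := hZ g hg
  have hP : ∀ c, 0 ≤ P c := fun c => div_nonneg (hI.pos g c) (by linarith)
  have hP1 : ∑ c, P c = 1 := by
    simp only [hPd]
    rw [← Finset.sum_div, div_self]
    linarith
  have hP2 : ∀ c, P c ≤ 2 * p g c := by
    intro c
    simp only [hPd]
    rw [div_le_iff₀ (by linarith)]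
    have := hI.pos g c
    nlinarith
  set L' : E → Col → ℝ := fun f c => L f c + kp K col I φ g P f c with hL'
  have hR8 : 8 * (Fintype.card Col : ℝ) * B ≤ R := by
    rw [hBd, hRd]
    field_simp
    exact le_rfl
  set F : Col → ℝ := fun c' => pot K col l l' τ (Real.log X) (insert g I) (Function.update φ g c')
    (pn K col I φ g P μ p c') L' with hF
  have havg : ∑ c', P c' * F c' < 1 := by
    refine lt_of_le_of_lt ?_ hpot
    have hsub : (insert g I)ᶜ ⊆ Iᶜ := Finset.compl_subset_compl.2 (Finset.subset_insert _ _)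
    have e0 : ∑ c', P c' * F c' = ∑ f ∈ (insert g I)ᶜ, ∑ c', P c' * Real.exp (l' / 2 + 1 -
          l' * ∑ c, pn K col I φ g P μ p c' f c - τ * ∑ c, L' f c) +
        ∑ f ∈ (insert g I)ᶜ, ∑ c, ∑ c', P c' * Real.exp (l * (L' f c + Hs K col (insert g I)
          (Function.update φ g c') (pn K col I φ g P μ p c') f c - Real.log X)) := by
      have e1 : ∀ f, ∑ c, ∑ c', P c' * Real.exp (l * (L' f c + Hs K col (insert g I)
          (Function.update φ g c') (pn K col I φ g P μ p c') f c - Real.log X)) =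
          ∑ c', ∑ c, P c' * Real.exp (l * (L' f c + Hs K col (insert g I)
          (Function.update φ g c') (pn K col I φ g P μ p c') f c - Real.log X)) :=
        fun f => Finset.sum_comm
      rw [Finset.sum_congr rfl (fun f _ => e1 f), Finset.sum_comm,
        Finset.sum_comm (s := (insert g I)ᶜ), ← Finset.sum_add_distrib]
      apply Finset.sum_congr rfl
      intro c' _
      simp only [hF, pot, mul_add, Finset.mul_sum]
    rw [e0]
    apply add_le_add
    · refine le_trans (Finset.sum_le_sum ?_) (Finset.sum_le_sum_of_subset_of_nonneg hsub
        (fun _ _ _ => (Real.exp_pos _).le))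
      intro f hf
      rw [Finset.mem_compl, Finset.mem_insert, not_or] at hf
      have hz := Z_avg (φ := φ) hG hI.pos hP hP1 hP2 hg hf.2 hf.1 hB0 hB hμ0 hμ1 hl'.le h2
      rw [← hτ] at hz
      have e2 : ∀ c', P c' * Real.exp (l' / 2 + 1 -
          l' * ∑ c, pn K col I φ g P μ p c' f c - τ * ∑ c, L' f c) =
          Real.exp (l' / 2 + 1 - l' * ∑ c, p f c - τ * ∑ c, L' f c) *
          (P c' * Real.exp (-(l' * (∑ c, pn K col I φ g P μ p c' f c - ∑ c, p f c)))) := by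
        intro c'
        rw [mul_left_comm, ← Real.exp_add]
        congr 2; ring
      rw [Finset.sum_congr rfl (fun c' _ => e2 c'), ← Finset.mul_sum]
      refine (mul_le_mul_of_nonneg_left hz (Real.exp_pos _).le).trans ?_
      rw [← Real.exp_add]
      apply Real.exp_le_exp.2
      simp only [hL', Finset.sum_add_distrib]
      linarith
    · refine le_trans (Finset.sum_le_sum ?_) (Finset.sum_le_sum_of_subset_of_nonneg hsub
        (fun _ _ _ => Finset.sum_nonneg (fun _ _ => (Real.exp_pos _).le)))
      intro f hf
      rw [Finset.mem_compl, Finset.mem_insert, not_or] at hf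
      apply Finset.sum_le_sum
      intro c _
      have hs := S_avg (φ := φ) hG hI.pos hP hP1 hP2 hg hf.2 hf.1 hB0 hB hR8 hR1 hl.le h1 hμ c
      have e2 : ∀ c', P c' * Real.exp (l * (L' f c + Hs K col (insert g I)
          (Function.update φ g c') (pn K col I φ g P μ p c') f c - Real.log X)) =
          Real.exp (l * (L f c + Hs K col I φ p f c - Real.log X)) *
          (P c' * Real.exp (l * (kp K col I φ g P f c + Hs K col (insert g I)
      (Function.update φ g c') (pn K col I φ g P μ p c') f c - Hs K col I φ p f c))) := by
        intro c'
        rw [mul_left_comm, ← Real.exp_add]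
        congr 2; simp only [hL']; ring
      rw [Finset.sum_congr rfl (fun c' _ => e2 c'), ← Finset.mul_sum]
      exact mul_le_of_le_one_right (Real.exp_pos _).le hs
  obtain ⟨c', hc', hFc⟩ : ∃ c', 0 < P c' ∧ F c' < 1 := by
    by_contra hcon
    push Not at hcon
    have : ∑ c', P c' ≤ ∑ c', P c' * F c' := by
      apply Finset.sum_le_sum
      intro c _
      rcases (hP c).eq_or_lt with h | h
      · rw [← h]; simp
      · nlinarith [hcon c h]
    linarith
  have hpc' : p g c' ≠ 0 := by
    intro h
    simp only [hPd, h, zero_div, lt_irrefl] at hc'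
  refine ⟨Function.update φ g c', pn K col I φ g P μ p c', L', ?_, ?_, ?_, ?_, ?_, hFc⟩
  · exact fun f c => pn_nonneg hI.pos hP hμ1 c' f c
  · exact fun f c => add_nonneg (hI.Lpos f c) (kp_nonneg hP f c)
  · intro f hf c
    rw [Finset.mem_insert, not_or] at hf
    refine (pn_le hG hI.pos hP hP1 hμ0 hμ1 hf.1 c c').trans ?_
    simp only [hL']
    rw [Real.exp_add, mul_div_right_comm]
    apply mul_le_mul (hI.le f hf.2 c) _ _ (by positivity)
    · linarith [Real.add_one_le_exp (kp K col I φ g P f c)]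
    · linarith [kp_nonneg (K := K) (col := col) (I := I) (φ := φ) (g := g) hP f c]
  · intro f hf a hfa hsub hm
    rw [Finset.mem_insert, not_or] at hf
    unfold pn
    by_cases hga : g ∈ K a
    · have : kill K col I φ g f (col a f) c' := by
        refine ⟨a, hfa, hga, ?_, ?_, rfl, ?_⟩
        · intro y hy
          rw [Finset.mem_erase] at hy
          exact Finset.mem_of_mem_insert_of_ne (hsub hy.2) hy.1
        · intro y hy
          rw [Finset.mem_erase] at hy
          rw [← hm y hy.2, Function.update_of_ne hy.1]
        · rw [← hm g (by simp [hga, hf.1, Ne.symm hf.1])]; simp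
      rw [if_pos this, mul_zero]
    · have hne : ∀ y ∈ (K a).erase f, y ≠ g := by
        intro y hy hyg
        rw [hyg] at hy
        exact hga (Finset.mem_of_mem_erase hy)
      rw [hI.alive f hf.2 a hfa (fun y hy => Finset.mem_of_mem_insert_of_ne (hsub hy) (hne y hy))
        (fun y hy => by rw [← hm y hy, Function.update_of_ne (hne y hy)]), zero_mul]
  · intro a ha
    by_cases hga : g ∈ K a
    · by_contra hcon
      push Not at hcon
      have hcg : c' = col a g := by rw [← hcon g hga]; simp
      apply hpc'
      rw [hcg]
      apply hI.alive g hg a hga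
      · intro y hy
        rw [Finset.mem_erase] at hy
        exact Finset.mem_of_mem_insert_of_ne (ha hy.2) hy.1
      · intro y hy
        rw [Finset.mem_erase] at hy
        rw [← hcon y hy.2, Function.update_of_ne hy.1]
    · have hne : ∀ y ∈ K a, y ≠ g := by
        intro y hy hyg
        rw [hyg] at hy
        exact hga hy
      obtain ⟨y, hy, hyc⟩ := hI.nomat a
        (fun y hy => Finset.mem_of_mem_insert_of_ne (ha hy) (hne y hy))
      exact ⟨y, hy, by rwa [Function.update_of_ne (hne y hy)]⟩

theorem phase_two (hG : HG K col k) (ht : 0 < Fintype.card Col) {l l' τ X B R D0 : ℝ} (hX : 1 ≤ X)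
    (hl : 0 < l) (hl' : 0 < l') (hBd : B = X / Fintype.card Col) (hRd : R = 8 * X)
    (hμ : μ = 2 * (l * (34 * B * R ^ k))) (hτ : τ = l' * B * (μ + 2 * B) + 4 * l' ^ 2 * B ^ 2)
    (h1 : l * (34 * B * R ^ k) ≤ 1 / 3) (h2 : 2 * l' * B ≤ 1)
    (h3 : τ * Fintype.card Col * Real.log X ≤ 1)
    (h4 : Fintype.card E * Real.exp (1 - l' / 2) ≤ 1 / 4)
    (h5 : Fintype.card E * Fintype.card Col * Real.exp (l * (D0 - Real.log X)) ≤ 1 / 4)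
    (h6 : ∀ f c, ∑ a ∈ FS K col f c, (4 / (Fintype.card Col : ℝ)) ^ ((K a).card - 1) ≤ D0) :
    ∃ φ : E → Col, ∀ a, ∃ y ∈ K a, φ y ≠ col a y := by
  have htR : (0 : ℝ) < Fintype.card Col := by exact_mod_cast ht
  obtain ⟨c0⟩ : Nonempty Col := Fintype.card_pos_iff.1 ht
  have main : ∀ I : Finset E, ∃ φ p L, InvP K col l l' τ (Real.log X) I φ p L := by
    intro I
    induction I using Finset.induction_on with
    | empty =>
      refine ⟨fun _ => c0, fun _ _ => 1 / Fintype.card Col, fun _ _ => 0, ?_, ?_, ?_, ?_, ?_, ?_⟩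
      · intro f c; positivity
      · intro f c; exact le_rfl
      · intro f _ c; simp
      · intro f _ a hfa hs
        exfalso
        have := hG.two a
        have h7 := Finset.card_le_card hs
        rw [Finset.card_erase_of_mem hfa] at h7
        simp at h7
        omega
      · intro a ha
        have := hG.two a
        have h7 := Finset.card_le_card ha
        simp at h7
        rw [h7] at this
        simp at this
      · unfold pot
        have b1 : ∑ f ∈ (∅ : Finset E)ᶜ, Real.exp (l' / 2 + 1 - l' * ∑ c : Col,
            (1 / (Fintype.card Col : ℝ)) - τ * ∑ c : Col, 0) ≤ 1 / 4 := by
          refine le_trans (le_of_eq ?_) h4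
          rw [Finset.sum_const, Finset.compl_empty, Finset.card_univ, nsmul_eq_mul]
          congr 2
          simp only [Finset.sum_const, Finset.card_univ, nsmul_eq_mul]
          field_simp
          ring
        have b2 : ∑ f ∈ (∅ : Finset E)ᶜ, ∑ c, Real.exp (l * (0 + Hs K col ∅ (fun _ => c0)
            (fun _ _ => 1 / (Fintype.card Col : ℝ)) f c - Real.log X)) ≤ 1 / 4 := by
          refine le_trans ?_ h5
          have : ∀ f ∈ (∅ : Finset E)ᶜ, ∑ c, Real.exp (l * (0 + Hs K col ∅ (fun _ => c0)
            (fun _ _ => 1 / (Fintype.card Col : ℝ)) f c - Real.log X)) ≤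
              Fintype.card Col * Real.exp (l * (D0 - Real.log X)) := by
            intro f _
            have : ∀ c ∈ (Finset.univ : Finset Col), Real.exp (l * (0 + Hs K col ∅ (fun _ => c0)
              (fun _ _ => 1 / (Fintype.card Col : ℝ)) f c - Real.log X)) ≤
                Real.exp (l * (D0 - Real.log X)) := by
              intro c _
              apply Real.exp_le_exp.2
              apply mul_le_mul_of_nonneg_left _ hl.le
              have : Hs K col ∅ (fun _ => c0) (fun _ _ => 1 / (Fintype.card Col : ℝ)) f c ≤ D0 := by
                refine le_trans (Finset.sum_le_sum ?_) (h6 f c)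
                intro a ha
                unfold hterm
                unfold FS at ha
                simp only [Finset.mem_filter, Finset.mem_univ, true_and] at ha
                split_ifs
                · positivity
                · simp only [qv, Finset.notMem_empty, if_false, Finset.prod_const]
                  rw [Finset.card_erase_of_mem ha.1, mul_one_div]
              linarith
            refine (Finset.sum_le_sum this).trans ?_
            simp
          refine (Finset.sum_le_sum this).trans ?_
          simp [mul_assoc]
        linarith
    | insert g I hg ih =>
      obtain ⟨φ, p, L, hI⟩ := ih
      exact InvP_step hG ht hX hl hl' hBd hRd hμ hτ h1 h2 h3 hg hI
  obtain ⟨φ, p, L, hI⟩ := main Finset.univ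
  exact ⟨φ, fun a => hI.nomat a (Finset.subset_univ _)⟩
end PhaseTwo
section Structure

/-- edges of the complete graph -/
abbrev Ed (n : ℕ) : Type := {e : Finset (Fin n) // e.card = 2}

def ET {n : ℕ} (T : Finset (Fin n)) : Finset (Ed n) := Finset.univ.filter (fun e => e.1 ⊆ T)

lemma mem_ET {n : ℕ} {T : Finset (Fin n)} {e : Ed n} : e ∈ ET T ↔ e.1 ⊆ T := by simp [ET]

lemma ET_mono {n : ℕ} {T T' : Finset (Fin n)} (h : T ⊆ T') : ET T ⊆ ET T' := by
  intro e he
  rw [mem_ET] at *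
  exact he.trans h

lemma mem_ET_inter {n : ℕ} {T T' : Finset (Fin n)} {e : Ed n} (h : e ∈ ET T) (h' : e ∈ ET T') :
    e ∈ ET (T ∩ T') := by
  rw [mem_ET] at *
  exact Finset.subset_inter h h'

lemma two_edges {n : ℕ} {T : Finset (Fin n)} {e f : Ed n} (h : e ∈ ET T) (h' : f ∈ ET T)
    (hne : e ≠ f) : 3 ≤ T.card := by
  rw [mem_ET] at *
  by_contra hc
  have h1 : T.card ≤ 2 := by omega
  apply hne
  apply Subtype.ext
  rw [Finset.eq_of_subset_of_card_le h (by rw [e.2]; exact h1),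
    Finset.eq_of_subset_of_card_le h' (by rw [f.2]; exact h1)]

lemma two_le_of_mem {n : ℕ} {T : Finset (Fin n)} {e : Ed n} (h : e ∈ ET T) : 2 ≤ T.card := by
  rw [mem_ET] at h
  rw [← e.2]; exact Finset.card_le_card h

lemma card_ET {n : ℕ} (T : Finset (Fin n)) : (ET T).card = T.card.choose 2 := by
  rw [← Finset.card_powersetCard]
  apply Finset.card_bij (fun e _ => e.1)
  · intro e he
    rw [mem_ET] at he
    rw [Finset.mem_powersetCard]; exact ⟨he, e.2⟩
  · intro a _ b _ h; exact Subtype.ext h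
  · intro a ha
    rw [Finset.mem_powersetCard] at ha
    exact ⟨⟨a, ha.2⟩, mem_ET.2 ha.1, rfl⟩

def null {E C : Type} [DecidableEq C] (b : E → C) (X : Finset E) : ℕ := X.card - (X.image b).card

lemma null_add {E C : Type} [DecidableEq C] (b : E → C) (X : Finset E) :
    null b X + (X.image b).card = X.card := by
  unfold null
  have := Finset.card_image_le (s := X) (f := b)
  omega

lemma null_super {E C : Type} [DecidableEq E] [DecidableEq C] (b : E → C) (X Y : Finset E) :
    null b X + null b Y ≤ null b (X ∪ Y) + null b (X ∩ Y) := by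
  have h1 := null_add b X
  have h2 := null_add b Y
  have h3 := null_add b (X ∪ Y)
  have h4 := null_add b (X ∩ Y)
  have h5 := Finset.card_union_add_card_inter X Y
  have h6 := Finset.card_union_add_card_inter (X.image b) (Y.image b)
  have h7 := Finset.card_le_card (Finset.image_inter_subset b X Y)
  rw [Finset.image_union] at h3
  omega

lemma null_mono {E C : Type} [DecidableEq E] [DecidableEq C] (b : E → C) {X Y : Finset E}
    (h : X ⊆ Y) : null b X ≤ null b Y := by
  have h1 := null_super b X (Y \ X)
  have h3 : X ∪ (Y \ X) = Y := by rw [Finset.union_sdiff_of_subset h]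
  have h4 : null b (X ∩ (Y \ X)) = 0 := by
    unfold null
    rw [Finset.inter_sdiff_self]; simp
  rw [h3, h4] at h1
  omega

lemma null_le_pair {E C : Type} [DecidableEq E] [DecidableEq C] (b : E → C) {X : Finset E}
    {u v : E} (h : X ⊆ {u, v}) : null b X ≤ 1 := by
  have h1 := Finset.card_le_card h
  have h2 := Finset.card_le_two (a := u) (b := v)
  have h3 := null_add b X
  rcases X.eq_empty_or_nonempty with rfl | hne
  · simp at h3; omega
  · have : 1 ≤ (X.image b).card := Finset.card_pos.2 (hne.image b)
    omega

lemma null_small {E C : Type} [DecidableEq C] (b : E → C) {X : Finset E}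
    (h : X.card ≤ 1) : null b X = 0 := by
  have h3 := null_add b X
  rcases X.eq_empty_or_nonempty with rfl | hne
  · simp at h3; omega
  · have : 1 ≤ (X.image b).card := Finset.card_pos.2 (hne.image b)
    omega

lemma card_ET_le_one {n : ℕ} {T : Finset (Fin n)} (h : T.card ≤ 2) : (ET T).card ≤ 1 := by
  rw [card_ET]
  exact (Nat.choose_le_choose 2 h).trans (by simp)

/-- `b` is good -/
def Good (N s Pm : ℕ) {n : ℕ} {C : Type} [DecidableEq C] (b : Ed n → C) : Prop :=
  ∀ T : Finset (Fin n), 2 ≤ T.card → T.card ≤ Pm → N * null b (ET T) + 2 * s ≤ s * T.card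

structure TypeC (N s p : ℕ) {n : ℕ} {C : Type} [DecidableEq C] (b : Ed n → C)
    (T : Finset (Fin n)) : Prop where
  three : 3 ≤ T.card
  le : T.card ≤ p
  eq : N * null b (ET T) + 2 * s = s * T.card
  strict : ∀ T', T' ⊂ T → 3 ≤ T'.card → N * null b (ET T') + 2 * s < s * T'.card

variable {N s p n : ℕ} {C : Type} [DecidableEq C] {b : Ed n → C}

lemma TypeC.two_le_null (hs : 0 < s) (hnd : ¬ s ∣ N) {T : Finset (Fin n)}
    (h : TypeC N s p b T) : 2 ≤ null b (ET T) := by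
  by_contra hc
  have h1 := h.eq
  have h2 := h.three
  obtain ⟨m, hm⟩ := Nat.exists_eq_add_of_le h2
  rw [hm] at h1
  have h3 : null b (ET T) = 0 ∨ null b (ET T) = 1 := by omega
  rcases h3 with h3 | h3
  · rw [h3] at h1; nlinarith
  · rw [h3] at h1
    apply hnd
    exact ⟨m + 1, by nlinarith⟩

lemma chain (hg : Good N s (4 * p) b) {X : Finset (Ed n)} {V T : Finset (Fin n)} (hX : X ⊆ ET V)
    (ht : s * V.card ≤ N * null b X + 2 * s) (hT : TypeC N s p b T) (hN : 0 < N)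
    (hc : (V ∪ T).card ≤ 4 * p) {e e' : Ed n} (hne : e ≠ e') (he : e ∈ X) (he' : e' ∈ X)
    (heT : e ∈ ET T) (heT' : e' ∈ ET T) : null b (ET T) ≤ null b (X ∩ ET T) := by
  have h1 := null_super b X (ET T)
  have hsub : X ∪ ET T ⊆ ET (V ∪ T) := Finset.union_subset
    (hX.trans (ET_mono Finset.subset_union_left)) (ET_mono Finset.subset_union_right)
  have h2 := null_mono b hsub
  have h3 := hg (V ∪ T) ((by have := hT.three; omega : 2 ≤ T.card).trans
    (Finset.card_le_card Finset.subset_union_right)) hc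
  have hin : X ∩ ET T ⊆ ET (V ∩ T) := by
    intro y hy
    rw [Finset.mem_inter] at hy
    exact mem_ET_inter (hX hy.1) hy.2
  have h4 := null_mono b hin
  have h6 := Finset.card_union_add_card_inter V T
  by_cases hTV : T ⊆ V
  · rw [Finset.union_eq_left.2 hTV] at h3 h2
    by_contra hcon
    have h5 : null b X + 1 ≤ null b (ET V) := by omega
    nlinarith
  · exfalso
    have hss : V ∩ T ⊂ T := by
      rw [Finset.ssubset_iff_subset_ne]
      exact ⟨Finset.inter_subset_right, fun h => hTV (Finset.inter_eq_right.1 h)⟩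
    have h5 := hT.strict _ hss (two_edges (mem_ET_inter (hX he) heT)
      (mem_ET_inter (hX he') heT') hne)
    have h7 := hT.eq
    have h8 : N * null b X + N * null b (ET T) ≤
        N * null b (ET (V ∪ T)) + N * null b (ET (V ∩ T)) := by
      rw [← mul_add, ← mul_add]
      exact Nat.mul_le_mul_left _ (by omega)
    have h9 : s * (V ∪ T).card + s * (V ∩ T).card = s * V.card + s * T.card := by
      rw [← mul_add, ← mul_add, h6]
    omega

lemma typeC_inter (hg : Good N s (4 * p) b) {T T' : Finset (Fin n)} (hT : TypeC N s p b T)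
    (hT' : TypeC N s p b T') (hN : 0 < N) (hs : 0 < s) (hnd : ¬ s ∣ N) (h : 3 ≤ (T ∩ T').card) :
    T = T' := by
  by_contra hne
  have h1 := null_super b (ET T) (ET T')
  have hsub : ET T ∪ ET T' ⊆ ET (T ∪ T') := Finset.union_subset
    (ET_mono Finset.subset_union_left) (ET_mono Finset.subset_union_right)
  have h2 := null_mono b hsub
  have hcard := Finset.card_union_le T T'
  have a1 := hT.le
  have a2 := hT'.le
  have a3 := hT.three
  have h3 := hg (T ∪ T') ((by omega : 2 ≤ T.card).trans
    (Finset.card_le_card Finset.subset_union_left)) (by omega)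
  have hin : ET T ∩ ET T' ⊆ ET (T ∩ T') := by
    intro y hy
    rw [Finset.mem_inter] at hy
    exact mem_ET_inter hy.1 hy.2
  have h4 := null_mono b hin
  have h6 := Finset.card_union_add_card_inter T T'
  have h5 : N * null b (ET (T ∩ T')) + 2 * s < s * (T ∩ T').card := by
    by_cases hTT : T' ⊆ T
    · have hss : T' ⊂ T := Finset.ssubset_iff_subset_ne.2 ⟨hTT, fun h => hne h.symm⟩
      rw [Finset.inter_eq_right.2 hTT]
      exact hT.strict _ hss hT'.three
    · apply hT'.strict _ _ h
      rw [Finset.ssubset_iff_subset_ne]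
      exact ⟨Finset.inter_subset_right, fun h => hTT (Finset.inter_eq_right.1 h)⟩
  have h7 := hT.eq
  have h7' := hT'.eq
  have h8 : N * null b (ET T) + N * null b (ET T') ≤
      N * null b (ET (T ∪ T')) + N * null b (ET (T ∩ T')) := by
    rw [← mul_add, ← mul_add]
    exact Nat.mul_le_mul_left _ (by omega)
  have h9 : s * (T ∪ T').card + s * (T ∩ T').card = s * T.card + s * T'.card := by
    rw [← mul_add, ← mul_add, h6]
  omega

lemma typeC_share (hg : Good N s (4 * p) b) {T T' : Finset (Fin n)} (hT : TypeC N s p b T)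
    (hT' : TypeC N s p b T') (hN : 0 < N) (hs : 0 < s) (hnd : ¬ s ∣ N) {e e' : Ed n}
    (hne : T ≠ T') (h1 : e ∈ ET T) (h2 : e ∈ ET T') (h3 : e' ∈ ET T) (h4 : e' ∈ ET T') :
    e = e' := by
  by_contra hc
  exact hne (typeC_inter hg hT hT' hN hs hnd
    (two_edges (mem_ET_inter h1 h2) (mem_ET_inter h3 h4) hc))

lemma attach (hg : Good N s (4 * p) b) {X : Finset (Ed n)} {V T : Finset (Fin n)} (hX : X ⊆ ET V)
    (ht : s * V.card ≤ N * null b X + 2 * s) (hT : TypeC N s p b T) (hN : 0 < N) (hs : 0 < s)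
    (hnd : ¬ s ∣ N)
    (hc : (V ∪ T).card ≤ 4 * p) {e : Ed n} (he : e ∈ X)
    (heT : e ∈ ET T) (huniq : ∀ y ∈ X, y ∈ ET T → y = e) :
    X ∪ ET T ⊆ ET (V ∪ T) ∧ s * (V ∪ T).card ≤ N * null b (X ∪ ET T) + 2 * s := by
  have h1 := null_super b X (ET T)
  have hsub : X ∪ ET T ⊆ ET (V ∪ T) := Finset.union_subset
    (hX.trans (ET_mono Finset.subset_union_left)) (ET_mono Finset.subset_union_right)
  have h2 := null_mono b hsub
  have h3 := hg (V ∪ T) ((by have := hT.three; omega : 2 ≤ T.card).trans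
    (Finset.card_le_card Finset.subset_union_right)) hc
  have h4 : null b (X ∩ ET T) = 0 := by
    apply null_small
    rw [Finset.card_le_one]
    intro u hu v hv
    rw [Finset.mem_inter] at hu hv
    rw [huniq u hu.1 hu.2, huniq v hv.1 hv.2]
  have h6 := Finset.card_union_add_card_inter V T
  have h10 := hT.two_le_null hs hnd
  have h7 := hT.eq
  have h8 : N * null b X + N * null b (ET T) ≤ N * null b (X ∪ ET T) := by
    rw [← mul_add]
    exact Nat.mul_le_mul_left _ (by omega)
  have h9 : s * (V ∪ T).card + s * (V ∩ T).card = s * V.card + s * T.card := by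
    rw [← mul_add, ← mul_add, h6]
  have h11 : 2 ≤ (V ∩ T).card := two_le_of_mem (mem_ET_inter (hX he) heT)
  have h12 : s * 2 ≤ s * (V ∩ T).card := Nat.mul_le_mul_left _ h11
  exact ⟨hsub, by omega⟩

lemma tri_T (hg : Good N s (4 * p) b) (hN : 0 < N) (hs : 0 < s) (hnd : ¬ s ∣ N)
    {T T1 T2 : Finset (Fin n)} (hT : TypeC N s p b T) (hT1 : TypeC N s p b T1)
    (hT2 : TypeC N s p b T2) (h1 : T1 ≠ T) (h2 : T2 ≠ T) {x x' g : Ed n} (hxx : x ≠ x')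
    (hgx' : g ≠ x') (a1 : x ∈ ET T) (a2 : x' ∈ ET T) (a3 : x ∈ ET T1)
    (a4 : g ∈ ET T1) (a5 : x' ∈ ET T2) (a6 : g ∈ ET T2) : False := by
  have h12 : T1 ≠ T2 := by
    intro h
    rw [← h] at a5
    exact hxx (typeC_share hg hT1 hT hN hs hnd h1 a3 a1 a5 a2)
  have l0 := hT.le
  have l1 := hT1.le
  have l2 := hT2.le
  have c1 := Finset.card_union_le T T1
  have c2 := Finset.card_union_le (T ∪ T1) T2
  obtain ⟨t1, t2⟩ := attach hg (subset_refl (ET T)) (by have := hT.eq; omega) hT1 hN hs hnd (by omega)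
    a1 a3 (fun y hy hy1 => typeC_share hg hT1 hT hN hs hnd h1 hy1 hy a3 a1)
  have h3 := chain hg t1 t2 hT2 hN (by omega) hgx' (Finset.mem_union_right _ a4)
    (Finset.mem_union_left _ a2) a6 a5
  have h4 : (ET T ∪ ET T1) ∩ ET T2 ⊆ {x', g} := by
    intro y hy
    rw [Finset.mem_inter, Finset.mem_union] at hy
    rw [Finset.mem_insert, Finset.mem_singleton]
    rcases hy.1 with h | h
    · left; exact typeC_share hg hT2 hT hN hs hnd h2 hy.2 h a5 a2
    · right; exact typeC_share hg hT1 hT2 hN hs hnd h12 h hy.2 a4 a6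
  have := null_le_pair b h4
  have := hT2.two_le_null hs hnd
  omega

lemma quad_T (hg : Good N s (4 * p) b) (hN : 0 < N) (hs : 0 < s) (hnd : ¬ s ∣ N)
    {T T' T1 T1' : Finset (Fin n)} (hT : TypeC N s p b T) (hT' : TypeC N s p b T')
    (hT1 : TypeC N s p b T1) (hT1' : TypeC N s p b T1') {f x x' g : Ed n}
    (n1 : T1 ≠ T) (n2 : T1 ≠ T') (n3 : T1' ≠ T) (n4 : T1' ≠ T') (hfx : f ≠ x) (hfx' : f ≠ x')
    (hgx : g ≠ x) (hgx' : g ≠ x')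
    (a1 : f ∈ ET T) (a2 : f ∈ ET T') (a3 : x ∈ ET T) (a4 : x' ∈ ET T') (a5 : x ∈ ET T1)
    (a6 : g ∈ ET T1) (a7 : x' ∈ ET T1') (a8 : g ∈ ET T1') : T = T' := by
  by_contra hne
  have hxx : x ≠ x' := by
    intro h
    rw [← h] at a4
    exact hfx (typeC_share hg hT hT' hN hs hnd hne a1 a2 a3 a4)
  have h11 : T1 ≠ T1' := by
    intro h
    rw [← h] at a7
    exact tri_T hg hN hs hnd hT1 hT hT' n1.symm n2.symm hxx hfx' a5 a7 a3 a1 a4 a2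
  have l0 := hT.le
  have l1 := hT1.le
  have l2 := hT1'.le
  have l3 := hT'.le
  have c1 := Finset.card_union_le T T1
  have c2 := Finset.card_union_le (T ∪ T1) T1'
  have c3 := Finset.card_union_le (T ∪ T1 ∪ T1') T'
  have c4 := Finset.card_union_le (T ∪ T1) T'
  obtain ⟨t1, t2⟩ := attach hg (subset_refl (ET T)) (by have := hT.eq; omega) hT1 hN hs hnd (by omega)
    a3 a5 (fun y hy hy1 => typeC_share hg hT1 hT hN hs hnd n1 hy1 hy a5 a3)
  have huniq : ∀ y ∈ ET T ∪ ET T1, y ∈ ET T1' → y = g := by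
    intro y hy hy1
    by_contra hyg
    have h3 := chain hg t1 t2 hT1' hN (by omega) hyg hy (Finset.mem_union_right _ a6) hy1 a8
    have hyT : y ∈ ET T := by
      rcases Finset.mem_union.1 hy with h | h
      · exact h
      · exact absurd (typeC_share hg hT1 hT1' hN hs hnd h11 h hy1 a6 a8) hyg
    have h4 : (ET T ∪ ET T1) ∩ ET T1' ⊆ {y, g} := by
      intro z hz
      rw [Finset.mem_inter, Finset.mem_union] at hz
      rw [Finset.mem_insert, Finset.mem_singleton]
      rcases hz.1 with h | h
      · left; exact typeC_share hg hT1' hT hN hs hnd n3 hz.2 h hy1 hyT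
      · right; exact typeC_share hg hT1 hT1' hN hs hnd h11 h hz.2 a6 a8
    have := null_le_pair b h4
    have := hT1'.two_le_null hs hnd
    omega
  obtain ⟨u1, u2⟩ := attach hg t1 t2 hT1' hN hs hnd (by omega) (Finset.mem_union_right _ a6) a8 huniq
  have h3 := chain hg u1 u2 hT' hN (by omega) hfx'
    (Finset.mem_union_left _ (Finset.mem_union_left _ a1)) (Finset.mem_union_right _ a7) a2 a4
  have h4 : (ET T ∪ ET T1 ∪ ET T1') ∩ ET T' ⊆ {f, x'} := by
    intro z hz
    rw [Finset.mem_inter, Finset.mem_union, Finset.mem_union] at hz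
    rw [Finset.mem_insert, Finset.mem_singleton]
    rcases hz.1 with (h | h) | h
    · left; exact typeC_share hg hT hT' hN hs hnd hne h hz.2 a1 a2
    · left
      by_contra hzf
      have h5 := chain hg t1 t2 hT' hN (by omega) hzf
        (Finset.mem_union_right _ h) (Finset.mem_union_left _ a1) hz.2 a2
      have h6 : (ET T ∪ ET T1) ∩ ET T' ⊆ {f, z} := by
        intro w hw
        rw [Finset.mem_inter, Finset.mem_union] at hw
        rw [Finset.mem_insert, Finset.mem_singleton]
        rcases hw.1 with h' | h'
        · left; exact typeC_share hg hT hT' hN hs hnd hne h' hw.2 a1 a2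
        · right; exact typeC_share hg hT1 hT' hN hs hnd n2 h' hw.2 h hz.2
      have := null_le_pair b h6
      have := hT'.two_le_null hs hnd
      omega
    · right; exact typeC_share hg hT1' hT' hN hs hnd n4 h hz.2 a7 a4
  have := null_le_pair b h4
  have := hT'.two_le_null hs hnd
  omega

end Structure

section Bridge

open scoped Classical

variable {N s p n : ℕ} {C Col : Type} [DecidableEq C] [Fintype Col] [DecidableEq Col]

noncomputable def KT (b : Ed n → C) (T : Finset (Fin n)) : Finset (Ed n) :=
  (ET T).filter (fun e => ∃ e' ∈ ET T, e' ≠ e ∧ b e' = b e)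

abbrev Idx (N s p : ℕ) (b : Ed n → C) (c0 : Col) : Type :=
  {a : Finset (Fin n) × (Ed n → Col) // TypeC N s p b a.1 ∧ (∀ e, e ∉ KT b a.1 → a.2 e = c0) ∧
    ∀ e ∈ KT b a.1, ∀ e' ∈ KT b a.1, b e = b e' → a.2 e = a.2 e'}

noncomputable instance instFinIdx (N s p : ℕ) (b : Ed n → C) (c0 : Col) :
    Fintype (Idx N s p b c0) := Fintype.ofFinite _

lemma KT_sub (b : Ed n → C) (T : Finset (Fin n)) : KT b T ⊆ ET T := Finset.filter_subset _ _

lemma null_KT (b : Ed n → C) (T : Finset (Fin n)) : null b (ET T) ≤ null b (KT b T) := by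
  have h1 := null_add b (ET T)
  have h2 := null_add b (KT b T)
  have h3 := Finset.card_sdiff_add_card_eq_card (KT_sub b T)
  have h4 : ((ET T \ KT b T).image b).card = (ET T \ KT b T).card := by
    rw [Finset.card_image_iff]
    intro e he e' he' h
    simp only [Finset.coe_sdiff, Set.mem_sdiff, Finset.mem_coe] at he he'
    by_contra hne
    apply he.2
    unfold KT
    rw [Finset.mem_filter]
    exact ⟨he.1, e', he'.1, fun h => hne h.symm, h.symm⟩
  have h5 : Disjoint ((ET T \ KT b T).image b) ((KT b T).image b) := by
    rw [Finset.disjoint_left]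
    intro c hc hc'
    obtain ⟨e, he, rfl⟩ := Finset.mem_image.1 hc
    obtain ⟨e', he', h⟩ := Finset.mem_image.1 hc'
    rw [Finset.mem_sdiff] at he
    apply he.2
    unfold KT
    rw [Finset.mem_filter]
    refine ⟨he.1, e', KT_sub b T he', ?_, h⟩
    intro hh
    rw [hh] at he'
    exact he.2 he'
  have h6 : (ET T \ KT b T).image b ∪ (KT b T).image b ⊆ (ET T).image b := by
    rw [← Finset.image_union, Finset.sdiff_union_of_subset (KT_sub b T)]
  have h7 := Finset.card_le_card h6
  rw [Finset.card_union_of_disjoint h5] at h7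
  omega

lemma KT_two {b : Ed n → C} {T : Finset (Fin n)} (h : 0 < null b (ET T)) :
    2 ≤ (KT b T).card := by
  have h1 := null_KT b T
  have h2 := null_add b (KT b T)
  rcases (KT b T).eq_empty_or_nonempty with h3 | h3
  · rw [h3] at h2; simp at h2; rw [h3] at h1; omega
  · have : 1 ≤ ((KT b T).image b).card := Finset.card_pos.2 (h3.image b)
    omega

lemma KT_partner {b : Ed n → C} {T : Finset (Fin n)} {e : Ed n} (h : e ∈ KT b T) :
    ∃ e' ∈ KT b T, e' ≠ e ∧ b e' = b e := by
  have h' := h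
  unfold KT at h'
  rw [Finset.mem_filter] at h'
  obtain ⟨h1, e', h2, h3, h4⟩ := h'
  refine ⟨e', ?_, h3, h4⟩
  unfold KT
  rw [Finset.mem_filter]
  exact ⟨h2, e, h1, h3.symm, h4.symm⟩

lemma HG_Idx {b : Ed n → C} {c0 : Col} (hg : Good N s (4 * p) b) (hN : 0 < N) (hs : 0 < s)
    (hnd : ¬ s ∣ N) :
    HG (ι := Idx N s p b c0) (fun a => KT b a.1.1) (fun a => a.1.2) (p ^ 2) := by
  have hsame : ∀ (a a' : Idx N s p b c0) (f g : Ed n), f ≠ g → f ∈ KT b a.1.1 → g ∈ KT b a.1.1 →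
      f ∈ KT b a'.1.1 → g ∈ KT b a'.1.1 → a.1.1 = a'.1.1 := by
    intro a a' f g hfg h1 h2 h3 h4
    by_contra hne
    exact hfg (typeC_share hg a.2.1 a'.2.1 hN hs hnd hne (KT_sub _ _ h1) (KT_sub _ _ h3)
      (KT_sub _ _ h2) (KT_sub _ _ h4))
  refine ⟨?_, ?_, ?_, ?_, ?_, ?_⟩
  · intro a
    exact KT_two (by have := a.2.1.two_le_null hs hnd; omega)
  · intro a
    refine (Finset.card_le_card (KT_sub _ _)).trans ?_
    rw [card_ET]
    refine (Nat.choose_le_pow _ _).trans ?_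
    exact Nat.pow_le_pow_left a.2.1.le 2
  · intro a a' x hK hx hy
    have h2 := KT_two (b := b) (T := a.1.1) (by have := a.2.1.two_le_null hs hnd; omega)
    obtain ⟨u, hu, v, hv, huv⟩ := Finset.one_lt_card.1 (show 1 < _ from h2)
    have hT : a.1.1 = a'.1.1 := hsame a a' u v huv hu hv (hK ▸ hu) (hK ▸ hv)
    apply Subtype.ext
    apply Prod.ext hT
    funext e
    by_cases he : e ∈ KT b a.1.1
    · by_cases hex : e = x
      · rw [hex]
        obtain ⟨y, hy1, hy2, hy3⟩ := KT_partner hx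
        rw [← a.2.2.2 y hy1 x hx hy3,
          ← a'.2.2.2 y (by rw [← hT]; exact hy1) x (by rw [← hT]; exact hx) hy3]
        exact hy y hy1 hy2
      · exact hy e he hex
    · rw [a.2.2.1 e he, a'.2.2.1 e (by rw [← hT]; exact he)]
  · intro a a' f g hfg h1 h2 h3 h4
    rw [show KT b a.1.1 = KT b a'.1.1 from by rw [hsame a a' f g hfg h1 h2 h3 h4]]
  · intro a a1 a2 x x' g hxx h1 h2 h3 h4 h5 h6 h7
    apply tri_T hg hN hs hnd a.2.1 a1.2.1 a2.2.1 (x := x) (x' := x') (g := g) _ _ hxx _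
      (KT_sub _ _ h1) (KT_sub _ _ h2) (KT_sub _ _ h4) (KT_sub _ _ h5) (KT_sub _ _ h6)
      (KT_sub _ _ h7)
    · intro h; simp only [h] at h5; exact h3 h5
    · intro h; simp only [h] at h7; exact h3 h7
    · intro h; rw [h] at h3; exact h3 h2
  · intro a a' a1 a1' f x x' g h1 h2 h3 h4 h5 h6 h7 h8 h9 h10 h11 h12
    have : a.1.1 = a'.1.1 := by
      apply quad_T hg hN hs hnd a.2.1 a'.2.1 a1.2.1 a1'.2.1 (f := f) (x := x) (x' := x') (g := g)
        _ _ _ _ _ _ _ _ (KT_sub _ _ h1) (KT_sub _ _ h2) (KT_sub _ _ h3) (KT_sub _ _ h4)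
        (KT_sub _ _ h7) (KT_sub _ _ h8) (KT_sub _ _ h9) (KT_sub _ _ h10)
      · intro h; simp only [h] at h5; exact h5 h1
      · intro h; simp only [h] at h5; exact h5 h2
      · intro h; simp only [h] at h6; exact h6 h1
      · intro h; simp only [h] at h6; exact h6 h2
      · intro h; rw [h] at h5; exact h5 h7
      · intro h; rw [h] at h6; exact h6 h9
      · intro h; rw [h] at h11; exact h11 h3
      · intro h; rw [h] at h12; exact h12 h4
    simp only [this]

lemma fiber_card {b : Ed n → C} {c0 : Col} (f : Ed n) (c : Col) (T : Finset (Fin n))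
    (hfT : f ∈ KT b T) (A : Finset (Idx N s p b c0))
    (hA : ∀ a ∈ A, a.1.1 = T ∧ a.1.2 f = c) :
    A.card ≤ Fintype.card Col ^ (((KT b T).image b).card - 1) := by
  set D := ((KT b T).image b).erase (b f) with hD
  have hDc : D.card = ((KT b T).image b).card - 1 :=
    Finset.card_erase_of_mem (Finset.mem_image_of_mem b hfT)
  have hrep : ∀ d : D, ∃ e ∈ KT b T, b e = d.1 := by
    intro d
    have := Finset.mem_of_mem_erase d.2
    obtain ⟨e, he, h⟩ := Finset.mem_image.1 this
    exact ⟨e, he, h⟩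
  choose r hr1 hr2 using hrep
  have : A.card ≤ (Finset.univ : Finset (D → Col)).card := by
    apply Finset.card_le_card_of_injOn (fun a d => a.1.2 (r d))
    · intro a _; simp
    · intro a ha a' ha' h
      obtain ⟨e1, e2⟩ := hA a ha
      obtain ⟨e1', e2'⟩ := hA a' ha'
      apply Subtype.ext
      apply Prod.ext (e1.trans e1'.symm)
      funext e
      have q1 := a.2.2
      have q2 := a'.2.2
      rw [e1] at q1
      rw [e1'] at q2
      by_cases he : e ∈ KT b T
      · by_cases hef : b e = b f
        · rw [q1.2 e he f hfT hef, q2.2 e he f hfT hef, e2, e2']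
        · have hd : b e ∈ D := by
            rw [hD, Finset.mem_erase]
            exact ⟨hef, Finset.mem_image_of_mem b he⟩
          rw [q1.2 e he (r ⟨b e, hd⟩) (hr1 _) (hr2 ⟨b e, hd⟩).symm,
            q2.2 e he (r ⟨b e, hd⟩) (hr1 _) (hr2 ⟨b e, hd⟩).symm]
          exact congrFun h ⟨b e, hd⟩
      · rw [q1.1 e he, q2.1 e he]
  rw [Finset.card_univ, Fintype.card_fun, Fintype.card_coe, hDc] at this
  exact this

lemma wdeg {b : Ed n → C} {c0 : Col} (f : Ed n) (c : Col) :
    ∑ a ∈ FS (ι := Idx N s p b c0) (fun a => KT b a.1.1) (fun a => a.1.2) f c,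
      (4 / (Fintype.card Col : ℝ)) ^ ((KT b a.1.1).card - 1) ≤
    ∑ T ∈ Finset.univ.filter (fun T => TypeC N s p b T ∧ f ∈ ET T),
      4 ^ (p ^ 2) / (Fintype.card Col : ℝ) ^ (null b (ET T)) := by
  have ht : (1 : ℝ) ≤ Fintype.card Col := by
    have : 0 < Fintype.card Col := Fintype.card_pos_iff.2 ⟨c0⟩
    exact_mod_cast this
  set A := FS (ι := Idx N s p b c0) (fun a => KT b a.1.1) (fun a => a.1.2) f c with hA
  have hAm : ∀ a ∈ A, f ∈ KT b a.1.1 ∧ a.1.2 f = c := by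
    intro a ha
    rw [hA] at ha
    unfold FS at ha
    simpa using ha
  rw [← Finset.sum_fiberwise_of_maps_to (s := A) (g := fun a => a.1.1)
    (t := Finset.univ.filter (fun T => TypeC N s p b T ∧ f ∈ ET T))]
  · apply Finset.sum_le_sum
    intro T hT
    rw [Finset.mem_filter] at hT
    by_cases hfT : f ∈ KT b T
    · have h1 := fiber_card (N := N) (s := s) (p := p) (c0 := c0) f c T hfT
        (A.filter (fun a => a.1.1 = T)) (by
          intro a ha
          rw [Finset.mem_filter] at ha
          exact ⟨ha.2, (hAm a ha.1).2⟩)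
      have h2 : ∑ a ∈ A.filter (fun a => a.1.1 = T),
          (4 / (Fintype.card Col : ℝ)) ^ ((KT b a.1.1).card - 1) =
          (A.filter (fun a => a.1.1 = T)).card * (4 / (Fintype.card Col : ℝ)) ^ ((KT b T).card - 1) := by
        rw [← nsmul_eq_mul, ← Finset.sum_const]
        apply Finset.sum_congr rfl
        intro a ha
        rw [Finset.mem_filter] at ha
        rw [ha.2]
      rw [h2]
      have h3 : ((A.filter (fun a => a.1.1 = T)).card : ℝ) ≤
          (Fintype.card Col : ℝ) ^ (((KT b T).image b).card - 1) := by exact_mod_cast h1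
      refine (mul_le_mul_of_nonneg_right h3 (by positivity)).trans ?_
      have h4 := null_add b (KT b T)
      have h5 := null_KT b T
      have h6 : 1 ≤ ((KT b T).image b).card := Finset.card_pos.2 ⟨b f, Finset.mem_image_of_mem b hfT⟩
      have h7 : (KT b T).card - 1 = (((KT b T).image b).card - 1) + null b (KT b T) := by omega
      have h8 : (KT b T).card - 1 ≤ p ^ 2 := by
        have := Finset.card_le_card (KT_sub b T)
        rw [card_ET] at this
        have h9 := Nat.choose_le_pow T.card 2
        have h10 := Nat.pow_le_pow_left hT.2.1.le 2
        omega
      rw [div_pow, mul_div_assoc', div_le_div_iff₀ (by positivity) (by positivity)]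
      have e1 : (Fintype.card Col : ℝ) ^ ((KT b T).card - 1) =
          (Fintype.card Col : ℝ) ^ (((KT b T).image b).card - 1) *
          (Fintype.card Col : ℝ) ^ (null b (KT b T)) := by rw [h7, pow_add]
      rw [e1]
      have e2 : (4 : ℝ) ^ ((KT b T).card - 1) ≤ 4 ^ (p ^ 2) := pow_le_pow_right₀ (by norm_num) h8
      have e3 : (Fintype.card Col : ℝ) ^ (null b (ET T)) ≤ (Fintype.card Col : ℝ) ^ (null b (KT b T)) :=
        pow_le_pow_right₀ ht h5
      have e4 : 0 ≤ (Fintype.card Col : ℝ) ^ (((KT b T).image b).card - 1) := by positivity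
      calc _ = (Fintype.card Col : ℝ) ^ (((KT b T).image b).card - 1) *
            (4 ^ ((KT b T).card - 1) * (Fintype.card Col : ℝ) ^ (null b (ET T))) := by ring
        _ ≤ (Fintype.card Col : ℝ) ^ (((KT b T).image b).card - 1) *
            (4 ^ (p ^ 2) * (Fintype.card Col : ℝ) ^ (null b (KT b T))) :=
            mul_le_mul_of_nonneg_left (mul_le_mul e2 e3 (by positivity) (by positivity)) e4
        _ = _ := by ring
    · rw [Finset.sum_eq_zero]
      · positivity
      · intro a ha
        rw [Finset.mem_filter] at ha
        exfalso
        apply hfT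
        rw [← ha.2]; exact (hAm a ha.1).1
  · intro a ha
    rw [Finset.mem_filter]
    exact ⟨Finset.mem_univ _, a.2.1, KT_sub _ _ (hAm a ha).1⟩

lemma finish {b : Ed n → C} {c0 : Col} (hp : 3 ≤ p) (hg : Good (p - 2) s (4 * p) b)
    (φ : Ed n → Col)
    (hφ : ∀ a : Idx (p - 2) s p b c0, ∃ y ∈ KT b a.1.1, φ y ≠ a.1.2 y) (S : Finset (Fin n))
    (hS : S.card = p) : null (fun e => (b e, φ e)) (ET S) < s := by
  by_contra hcon
  push Not at hcon
  set ψ : Ed n → C × Col := fun e => (b e, φ e) with hψ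
  set F := S.powerset.filter (fun T => 3 ≤ T.card ∧ s * T.card ≤ (p - 2) * null ψ (ET T) + 2 * s)
    with hF
  have hSF : S ∈ F := by
    rw [hF, Finset.mem_filter]
    refine ⟨Finset.mem_powerset_self S, by omega, ?_⟩
    rw [hS]
    obtain ⟨m, rfl⟩ := Nat.exists_eq_add_of_le hp
    have : (3 + m - 2) * s ≤ (3 + m - 2) * null ψ (ET S) := Nat.mul_le_mul_left _ hcon
    have h2 : 3 + m - 2 = m + 1 := by omega
    rw [h2] at *
    nlinarith
  obtain ⟨T, hTF, hmin⟩ := Finset.exists_min_image F Finset.card ⟨S, hSF⟩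
  rw [hF, Finset.mem_filter, Finset.mem_powerset] at hTF
  obtain ⟨hTS, hT3, hTd⟩ := hTF
  have hTp : T.card ≤ p := hS ▸ Finset.card_le_card hTS
  have himg : ∀ X : Finset (Ed n), (X.image ψ).image Prod.fst = X.image b := by
    intro X; rw [Finset.image_image]; rfl
  have hle : ∀ X, null ψ X ≤ null b X := by
    intro X
    have h1 := null_add ψ X
    have h2 := null_add b X
    have h3 := Finset.card_image_le (s := X.image ψ) (f := Prod.fst)
    rw [himg] at h3
    omega
  have hgT := hg T (by omega) (by omega)
  have heq : null b (ET T) = null ψ (ET T) := by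
    have h1 := hle (ET T)
    have h2 : (p - 2) * null b (ET T) ≤ (p - 2) * null ψ (ET T) := by omega
    have := Nat.le_of_mul_le_mul_left h2 (by omega)
    omega
  have hinj : Set.InjOn Prod.fst ((ET T).image ψ : Set (C × Col)) := by
    rw [← Finset.card_image_iff, himg]
    have h1 := null_add ψ (ET T)
    have h2 := null_add b (ET T)
    omega
  have hsame : ∀ X, X ⊆ ET T → null b X = null ψ X := by
    intro X hX
    have h1 := null_add ψ X
    have h2 := null_add b X
    have h3 : ((X.image ψ).image Prod.fst).card = (X.image ψ).card := by
      rw [Finset.card_image_iff]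
      exact hinj.mono (Finset.coe_subset.2 (Finset.image_subset_image hX))
    rw [himg] at h3
    omega
  have hTC : TypeC (p - 2) s p b T := by
    refine ⟨hT3, hTp, by rw [heq] at hgT ⊢; omega, ?_⟩
    intro T' hT' h3
    rw [hsame _ (ET_mono hT'.1)]
    by_contra hcc
    have hT'F : T' ∈ F := by
      rw [hF, Finset.mem_filter, Finset.mem_powerset]
      exact ⟨hT'.1.trans hTS, h3, by omega⟩
    have := hmin T' hT'F
    have := Finset.card_lt_card hT'
    omega
  obtain ⟨y, hy, hne⟩ := hφ ⟨(T, fun e => if e ∈ KT b T then φ e else c0), hTC,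
    (fun e he => by simp only at he; simp [he]), (by
      intro e he e' he' h
      simp only at he he'
      simp only [he, he', if_true]
      have := hinj (Finset.mem_coe.2 (Finset.mem_image_of_mem ψ (KT_sub _ _ he)))
        (Finset.mem_coe.2 (Finset.mem_image_of_mem ψ (KT_sub _ _ he'))) h
      exact (Prod.ext_iff.1 this).2)⟩
  simp only at hy
  simp [hy] at hne

theorem phase_two_apply {b : Ed n → C} (hp : 3 ≤ p) (hs : 0 < s) (hnd : ¬ s ∣ (p - 2))
    (hg : Good (p - 2) s (4 * p) b)
    (ht : 0 < Fintype.card Col) {l l' τ μ X B R D0 : ℝ} (hX : 1 ≤ X)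
    (hl : 0 < l) (hl' : 0 < l') (hBd : B = X / Fintype.card Col) (hRd : R = 8 * X)
    (hμ : μ = 2 * (l * (34 * B * R ^ (p ^ 2))))
    (hτ : τ = l' * B * (μ + 2 * B) + 4 * l' ^ 2 * B ^ 2)
    (h1 : l * (34 * B * R ^ (p ^ 2)) ≤ 1 / 3) (h2 : 2 * l' * B ≤ 1)
    (h3 : τ * Fintype.card Col * Real.log X ≤ 1)
    (h4 : Fintype.card (Ed n) * Real.exp (1 - l' / 2) ≤ 1 / 4)
    (h5 : Fintype.card (Ed n) * Fintype.card Col * Real.exp (l * (D0 - Real.log X)) ≤ 1 / 4)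
    (h6 : ∀ f : Ed n, ∑ T ∈ Finset.univ.filter (fun T => TypeC (p - 2) s p b T ∧ f ∈ ET T),
      4 ^ (p ^ 2) / (Fintype.card Col : ℝ) ^ (null b (ET T)) ≤ D0) :
    ∃ φ : Ed n → Col, ∀ S : Finset (Fin n), S.card = p →
      null (fun e => (b e, φ e)) (ET S) < s := by
  obtain ⟨c0⟩ : Nonempty Col := Fintype.card_pos_iff.1 ht
  have hG := HG_Idx (c0 := c0) hg (by omega) hs hnd
  obtain ⟨φ, hφ⟩ := phase_two hG ht hX hl hl' hBd hRd hμ hτ h1 h2 h3 h4 h5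
    (fun f c => (wdeg f c).trans (h6 f))
  exact ⟨φ, finish hp hg φ hφ⟩

end Bridge

section Counting

open scoped Classical

lemma coord {E : Type} [Fintype E] [DecidableEq E] {r : ℕ} (D : Finset E) (A : Finset (E → Fin r))
    (Rd : E → (E → Fin r) → Finset (Fin r)) (C0 : ℕ)
    (hA : ∀ b ∈ A, ∀ b', (∀ e, e ∉ D → b' e = b e) → b' ∈ A)
    (hR : ∀ b b', (∀ e, e ∉ D → b' e = b e) → ∀ d ∈ D, Rd d b ⊆ Rd d b')
    (hC : ∀ b, ∀ d ∈ D, (Rd d b).card ≤ C0) :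
    (A.filter (fun b => ∀ d ∈ D, b d ∈ Rd d b)).card * r ^ D.card ≤ A.card * C0 ^ D.card := by
  apply Finset.card_mul_le_card_mul (fun b b' : E → Fin r => ∀ e, e ∉ D → b' e = b e)
  · intro b hb
    rw [Finset.mem_filter] at hb
    have h1 : Fintype.piFinset (fun e => if e ∈ D then (Finset.univ : Finset (Fin r)) else {b e}) ⊆
        A.bipartiteAbove (fun b b' : E → Fin r => ∀ e, e ∉ D → b' e = b e) b := by
      intro b' hb'
      rw [Fintype.mem_piFinset] at hb'
      have h2 : ∀ e, e ∉ D → b' e = b e := by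
        intro e he
        have := hb' e
        simpa [he] using this
      rw [Finset.mem_bipartiteAbove]
      exact ⟨hA b hb.1 b' h2, h2⟩
    refine le_trans (le_of_eq ?_) (Finset.card_le_card h1)
    rw [Fintype.card_piFinset]
    have : ∀ e, (if e ∈ D then (Finset.univ : Finset (Fin r)) else {b e}).card =
        if e ∈ D then r else 1 := by
      intro e; split_ifs <;> simp
    rw [Finset.prod_congr rfl (fun e _ => this e), Finset.prod_ite_mem, Finset.univ_inter,
      Finset.prod_const]
  · intro b' hb'
    have h1 : (A.filter (fun b => ∀ d ∈ D, b d ∈ Rd d b)).bipartiteBelow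
        (fun b b' : E → Fin r => ∀ e, e ∉ D → b' e = b e) b' ⊆
        Fintype.piFinset (fun e => if e ∈ D then Rd e b' else {b' e}) := by
      intro b hb
      rw [Finset.mem_bipartiteBelow, Finset.mem_filter] at hb
      rw [Fintype.mem_piFinset]
      intro e
      by_cases he : e ∈ D
      · simp only [he, if_true]
        exact hR b b' hb.2 e he (hb.1.2 e he)
      · simp [he, hb.2 e he]
    refine (Finset.card_le_card h1).trans ?_
    rw [Fintype.card_piFinset]
    have : ∀ e, (if e ∈ D then Rd e b' else {b' e}).card ≤ if e ∈ D then C0 else 1 := by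
      intro e
      split_ifs with h
      · exact hC b' e h
      · simp
    refine (Finset.prod_le_prod' (fun e _ => this e)).trans (le_of_eq ?_)
    rw [Finset.prod_ite_mem, Finset.univ_inter, Finset.prod_const]

lemma spread {E C : Type} [DecidableEq E] [DecidableEq C] (b : E → C) (X : Finset E) (f : E) :
    ∃ D ⊆ X, f ∉ D ∧ D.card = null b X ∧ ∀ x ∈ X, b x ∈ (X \ D).image b := by
  have hrep : ∀ c : C, ∃ x, c ∈ X.image b → (x ∈ X ∧ b x = c ∧ (f ∈ X → b f = c → x = f)) := by
    intro c
    by_cases hc : c ∈ X.image b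
    · by_cases h : f ∈ X ∧ b f = c
      · exact ⟨f, fun _ => ⟨h.1, h.2, fun _ _ => rfl⟩⟩
      · obtain ⟨x, hx, hxc⟩ := Finset.mem_image.1 hc
        exact ⟨x, fun _ => ⟨hx, hxc, fun h1 h2 => absurd ⟨h1, h2⟩ h⟩⟩
    · exact ⟨f, fun h => absurd h hc⟩
  choose rep hrep using hrep
  set Y := (X.image b).image rep with hY
  have hYX : Y ⊆ X := by
    intro y hy
    obtain ⟨c, hc, rfl⟩ := Finset.mem_image.1 hy
    exact (hrep c hc).1
  have hYc : Y.card = (X.image b).card := by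
    rw [hY, Finset.card_image_iff]
    intro c hc c' hc' h
    rw [← (hrep c hc).2.1, ← (hrep c' hc').2.1, h]
  refine ⟨X \ Y, Finset.sdiff_subset, ?_, ?_, ?_⟩
  · intro hf
    rw [Finset.mem_sdiff] at hf
    apply hf.2
    have := (hrep (b f) (Finset.mem_image_of_mem b hf.1)).2.2 hf.1 rfl
    rw [← this]
    exact Finset.mem_image_of_mem _ (Finset.mem_image_of_mem b hf.1)
  · have h1 := null_add b X
    have h2 := Finset.card_sdiff_add_card_eq_card hYX
    omega
  · intro x hx
    have hc := Finset.mem_image_of_mem b hx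
    rw [Finset.mem_image]
    refine ⟨rep (b x), ?_, (hrep _ hc).2.1⟩
    rw [Finset.sdiff_sdiff_eq_self hYX]
    exact Finset.mem_image_of_mem _ hc

variable {n r : ℕ}

def GoodOn (N s Pm : ℕ) {n r : ℕ} (E' : Finset (Ed n)) (b : Ed n → Fin r) : Prop :=
  ∀ T : Finset (Fin n), 2 ≤ T.card → T.card ≤ Pm → N * null b (ET T ∩ E') + 2 * s ≤ s * T.card

noncomputable def GS (N s Pm : ℕ) {n : ℕ} (r : ℕ) (E' : Finset (Ed n)) : Finset (Ed n → Fin r) :=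
  Finset.univ.filter (fun b => GoodOn N s Pm E' b)

variable {N s Pm : ℕ}

lemma mem_GS {E' : Finset (Ed n)} {b : Ed n → Fin r} :
    b ∈ GS N s Pm r E' ↔ GoodOn N s Pm E' b := by simp [GS]

lemma GS_anti {E' E'' : Finset (Ed n)} (h : E' ⊆ E'') : GS N s Pm r E'' ⊆ GS N s Pm r E' := by
  intro b hb
  rw [mem_GS] at *
  intro T h1 h2
  have h3 := hb T h1 h2
  have h4 := null_mono b (Finset.inter_subset_inter (Finset.Subset.refl (ET T)) h)
  have := Nat.mul_le_mul_left N h4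
  omega

lemma GS_closed {E' D : Finset (Ed n)} (hD : Disjoint D E') : ∀ b ∈ GS N s Pm r E', ∀ b',
    (∀ e, e ∉ D → b' e = b e) → b' ∈ GS N s Pm r E' := by
  intro b hb b' hbb'
  rw [mem_GS] at *
  intro T h1 h2
  have h3 := hb T h1 h2
  have h4 : (ET T ∩ E').image b' = (ET T ∩ E').image b := by
    apply Finset.image_congr
    intro e he
    apply hbb'
    intro heD
    exact (Finset.disjoint_left.1 hD heD) (Finset.mem_inter.1 he).2
  unfold null at *
  rw [h4]; exact h3

lemma addback {E' : Finset (Ed n)} (h : ∀ E'' ⊂ E', ∀ e, e ∉ E'' → e ∈ E' →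
    (GS N s Pm r E'').card ≤ 2 * (GS N s Pm r (insert e E'')).card) (D : Finset (Ed n))
    (hD : D ⊆ E') : (GS N s Pm r (E' \ D)).card ≤ 2 ^ D.card * (GS N s Pm r E').card := by
  induction D using Finset.induction_on with
  | empty => simp
  | insert d D hd ih =>
    have hdE : d ∈ E' := hD (Finset.mem_insert_self _ _)
    have h1 := h (E' \ insert d D) (by
      rw [Finset.ssubset_iff_subset_ne]
      refine ⟨Finset.sdiff_subset, fun hh => ?_⟩
      rw [← hh] at hdE
      simp at hdE) d (by simp) hdE
    have h2 : insert d (E' \ insert d D) = E' \ D := by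
      ext y
      simp only [Finset.mem_insert, Finset.mem_sdiff, not_or]
      by_cases hy : y = d
      · subst hy; simp [hdE, hd]
      · simp [hy]
    rw [h2] at h1
    have h3 := ih ((Finset.subset_insert _ _).trans hD)
    rw [Finset.card_insert_of_notMem hd, pow_succ]
    nlinarith

lemma count_T (e : Ed n) (m : ℕ) :
    (Finset.univ.filter (fun T : Finset (Fin n) => e ∈ ET T ∧ T.card = m)).card ≤ n ^ (m - 2) := by
  have : (Finset.univ.filter (fun T : Finset (Fin n) => e ∈ ET T ∧ T.card = m)).card ≤
      (Finset.powersetCard (m - 2) (Finset.univ : Finset (Fin n))).card := by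
    apply Finset.card_le_card_of_injOn (fun T => T \ e.1)
    · intro T hT
      simp only [Finset.coe_filter, Finset.mem_univ, true_and, Set.mem_setOf_eq, mem_ET] at hT
      rw [Finset.mem_coe, Finset.mem_powersetCard]
      refine ⟨Finset.subset_univ _, ?_⟩
      rw [Finset.card_sdiff_of_subset hT.1, hT.2, e.2]
    · intro T hT T' hT' h
      simp only [Finset.coe_filter, Finset.mem_univ, true_and, Set.mem_setOf_eq, mem_ET] at hT hT'
      rw [← Finset.sdiff_union_of_subset hT.1, ← Finset.sdiff_union_of_subset hT'.1]
      simp only at h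
      rw [h]
  refine this.trans ?_
  rw [Finset.card_powersetCard, Finset.card_univ, Fintype.card_fin]
  exact Nat.choose_le_pow _ _

lemma card_ET_le {T : Finset (Fin n)} (h : T.card ≤ Pm) : (ET T).card ≤ Pm ^ 2 := by
  rw [card_ET]
  exact (Nat.choose_le_pow _ _).trans (Nat.pow_le_pow_left h 2)

/-- one step of the counting argument -/
lemma bad_count (hr : 0 < r) {E' X D0 : Finset (Ed n)} {e : Ed n} (he : e ∉ E') (hX : X ⊆ E')
    (hXc : X.card ≤ Pm ^ 2) (hD : D0 ⊆ X)
    (hback : (GS N s Pm r (E' \ D0)).card ≤ 2 ^ D0.card * (GS N s Pm r E').card) :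
    (((GS N s Pm r (E' \ D0)).filter (fun b => ∀ d ∈ insert e D0, b d ∈ (X \ D0).image b)).card : ℝ)
      ≤ (2 * (Pm : ℝ) ^ 2 / r) ^ (D0.card + 1) * (GS N s Pm r E').card := by
  have heD : e ∉ D0 := fun h => he (hX (hD h))
  have h1 := coord (insert e D0) (GS N s Pm r (E' \ D0)) (fun _ b => (X \ D0).image b) (Pm ^ 2)
    (GS_closed (by
      rw [Finset.disjoint_left]
      intro y hy hy'
      rw [Finset.mem_sdiff] at hy'
      rcases Finset.mem_insert.1 hy with h | h
      · rw [h] at hy'; exact he hy'.1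
      · exact hy'.2 h))
    (by
      intro b b' h d _
      apply subset_of_eq
      apply Finset.image_congr
      intro y hy
      symm
      apply h
      intro hyD
      simp only [Finset.coe_sdiff, Set.mem_sdiff, Finset.mem_coe] at hy
      rcases Finset.mem_insert.1 hyD with h | h
      · rw [h] at hy; exact he (hX hy.1)
      · exact hy.2 h)
    (by
      intro b d _
      exact Finset.card_image_le.trans ((Finset.card_le_card Finset.sdiff_subset).trans hXc))
  rw [Finset.card_insert_of_notMem heD] at h1
  have hrR : (0 : ℝ) < r := by exact_mod_cast hr
  set Z := ((GS N s Pm r (E' \ D0)).filter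
    (fun b => ∀ d ∈ insert e D0, b d ∈ (X \ D0).image b)).card with hZ
  have h2 : (Z : ℝ) * r ^ (D0.card + 1) ≤ (GS N s Pm r (E' \ D0)).card * ((Pm : ℝ) ^ 2) ^ (D0.card + 1) := by
    exact_mod_cast h1
  have h3 : ((GS N s Pm r (E' \ D0)).card : ℝ) ≤ 2 ^ (D0.card + 1) * (GS N s Pm r E').card := by
    have : ((GS N s Pm r (E' \ D0)).card : ℝ) ≤ 2 ^ (D0.card) * (GS N s Pm r E').card := by
      exact_mod_cast hback
    refine this.trans ?_
    exact mul_le_mul_of_nonneg_right (pow_le_pow_right₀ (by norm_num) (Nat.le_succ _))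
      (Nat.cast_nonneg _)
  rw [div_pow, div_mul_eq_mul_div, le_div_iff₀ (by positivity), mul_pow]
  calc _ ≤ _ := h2
    _ ≤ (2 ^ (D0.card + 1) * (GS N s Pm r E').card) * ((Pm : ℝ) ^ 2) ^ (D0.card + 1) :=
      mul_le_mul_of_nonneg_right h3 (by positivity)
    _ = _ := by ring

lemma rosen (hN : 0 < N) (hr : 0 < r) (hP : 0 < Pm) (hrho : 2 * (Pm : ℝ) ^ 2 / r ≤ 1)
    (H : ∀ m, 2 ≤ m → m ≤ Pm → (n : ℝ) ^ (m - 2) * 2 ^ (Pm ^ 2) *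
      (2 * (Pm : ℝ) ^ 2 / r) ^ (s * (m - 2) / N + 1) ≤ 1 / (2 * Pm)) (E' : Finset (Ed n)) :
    ∀ e, e ∉ E' → (GS N s Pm r E').card ≤ 2 * (GS N s Pm r (insert e E')).card := by
  induction E' using Finset.strongInduction with
  | H E' ih =>
    intro e he
    set ρ : ℝ := 2 * (Pm : ℝ) ^ 2 / r with hρ
    have hρ0 : 0 ≤ ρ := by positivity
    have hback := addback (N := N) (s := s) (Pm := Pm) (r := r) (E' := E')
      (fun E'' h e he _ => ih E'' h e he)
    set 𝒯 : Finset (Finset (Fin n)) := Finset.univ.filter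
      (fun T => e ∈ ET T ∧ 2 ≤ T.card ∧ T.card ≤ Pm) with h𝒯
    set BadT : Finset (Fin n) → Finset (Ed n) → Finset (Ed n → Fin r) := fun T D0 =>
      (GS N s Pm r (E' \ D0)).filter (fun b => ∀ d ∈ insert e D0, b d ∈ ((ET T ∩ E') \ D0).image b)
      with hBadT
    set Ds : Finset (Fin n) → Finset (Finset (Ed n)) := fun T =>
      (ET T ∩ E').powerset.filter (fun D0 => s * (T.card - 2) / N + 1 ≤ D0.card + 1) with hDs
    have hcover : GS N s Pm r E' ⊆ GS N s Pm r (insert e E') ∪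
        𝒯.biUnion (fun T => (Ds T).biUnion (fun D0 => BadT T D0)) := by
      intro b hb
      by_cases hgood : b ∈ GS N s Pm r (insert e E')
      · exact Finset.mem_union_left _ hgood
      apply Finset.mem_union_right
      rw [mem_GS] at hgood
      unfold GoodOn at hgood
      push Not at hgood
      obtain ⟨T, hT1, hT2, hT3⟩ := hgood
      have hbE := mem_GS.1 hb T hT1 hT2
      have heT : e ∈ ET T := by
        by_contra h
        rw [Finset.inter_insert_of_notMem h] at hT3
        omega
      rw [Finset.inter_insert_of_mem heT] at hT3
      set X := ET T ∩ E' with hX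
      have heX : e ∉ X := fun h => he (Finset.mem_inter.1 h).2
      have hbe : b e ∈ X.image b := by
        by_contra h
        have h1 := null_add b X
        have h2 := null_add b (insert e X)
        rw [Finset.image_insert, Finset.card_insert_of_notMem h,
          Finset.card_insert_of_notMem heX] at h2
        have : null b (insert e X) = null b X := by omega
        rw [this] at hT3
        omega
      have hnull : null b (insert e X) = null b X + 1 := by
        have h1 := null_add b X
        have h2 := null_add b (insert e X)
        rw [Finset.image_insert, Finset.insert_eq_of_mem hbe,
          Finset.card_insert_of_notMem heX] at h2
        omega
      obtain ⟨D0, hD0, _, hDc, hDi⟩ := spread b X e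
      rw [Finset.mem_biUnion]
      refine ⟨T, by rw [h𝒯, Finset.mem_filter]; exact ⟨Finset.mem_univ _, heT, hT1, hT2⟩, ?_⟩
      rw [Finset.mem_biUnion]
      refine ⟨D0, ?_, ?_⟩
      · simp only [hDs]
        rw [Finset.mem_filter, Finset.mem_powerset]
        refine ⟨hD0, ?_⟩
        rw [hDc, Nat.add_one_le_iff, Nat.div_lt_iff_lt_mul hN, ← hnull]
        have : s * (T.card - 2) + 2 * s = s * T.card := by
          obtain ⟨m, hm⟩ := Nat.exists_eq_add_of_le hT1
          rw [hm]
          have : 2 + m - 2 = m := by omega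
          rw [this]; ring
        rw [mul_comm _ N]
        omega
      · simp only [hBadT]
        rw [Finset.mem_filter]
        refine ⟨GS_anti Finset.sdiff_subset hb, ?_⟩
        intro d hd
        rcases Finset.mem_insert.1 hd with h | h
        · rw [h]
          obtain ⟨x, hx, hxe⟩ := Finset.mem_image.1 hbe
          rw [← hxe]; exact hDi x hx
        · exact hDi d (hD0 h)
    have hcard : ((GS N s Pm r E').card : ℝ) ≤ (GS N s Pm r (insert e E')).card +
        ∑ T ∈ 𝒯, ∑ D0 ∈ Ds T, ((BadT T D0).card : ℝ) := by
      have h1 := (Finset.card_le_card hcover).trans (Finset.card_union_le _ _)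
      have h2 := h1.trans (Nat.add_le_add_left (Finset.card_biUnion_le.trans
        (Finset.sum_le_sum (fun T _ => Finset.card_biUnion_le))) _)
      exact_mod_cast h2
    have hT : ∀ T ∈ 𝒯, ∑ D0 ∈ Ds T, ((BadT T D0).card : ℝ) ≤
        2 ^ (Pm ^ 2) * ρ ^ (s * (T.card - 2) / N + 1) * (GS N s Pm r E').card := by
      intro T hT
      rw [h𝒯, Finset.mem_filter] at hT
      have hXc : (ET T ∩ E').card ≤ Pm ^ 2 :=
        (Finset.card_le_card Finset.inter_subset_left).trans (card_ET_le hT.2.2.2)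
      have h1 : ∀ D0 ∈ Ds T, ((BadT T D0).card : ℝ) ≤
          ρ ^ (s * (T.card - 2) / N + 1) * (GS N s Pm r E').card := by
        intro D0 hD0
        simp only [hDs] at hD0
        rw [Finset.mem_filter, Finset.mem_powerset] at hD0
        refine (bad_count hr he Finset.inter_subset_right hXc hD0.1
          (hback D0 (hD0.1.trans Finset.inter_subset_right))).trans ?_
        apply mul_le_mul_of_nonneg_right _ (by positivity)
        exact pow_le_pow_of_le_one hρ0 hrho hD0.2
      refine (Finset.sum_le_sum h1).trans ?_
      rw [Finset.sum_const, nsmul_eq_mul, mul_assoc]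
      apply mul_le_mul_of_nonneg_right _ (by positivity)
      have h2 : (Ds T).card ≤ 2 ^ (Pm ^ 2) := by
        simp only [hDs]
        refine (Finset.card_filter_le _ _).trans ?_
        rw [Finset.card_powerset]
        exact Nat.pow_le_pow_right (by norm_num) hXc
      exact_mod_cast h2
    have hsum : ∑ T ∈ 𝒯, ∑ D0 ∈ Ds T, ((BadT T D0).card : ℝ) ≤
        1 / 2 * (GS N s Pm r E').card := by
      refine (Finset.sum_le_sum hT).trans ?_
      rw [← Finset.sum_mul]
      apply mul_le_mul_of_nonneg_right _ (by positivity)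
      rw [← Finset.sum_fiberwise_of_maps_to (s := 𝒯) (g := Finset.card) (t := Finset.Ioc 1 Pm)]
      · have h1 : ∀ m ∈ Finset.Ioc 1 Pm, ∑ T ∈ 𝒯.filter (fun T => T.card = m),
            2 ^ (Pm ^ 2) * ρ ^ (s * (T.card - 2) / N + 1) ≤ 1 / (2 * (Pm : ℝ)) := by
          intro m hm
          rw [Finset.mem_Ioc] at hm
          refine le_trans ?_ (H m hm.1 hm.2)
          have h2 : ∑ T ∈ 𝒯.filter (fun T => T.card = m),
            2 ^ (Pm ^ 2) * ρ ^ (s * (T.card - 2) / N + 1) =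
            ∑ T ∈ 𝒯.filter (fun T => T.card = m), 2 ^ (Pm ^ 2) * ρ ^ (s * (m - 2) / N + 1) := by
            apply Finset.sum_congr rfl
            intro T hT
            rw [Finset.mem_filter] at hT
            rw [hT.2]
          rw [h2, Finset.sum_const, nsmul_eq_mul, mul_assoc]
          apply mul_le_mul_of_nonneg_right _ (by positivity)
          have h3 : (𝒯.filter (fun T => T.card = m)).card ≤ n ^ (m - 2) := by
            refine le_trans (Finset.card_le_card ?_) (count_T e m)
            intro T hT
            rw [Finset.mem_filter, h𝒯, Finset.mem_filter] at hT
            rw [Finset.mem_filter]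
            exact ⟨Finset.mem_univ _, hT.1.2.1, hT.2⟩
          exact_mod_cast h3
        refine (Finset.sum_le_sum h1).trans ?_
        rw [Finset.sum_const, nsmul_eq_mul, Nat.card_Ioc]
        have hPR : (0 : ℝ) < Pm := by exact_mod_cast hP
        have h4 : ((Pm - 1 : ℕ) : ℝ) ≤ Pm := by exact_mod_cast Nat.sub_le _ _
        rw [mul_one_div, div_le_div_iff₀ (by positivity) (by norm_num)]
        linarith
      · intro T hT
        rw [h𝒯, Finset.mem_filter] at hT
        rw [Finset.mem_Ioc]
        exact ⟨by omega, hT.2.2.2⟩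
    have : ((GS N s Pm r E').card : ℝ) ≤ 2 * (GS N s Pm r (insert e E')).card := by linarith
    exact_mod_cast this

end Counting

section Degree

open scoped Classical

variable {n r N s p : ℕ}

lemma GS_univ {Pm : ℕ} {b : Ed n → Fin r} : b ∈ GS N s Pm r Finset.univ ↔ Good N s Pm b := by
  rw [mem_GS]
  unfold GoodOn Good
  simp only [Finset.inter_univ]

lemma GS_pos {Pm : ℕ} (hr : 0 < r)
    (hro : ∀ E' : Finset (Ed n), ∀ e, e ∉ E' → (GS N s Pm r E').card ≤ 2 * (GS N s Pm r (insert e E')).card) :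
    0 < (GS N s Pm r (Finset.univ : Finset (Ed n))).card := by
  have h1 := addback (N := N) (s := s) (Pm := Pm) (r := r) (E' := (Finset.univ : Finset (Ed n)))
      (fun E'' _ e he _ => hro E'' e he) Finset.univ (Finset.Subset.refl _)
  rw [Finset.sdiff_self] at h1
  have h2 : 0 < (GS N s Pm r (∅ : Finset (Ed n))).card := by
    rw [Finset.card_pos]
    refine ⟨fun _ => ⟨0, hr⟩, ?_⟩
    rw [mem_GS]
    intro T h2 _
    rw [Finset.inter_empty, null_small _ (by simp)]
    nlinarith
  by_contra h
  have h3 : (GS N s Pm r (Finset.univ : Finset (Ed n))).card = 0 := by omega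
  rw [h3] at h1
  omega

lemma fam_count (hr : 0 < r) (hN : 0 < N) (hs : 0 < s) (hnd : ¬ s ∣ N)
    (hro : ∀ E' : Finset (Ed n), ∀ e, e ∉ E' →
      (GS N s (4 * p) r E').card ≤ 2 * (GS N s (4 * p) r (insert e E')).card)
    (f : Ed n) (m : ℕ) (hm : m ≤ p) (F : Finset (Finset (Fin n)))
    (hF : ∀ T ∈ F, f ∈ ET T ∧ T.card = m) :
    (((GS N s (4 * p) r Finset.univ).filter (fun b => ∀ T ∈ F, TypeC N s p b T)).card : ℝ) ≤
      ((2 : ℝ) ^ ((4 * p) ^ 2) * (2 * ((4 * p : ℕ) : ℝ) ^ 2 / r) ^ (s * (m - 2) / N)) ^ F.card *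
        (GS N s (4 * p) r (Finset.univ : Finset (Ed n))).card := by
  set ν := s * (m - 2) / N with hν
  set Pm := 4 * p with hPm
  set G := GS N s Pm r (Finset.univ : Finset (Ed n)) with hG
  have hrR : (0 : ℝ) < r := by exact_mod_cast hr
  have hTd : ∀ d : Ed n, ∃ T : Finset (Fin n), (∃ T' ∈ F, d ∈ ET T') → (T ∈ F ∧ d ∈ ET T) := by
    intro d
    by_cases h : ∃ T' ∈ F, d ∈ ET T'
    · obtain ⟨T', h1, h2⟩ := h
      exact ⟨T', fun _ => ⟨h1, h2⟩⟩
    · exact ⟨∅, fun h' => absurd h' h⟩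
  choose Td hTd using hTd
  set U := F.biUnion (fun T => ET T) with hU
  have hUc : U.card ≤ F.card * Pm ^ 2 := by
    apply Finset.card_biUnion_le_card_mul
    intro T hT
    apply card_ET_le
    rw [(hF T hT).2]; omega
  set Ds := U.powerset.filter (fun D => D.card = F.card * ν) with hDs
  set Bad : Finset (Ed n) → Finset (Ed n → Fin r) := fun D =>
    (GS N s Pm r (Finset.univ \ D)).filter (fun b => ∀ d ∈ D, b d ∈ (ET (Td d) \ D).image b) with hBad
  have hcover : G.filter (fun b => ∀ T ∈ F, TypeC N s p b T) ⊆ Ds.biUnion Bad := by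
    intro b hb
    rw [Finset.mem_filter] at hb
    obtain ⟨hbG, hbT⟩ := hb
    have hgood : Good N s Pm b := GS_univ.1 hbG
    have hnull : ∀ T ∈ F, null b (ET T) = ν := by
      intro T hT
      have h1 := (hbT T hT).eq
      have h2 := (hbT T hT).three
      rw [(hF T hT).2] at h1 h2
      rw [hν]
      symm
      apply Nat.div_eq_of_eq_mul_right hN
      obtain ⟨k, hk⟩ := Nat.exists_eq_add_of_le h2
      rw [hk] at h1 ⊢
      have : 3 + k - 2 = k + 1 := by omega
      rw [this]
      have : s * (3 + k) = s * (k + 1) + 2 * s := by ring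
      omega
    choose DT hDT using fun T : Finset (Fin n) => spread b (ET T) f
    have hshare : ∀ T ∈ F, ∀ T' ∈ F, ∀ d, d ≠ f → d ∈ ET T → d ∈ ET T' → T = T' := by
      intro T hT T' hT' d hd h1 h2
      by_contra hne
      exact hd (typeC_share hgood (hbT T hT) (hbT T' hT') hN hs hnd hne h1 h2 (hF T hT).1 (hF T' hT').1)
    set D := F.biUnion DT with hD
    have hfD : ∀ d ∈ D, d ≠ f := by
      intro d hd h
      obtain ⟨T, hT, hdT⟩ := Finset.mem_biUnion.1 hd
      rw [h] at hdT
      exact (hDT T).2.1 hdT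
    rw [Finset.mem_biUnion]
    refine ⟨D, ?_, ?_⟩
    · rw [hDs, Finset.mem_filter, Finset.mem_powerset]
      constructor
      · intro d hd
        obtain ⟨T, hT, hdT⟩ := Finset.mem_biUnion.1 hd
        exact Finset.mem_biUnion.2 ⟨T, hT, (hDT T).1 hdT⟩
      · rw [hD, Finset.card_biUnion]
        · rw [Finset.sum_congr rfl (fun T hT => ((hDT T).2.2.1).trans (hnull T hT)),
            Finset.sum_const, smul_eq_mul]
        · intro T hT T' hT' hne
          rw [Function.onFun, Finset.disjoint_left]
          intro d hd hd'
          apply hne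
          apply hshare T hT T' hT' d _ ((hDT T).1 hd) ((hDT T').1 hd')
          exact hfD d (Finset.mem_biUnion.2 ⟨T, hT, hd⟩)
    · simp only [hBad]
      rw [Finset.mem_filter]
      refine ⟨GS_anti (Finset.subset_univ _) hbG, ?_⟩
      intro d hd
      obtain ⟨T, hT, hdT⟩ := Finset.mem_biUnion.1 hd
      have h1 := hTd d ⟨T, hT, (hDT T).1 hdT⟩
      have h2 : Td d = T := hshare _ h1.1 T hT d (hfD d hd) h1.2 ((hDT T).1 hdT)
      rw [h2]
      obtain ⟨x, hx, hxd⟩ := Finset.mem_image.1 ((hDT T).2.2.2 d ((hDT T).1 hdT))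
      rw [← hxd]
      apply Finset.mem_image_of_mem
      rw [Finset.mem_sdiff] at hx ⊢
      refine ⟨hx.1, fun hxD => hx.2 ?_⟩
      obtain ⟨T', hT', hxT'⟩ := Finset.mem_biUnion.1 hxD
      have : T = T' := hshare T hT T' hT' x (hfD x hxD) hx.1 ((hDT T').1 hxT')
      rw [this]; exact hxT'
  have hB : ∀ D ∈ Ds, ((Bad D).card : ℝ) ≤ (2 * (Pm : ℝ) ^ 2 / r) ^ (F.card * ν) * G.card := by
    intro D hD
    rw [hDs, Finset.mem_filter, Finset.mem_powerset] at hD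
    obtain ⟨hDU, hDc⟩ := hD
    have h1 := coord D (GS N s Pm r (Finset.univ \ D)) (fun d b => (ET (Td d) \ D).image b) (Pm ^ 2)
      (GS_closed Finset.disjoint_sdiff)
      (by
        intro b b' h d _
        apply subset_of_eq
        apply Finset.image_congr
        intro y hy
        symm
        apply h
        rw [Finset.mem_coe, Finset.mem_sdiff] at hy
        exact hy.2)
      (by
        intro b d hd
        refine Finset.card_image_le.trans ((Finset.card_le_card Finset.sdiff_subset).trans ?_)
        apply card_ET_le
        obtain ⟨T, hT, hdT⟩ := Finset.mem_biUnion.1 (hDU hd)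
        rw [(hF _ (hTd d ⟨T, hT, hdT⟩).1).2]; omega)
    have h2 := addback (N := N) (s := s) (Pm := Pm) (r := r) (E' := (Finset.univ : Finset (Ed n)))
      (fun E'' _ e he _ => hro E'' e he) D (Finset.subset_univ _)
    rw [hDc] at h1 h2
    have h1' : ((Bad D).card : ℝ) * r ^ (F.card * ν) ≤
      (GS N s Pm r (Finset.univ \ D)).card * ((Pm : ℝ) ^ 2) ^ (F.card * ν) := by exact_mod_cast h1
    have h2' : ((GS N s Pm r (Finset.univ \ D)).card : ℝ) ≤ 2 ^ (F.card * ν) * G.card := by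
      exact_mod_cast h2
    rw [div_pow, div_mul_eq_mul_div, le_div_iff₀ (by positivity), mul_pow]
    calc _ ≤ _ := h1'
      _ ≤ (2 ^ (F.card * ν) * G.card) * ((Pm : ℝ) ^ 2) ^ (F.card * ν) :=
        mul_le_mul_of_nonneg_right h2' (by positivity)
      _ = _ := by ring
  have h3 : ((G.filter (fun b => ∀ T ∈ F, TypeC N s p b T)).card : ℝ) ≤
      ∑ D ∈ Ds, ((Bad D).card : ℝ) := by
    exact_mod_cast (Finset.card_le_card hcover).trans Finset.card_biUnion_le
  refine h3.trans ((Finset.sum_le_sum hB).trans ?_)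
  rw [Finset.sum_const, nsmul_eq_mul, ← mul_assoc]
  apply mul_le_mul_of_nonneg_right _ (Nat.cast_nonneg _)
  rw [mul_pow, ← pow_mul, ← pow_mul, mul_comm ν]
  apply mul_le_mul_of_nonneg_right _ (by positivity)
  have h4 : Ds.card ≤ 2 ^ (Pm ^ 2 * F.card) := by
    refine (Finset.card_filter_le _ _).trans ?_
    rw [Finset.card_powerset]
    apply Nat.pow_le_pow_right (by norm_num)
    rw [mul_comm]; exact hUc
  exact_mod_cast h4

lemma many_count (hr : 0 < r) (hN : 0 < N) (hs : 0 < s) (hnd : ¬ s ∣ N)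
    (hro : ∀ E' : Finset (Ed n), ∀ e, e ∉ E' →
      (GS N s (4 * p) r E').card ≤ 2 * (GS N s (4 * p) r (insert e E')).card)
    (f : Ed n) (m : ℕ) (hm : m ≤ p) (M : ℕ)
    (hM : 2 * Real.exp 1 * ((n : ℝ) ^ (m - 2) * ((2 : ℝ) ^ ((4 * p) ^ 2) *
      (2 * ((4 * p : ℕ) : ℝ) ^ 2 / r) ^ (s * (m - 2) / N))) ≤ M) :
    (((GS N s (4 * p) r Finset.univ).filter (fun b => M ≤ (Finset.univ.filter
      (fun T => TypeC N s p b T ∧ f ∈ ET T ∧ T.card = m)).card)).card : ℝ) * 2 ^ M ≤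
        (GS N s (4 * p) r (Finset.univ : Finset (Ed n))).card := by
  set G := GS N s (4 * p) r (Finset.univ : Finset (Ed n)) with hG
  set q : ℝ := (2 : ℝ) ^ ((4 * p) ^ 2) * (2 * ((4 * p : ℕ) : ℝ) ^ 2 / r) ^ (s * (m - 2) / N) with hq
  have hq0 : 0 ≤ q := by positivity
  set A := Finset.univ.filter (fun T : Finset (Fin n) => f ∈ ET T ∧ T.card = m) with hA
  have hAc : A.card ≤ n ^ (m - 2) := count_T f m
  have hcover : G.filter (fun b => M ≤ (Finset.univ.filter
      (fun T => TypeC N s p b T ∧ f ∈ ET T ∧ T.card = m)).card) ⊆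
      (A.powersetCard M).biUnion (fun F => G.filter (fun b => ∀ T ∈ F, TypeC N s p b T)) := by
    intro b hb
    rw [Finset.mem_filter] at hb
    obtain ⟨F, hF, hFc⟩ := Finset.exists_subset_card_eq hb.2
    rw [Finset.mem_biUnion]
    refine ⟨F, ?_, ?_⟩
    · rw [Finset.mem_powersetCard]
      refine ⟨fun T hT => ?_, hFc⟩
      have := hF hT
      rw [Finset.mem_filter] at this
      rw [hA, Finset.mem_filter]
      exact ⟨Finset.mem_univ _, this.2.2⟩
    · rw [Finset.mem_filter]
      refine ⟨hb.1, fun T hT => ?_⟩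
      have := hF hT
      rw [Finset.mem_filter] at this
      exact this.2.1
  have h1 : ((G.filter (fun b => M ≤ (Finset.univ.filter
      (fun T => TypeC N s p b T ∧ f ∈ ET T ∧ T.card = m)).card)).card : ℝ) ≤
      ∑ F ∈ A.powersetCard M, ((G.filter (fun b => ∀ T ∈ F, TypeC N s p b T)).card : ℝ) := by
    exact_mod_cast (Finset.card_le_card hcover).trans Finset.card_biUnion_le
  have h2 : ∀ F ∈ A.powersetCard M, ((G.filter (fun b => ∀ T ∈ F, TypeC N s p b T)).card : ℝ) ≤
      q ^ M * G.card := by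
    intro F hF
    rw [Finset.mem_powersetCard] at hF
    have := fam_count hr hN hs hnd hro f m hm F (fun T hT => by
      have := hF.1 hT
      rw [hA, Finset.mem_filter] at this
      exact this.2)
    rw [hF.2] at this
    exact this
  have h3 := h1.trans (Finset.sum_le_sum h2)
  rw [Finset.sum_const, nsmul_eq_mul, Finset.card_powersetCard] at h3
  have h4 : ((A.card.choose M : ℕ) : ℝ) ≤ ((n : ℝ) ^ (m - 2)) ^ M / (M.factorial : ℝ) := by
    refine (Nat.choose_le_pow_div M A.card).trans ?_
    apply div_le_div_of_nonneg_right _ (by positivity)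
    apply pow_le_pow_left₀ (by positivity)
    exact_mod_cast hAc
  set Q : ℝ := (n : ℝ) ^ (m - 2) * q with hQ
  have hQ0 : 0 ≤ Q := by positivity
  have h5 : (2 * Q) ^ M / (M.factorial : ℝ) ≤ 1 := by
    have h6 := Real.pow_div_factorial_le_exp (2 * Real.exp 1 * Q) (by positivity) M
    have h7 : Real.exp (2 * Real.exp 1 * Q) ≤ Real.exp 1 ^ M := by
      rw [← Real.exp_nat_mul, mul_one]
      exact Real.exp_le_exp.2 hM
    have h8 := h6.trans h7
    have h9 : (2 * Real.exp 1 * Q) ^ M / (M.factorial : ℝ) =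
        Real.exp 1 ^ M * ((2 * Q) ^ M / (M.factorial : ℝ)) := by
      rw [mul_pow, mul_pow, mul_pow]; ring
    rw [h9] at h8
    have h10 : 0 < Real.exp 1 ^ M := by positivity
    by_contra hc
    push Not at hc
    nlinarith
  have h6 : ((A.card.choose M : ℕ) : ℝ) * (q ^ M * G.card) * 2 ^ M ≤ G.card := by
    calc _ ≤ ((n : ℝ) ^ (m - 2)) ^ M / (M.factorial : ℝ) * (q ^ M * G.card) * 2 ^ M := by
          apply mul_le_mul_of_nonneg_right _ (by positivity)
          exact mul_le_mul_of_nonneg_right h4 (by positivity)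
      _ = ((2 * Q) ^ M / (M.factorial : ℝ)) * G.card := by
          rw [hQ, mul_pow, mul_pow]; ring
      _ ≤ 1 * G.card := mul_le_mul_of_nonneg_right h5 (by positivity)
      _ = _ := one_mul _
  exact (mul_le_mul_of_nonneg_right h3 (by positivity)).trans h6

lemma card_Ed_le : Fintype.card (Ed n) ≤ n ^ 2 := by
  have : Fintype.card (Ed n) = n.choose 2 := by
    rw [Fintype.card_finset_len, Fintype.card_fin]
  rw [this]
  exact Nat.choose_le_pow _ _

lemma exists_good (hr : 0 < r) (hN : 0 < N) (hs : 0 < s) (hnd : ¬ s ∣ N)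
    (hro : ∀ E' : Finset (Ed n), ∀ e, e ∉ E' →
      (GS N s (4 * p) r E').card ≤ 2 * (GS N s (4 * p) r (insert e E')).card)
    (M : ℕ → ℕ)
    (hM : ∀ m, m ≤ p → 2 * Real.exp 1 * ((n : ℝ) ^ (m - 2) * ((2 : ℝ) ^ ((4 * p) ^ 2) *
      (2 * ((4 * p : ℕ) : ℝ) ^ 2 / r) ^ (s * (m - 2) / N))) ≤ M m)
    (hM2 : ∀ m, m ≤ p → (n : ℝ) ^ 2 * (p + 1) < 2 ^ (M m)) :
    ∃ b : Ed n → Fin r, Good N s (4 * p) b ∧ ∀ f : Ed n, ∀ m, m ≤ p →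
      (Finset.univ.filter (fun T => TypeC N s p b T ∧ f ∈ ET T ∧ T.card = m)).card ≤ M m := by
  set G := GS N s (4 * p) r (Finset.univ : Finset (Ed n)) with hG
  have hG0 : (0 : ℝ) < G.card := by exact_mod_cast GS_pos hr hro
  by_contra hcon
  push Not at hcon
  set I : Finset (Ed n × ℕ) := Finset.univ ×ˢ Finset.range (p + 1) with hI
  set Bd : Ed n × ℕ → Finset (Ed n → Fin r) := fun x => G.filter (fun b => M x.2 ≤ (Finset.univ.filter
      (fun T => TypeC N s p b T ∧ x.1 ∈ ET T ∧ T.card = x.2)).card) with hBd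
  have hcover : G ⊆ I.biUnion Bd := by
    intro b hb
    obtain ⟨f, m, hm, h⟩ := hcon b (GS_univ.1 hb)
    rw [Finset.mem_biUnion]
    refine ⟨(f, m), ?_, ?_⟩
    · rw [hI, Finset.mem_product, Finset.mem_range]
      exact ⟨Finset.mem_univ _, by simp only; omega⟩
    · simp only [hBd]
      rw [Finset.mem_filter]
      exact ⟨hb, h.le⟩
  have h1 : (G.card : ℝ) ≤ ∑ x ∈ I, ((Bd x).card : ℝ) := by
    exact_mod_cast (Finset.card_le_card hcover).trans Finset.card_biUnion_le
  have hIc : (I.card : ℝ) ≤ (n : ℝ) ^ 2 * (p + 1) := by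
    rw [hI, Finset.card_product, Finset.card_range, Finset.card_univ]
    push_cast
    apply mul_le_mul_of_nonneg_right _ (by positivity)
    exact_mod_cast card_Ed_le
  have hIne : I.Nonempty := by
    by_contra h
    rw [Finset.not_nonempty_iff_eq_empty] at h
    rw [h, Finset.sum_empty] at h1
    linarith
  have hIpos : (0 : ℝ) < I.card := by exact_mod_cast hIne.card_pos
  have h2 : ∀ x ∈ I, ((Bd x).card : ℝ) < G.card / I.card := by
    intro x hx
    rw [hI, Finset.mem_product, Finset.mem_range] at hx
    have hxm : x.2 ≤ p := by omega
    have h3 := many_count hr hN hs hnd hro x.1 x.2 hxm (M x.2) (hM _ hxm)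
    have h4 := hM2 _ hxm
    have h3' : ((Bd x).card : ℝ) * 2 ^ (M x.2) ≤ G.card := h3
    rw [lt_div_iff₀ hIpos]
    rcases (Nat.cast_nonneg (α := ℝ) (Bd x).card).eq_or_lt with h | h
    · rw [← h, zero_mul]; exact hG0
    · refine lt_of_lt_of_le ?_ h3'
      exact mul_lt_mul_of_pos_left (lt_of_le_of_lt hIc h4) h
  have h5 := Finset.sum_lt_sum_of_nonempty hIne h2
  rw [Finset.sum_const, nsmul_eq_mul, mul_div_cancel₀ _ hIpos.ne'] at h5
  linarith

end Degree

section Assembly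

open scoped Classical

lemma ramsey_of_null {n p q s r t : ℕ} (hr : 0 < r) (ht : 0 < t) (hq : s + q = p.choose 2 + 1)
    (b : Ed n → Fin r) (φ : Ed n → Fin t)
    (h : ∀ S : Finset (Fin n), S.card = p → null (fun e => (b e, φ e)) (ET S) < s) :
    fRamsey n p q ≤ r * t := by
  unfold fRamsey
  apply Nat.sInf_le
  set ψ : Ed n → Fin r × Fin t := fun e => (b e, φ e) with hψ
  refine ⟨fun S => if h : S.card = 2 then finProdFinEquiv (ψ ⟨S, h⟩) else
    finProdFinEquiv (⟨0, hr⟩, ⟨0, ht⟩), ?_⟩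
  intro S hS
  have h1 := null_add ψ (ET S)
  have h2 := h S hS
  rw [card_ET, hS] at h1
  have h3 : q ≤ ((ET S).image ψ).card := by omega
  refine h3.trans ?_
  rw [← Finset.card_image_of_injective ((ET S).image ψ) finProdFinEquiv.injective]
  apply Finset.card_le_card
  intro c hc
  obtain ⟨c', hc', rfl⟩ := Finset.mem_image.1 hc
  obtain ⟨e, he, rfl⟩ := Finset.mem_image.1 hc'
  rw [Finset.mem_image]
  refine ⟨e.1, ?_, ?_⟩
  · rw [Finset.mem_powersetCard]
    exact ⟨mem_ET.1 he, e.2⟩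
  · rw [dif_pos e.2]

lemma core {n p q s r t : ℕ} (hp : 3 ≤ p) (hs : 0 < s) (hnd : ¬ s ∣ (p - 2))
    (hq : s + q = p.choose 2 + 1) (hr : 0 < r) (ht : 0 < t)
    (hrho : 2 * ((4 * p : ℕ) : ℝ) ^ 2 / r ≤ 1)
    (H : ∀ m, 2 ≤ m → m ≤ 4 * p → (n : ℝ) ^ (m - 2) * 2 ^ ((4 * p) ^ 2) *
      (2 * ((4 * p : ℕ) : ℝ) ^ 2 / r) ^ (s * (m - 2) / (p - 2) + 1) ≤ 1 / (2 * ((4 * p : ℕ) : ℝ)))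
    (M : ℕ → ℕ)
    (hM : ∀ m, m ≤ p → 2 * Real.exp 1 * ((n : ℝ) ^ (m - 2) * ((2 : ℝ) ^ ((4 * p) ^ 2) *
      (2 * ((4 * p : ℕ) : ℝ) ^ 2 / r) ^ (s * (m - 2) / (p - 2)))) ≤ M m)
    (hM2 : ∀ m, m ≤ p → (n : ℝ) ^ 2 * (p + 1) < 2 ^ (M m))
    {l l' τ μ X B R D0 : ℝ}
    (hX : 1 ≤ X) (hl : 0 < l) (hl' : 0 < l') (hBd : B = X / t) (hRd : R = 8 * X)
    (hμ : μ = 2 * (l * (34 * B * R ^ (p ^ 2)))) (hτ : τ = l' * B * (μ + 2 * B) + 4 * l' ^ 2 * B ^ 2)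
    (h1 : l * (34 * B * R ^ (p ^ 2)) ≤ 1 / 3) (h2 : 2 * l' * B ≤ 1)
    (h3 : τ * t * Real.log X ≤ 1)
    (h4 : (n : ℝ) ^ 2 * Real.exp (1 - l' / 2) ≤ 1 / 4)
    (h5 : (n : ℝ) ^ 2 * t * Real.exp (l * (D0 - Real.log X)) ≤ 1 / 4)
    (hD0 : 0 ≤ D0)
    (h6 : ∀ m, 3 ≤ m → m ≤ p → ∀ ν, (p - 2) * ν = s * (m - 2) → 1 ≤ ν → ν ≤ s →
      (M m : ℝ) * (4 ^ (p ^ 2) / (t : ℝ) ^ ν) ≤ D0 / (p + 1)) :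
    fRamsey n p q ≤ r * t := by
  have hN : 0 < p - 2 := by omega
  have hro : ∀ E' : Finset (Ed n), ∀ e, e ∉ E' → (GS (p - 2) s (4 * p) r E').card ≤
      2 * (GS (p - 2) s (4 * p) r (insert e E')).card :=
    fun E' => rosen hN hr (by omega) hrho H E'
  obtain ⟨b, hg, hdeg⟩ := exists_good hr hN hs hnd hro M hM hM2
  have hEd : (Fintype.card (Ed n) : ℝ) ≤ (n : ℝ) ^ 2 := by exact_mod_cast card_Ed_le
  have hct : Fintype.card (Fin t) = t := Fintype.card_fin t
  obtain ⟨φ, hφ⟩ := phase_two_apply (Col := Fin t) hp hs hnd hg (by rw [hct]; exact ht) hX hl hl'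
    (by rw [hct]; exact hBd) hRd hμ hτ h1 h2 (by rw [hct]; exact h3)
    ((mul_le_mul_of_nonneg_right hEd (by positivity)).trans h4)
    (le_trans (by
      rw [hct]
      apply mul_le_mul_of_nonneg_right _ (by positivity)
      exact mul_le_mul_of_nonneg_right hEd (by positivity)) h5)
    (D0 := D0) (by
      intro f
      rw [hct]
      rw [← Finset.sum_fiberwise_of_maps_to (g := Finset.card) (t := Finset.range (p + 1))]
      · have hh : ∀ m ∈ Finset.range (p + 1), ∑ T ∈ (Finset.univ.filter
            (fun T => TypeC (p - 2) s p b T ∧ f ∈ ET T)).filter (fun T => T.card = m),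
            (4 : ℝ) ^ (p ^ 2) / (t : ℝ) ^ (null b (ET T)) ≤ D0 / (p + 1) := by
          intro m hm
          rw [Finset.mem_range] at hm
          set A := (Finset.univ.filter
            (fun T => TypeC (p - 2) s p b T ∧ f ∈ ET T)).filter (fun T => T.card = m) with hA
          have hAm : ∀ T ∈ A, TypeC (p - 2) s p b T ∧ f ∈ ET T ∧ T.card = m := by
            intro T hT
            rw [hA, Finset.mem_filter, Finset.mem_filter] at hT
            exact ⟨hT.1.2.1, hT.1.2.2, hT.2⟩
          rcases A.eq_empty_or_nonempty with hE | ⟨T0, hT0⟩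
          · rw [hE, Finset.sum_empty]; positivity
          · have hT0' := hAm T0 hT0
            have heq : ∀ T ∈ A, (p - 2) * null b (ET T) + 2 * s = s * m := by
              intro T hT
              have := (hAm T hT).1.eq
              rw [(hAm T hT).2.2] at this
              exact this
            have hnu : ∀ T ∈ A, null b (ET T) = null b (ET T0) := by
              intro T hT
              have e1 := heq T hT
              have e2 := heq T0 hT0
              have : (p - 2) * null b (ET T) = (p - 2) * null b (ET T0) := by omega
              exact Nat.eq_of_mul_eq_mul_left hN this
            have h3m : 3 ≤ m := hT0'.2.2 ▸ hT0'.1.three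
            have e0 : (p - 2) * null b (ET T0) = s * (m - 2) := by
              have e2 := heq T0 hT0
              obtain ⟨k, hk⟩ := Nat.exists_eq_add_of_le h3m
              rw [hk] at e2 ⊢
              have : 3 + k - 2 = k + 1 := by omega
              rw [this]
              have : s * (3 + k) = s * (k + 1) + 2 * s := by ring
              omega
            have e1 := TypeC.two_le_null hs hnd hT0'.1
            have e2 : null b (ET T0) ≤ s := by
              have : (p - 2) * null b (ET T0) ≤ (p - 2) * s := by
                rw [e0, mul_comm s]
                exact Nat.mul_le_mul_right _ (by omega)
              exact Nat.le_of_mul_le_mul_left this hN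
            refine le_trans ?_ (h6 m h3m (by omega) _ e0 (by omega) e2)
            rw [Finset.sum_congr rfl (fun T hT => by rw [hnu T hT]), Finset.sum_const, nsmul_eq_mul]
            apply mul_le_mul_of_nonneg_right _ (by positivity)
            have : A.card ≤ M m := by
              refine le_trans (Finset.card_le_card ?_) (hdeg f m (by omega))
              intro T hT
              rw [Finset.mem_filter]
              exact ⟨Finset.mem_univ _, hAm T hT⟩
            exact_mod_cast this
        refine (Finset.sum_le_sum hh).trans (le_of_eq ?_)
        rw [Finset.sum_const, nsmul_eq_mul, Finset.card_range]
        push_cast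
        field_simp
      · intro T hT
        rw [Finset.mem_filter] at hT
        rw [Finset.mem_range]
        have := hT.2.1.le
        omega)
  exact ramsey_of_null hr ht hq b φ hφ

end Assembly

section Numeric

lemma ev_log (δ c : ℝ) (hδ : 0 < δ) : ∀ᶠ n : ℕ in Filter.atTop,
    c * (Real.log n) ^ 3 ≤ (n : ℝ) ^ δ := by
  have h1 := isLittleO_log_rpow_rpow_atTop (s := δ) 3 hδ
  have h2 : ∀ᶠ x : ℝ in Filter.atTop, c * (Real.log x) ^ 3 ≤ x ^ δ := by
    have h3 := h1.bound (c := 1 / (|c| + 1)) (by positivity)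
    filter_upwards [h3, Filter.eventually_ge_atTop 1] with x hx hx1
    have hl : 0 ≤ Real.log x := Real.log_nonneg hx1
    have e1 : Real.log x ^ (3 : ℝ) = Real.log x ^ 3 := by
      rw [← Real.rpow_natCast]; norm_num
    rw [e1, Real.norm_of_nonneg (by positivity), Real.norm_of_nonneg (by positivity),
      div_mul_eq_mul_div, one_mul, le_div_iff₀ (by positivity)] at hx
    have h4 : 0 ≤ Real.log x ^ 3 := by positivity
    nlinarith [le_abs_self c]
  exact tendsto_natCast_atTop_atTop.eventually h2

lemma rosH {y γ A ρ r Pr : ℝ} {N s m j J0 : ℕ} (hy : 1 ≤ y) (hs : 0 < s) (hγ : 0 ≤ γ)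
    (hγJ : 2 * γ * J0 ≤ 1 / (2 * s)) (hA : 0 ≤ A) (hρ : 1 ≤ ρ) (hP : 0 < Pr)
    (hr : y ^ ((N : ℝ) / s - 2 * γ) ≤ r) (hj : j ≤ J0) (hNj : s * (m - 2) + 1 ≤ N * j)
    (hbig : 2 * Pr * (A * ρ ^ J0) ≤ y ^ (1 / (2 * (s : ℝ)))) :
    y ^ (m - 2) * A * (ρ / r) ^ j ≤ 1 / (2 * Pr) := by
  have hy0 : 0 < y := by linarith
  have hsR : (0 : ℝ) < s := by exact_mod_cast hs
  have hr0 : 0 < r := lt_of_lt_of_le (Real.rpow_pos_of_pos hy0 _) hr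
  have h1 : y ^ (m - 2) * y ^ (1 / (2 * (s : ℝ))) ≤ r ^ j := by
    calc y ^ (m - 2) * y ^ (1 / (2 * (s : ℝ))) = y ^ (((m - 2 : ℕ) : ℝ) + 1 / (2 * (s : ℝ))) := by
          rw [Real.rpow_add hy0, Real.rpow_natCast]
      _ ≤ y ^ (((N : ℝ) / s - 2 * γ) * j) := by
          apply Real.rpow_le_rpow_of_exponent_le hy
          have e1 : (s : ℝ) * ((m - 2 : ℕ) : ℝ) + 1 ≤ N * j := by exact_mod_cast hNj
          have e2 : (j : ℝ) ≤ J0 := by exact_mod_cast hj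
          have e3 : 2 * γ * j ≤ 1 / (2 * s) :=
            (mul_le_mul_of_nonneg_left e2 (by positivity)).trans hγJ
          have e4 : ((m - 2 : ℕ) : ℝ) + 1 / s ≤ N / s * j := by
            rw [div_mul_eq_mul_div, le_div_iff₀ hsR, add_mul, div_mul_cancel₀ _ hsR.ne']
            linarith
          have e5 : 1 / (s : ℝ) = 1 / (2 * s) + 1 / (2 * s) := by field_simp; norm_num
          nlinarith
      _ = (y ^ ((N : ℝ) / s - 2 * γ)) ^ j := by rw [Real.rpow_mul hy0.le, Real.rpow_natCast]
      _ ≤ r ^ j := pow_le_pow_left₀ (Real.rpow_nonneg hy0.le _) hr j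
  have h2 : ρ ^ j ≤ ρ ^ J0 := pow_le_pow_right₀ hρ hj
  rw [div_pow, mul_div_assoc', div_le_div_iff₀ (by positivity) (by positivity), one_mul]
  calc y ^ (m - 2) * A * ρ ^ j * (2 * Pr) = y ^ (m - 2) * (2 * Pr * (A * ρ ^ j)) := by ring
    _ ≤ y ^ (m - 2) * (2 * Pr * (A * ρ ^ J0)) := by gcongr
    _ ≤ y ^ (m - 2) * y ^ (1 / (2 * (s : ℝ))) := by gcongr
    _ ≤ r ^ j := h1

lemma Qbound {y L K ρ r t : ℝ} {N s m ν : ℕ} (hy : 1 ≤ y) (hs : 0 < s) (hL : 1 ≤ L) (hK : 1 ≤ K)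
    (hρ : 1 ≤ ρ) (hr : 0 < r) (ht : 0 < t) (hν : N * ν = s * (m - 2)) (h1 : 1 ≤ ν) (h2 : ν ≤ s)
    (hrt : K * y ^ ((N : ℝ) / s) / L ^ (1 / (s : ℝ)) ≤ r * t) :
    y ^ (m - 2) * (ρ / r) ^ ν / t ^ ν ≤ ρ ^ s / K * L := by
  have hy0 : 0 < y := by linarith
  have hsR : (0 : ℝ) < s := by exact_mod_cast hs
  have hL0 : 0 < L := by linarith
  have hK0 : 0 < K := by linarith
  have hLs : 0 < L ^ (1 / (s : ℝ)) := Real.rpow_pos_of_pos hL0 _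
  have hys : 0 < y ^ ((N : ℝ) / s) := Real.rpow_pos_of_pos hy0 _
  have e1 : y ^ (m - 2) = (y ^ ((N : ℝ) / s)) ^ ν := by
    rw [← Real.rpow_natCast, ← Real.rpow_natCast, ← Real.rpow_mul hy0.le]
    congr 1
    have : (N : ℝ) * ν = s * ((m - 2 : ℕ) : ℝ) := by exact_mod_cast hν
    rw [div_mul_eq_mul_div, this, mul_div_cancel_left₀ _ hsR.ne']
  have e2 : y ^ (m - 2) * (ρ / r) ^ ν / t ^ ν = (y ^ ((N : ℝ) / s) * ρ / (r * t)) ^ ν := by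
    rw [e1, div_pow, div_pow, mul_pow, mul_pow]
    field_simp
  have e3 : y ^ ((N : ℝ) / s) * ρ / (r * t) ≤ ρ * L ^ (1 / (s : ℝ)) / K := by
    rw [div_le_iff₀ hLs] at hrt
    rw [div_le_div_iff₀ (by positivity) hK0]
    nlinarith
  rw [e2]
  calc _ ≤ (ρ * L ^ (1 / (s : ℝ)) / K) ^ ν := pow_le_pow_left₀ (by positivity) e3 ν
    _ = ρ ^ ν * (L ^ (1 / (s : ℝ))) ^ ν / K ^ ν := by rw [div_pow, mul_pow]
    _ ≤ ρ ^ s * L / K := by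
        have f1 : ρ ^ ν ≤ ρ ^ s := pow_le_pow_right₀ hρ h2
        have f2 : (L ^ (1 / (s : ℝ))) ^ ν ≤ L := by
          calc (L ^ (1 / (s : ℝ))) ^ ν ≤ (L ^ (1 / (s : ℝ))) ^ s :=
                pow_le_pow_right₀ (Real.one_le_rpow hL (by positivity)) h2
            _ = L := by
                rw [← Real.rpow_natCast, ← Real.rpow_mul hL0.le, one_div_mul_cancel hsR.ne',
                  Real.rpow_one]
        have f3 : K ≤ K ^ ν := le_self_pow₀ hK (by omega)
        gcongr
    _ = _ := by ring

set_option maxHeartbeats 1000000 in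
/-- the parameters of the second phase -/
lemma phase_num {y L t ε γ X B R l l' μ τ : ℝ} {k : ℕ} (hy : 1 ≤ y) (hLd : L = Real.log y)
    (hL : 1 ≤ L) (hε : 0 < ε) (hε1 : ε ≤ 1) (hεγ : (k + 2) * ε ≤ γ / 2) (ht : y ^ γ ≤ t)
    (hXd : X = y ^ ε) (hBd : B = X / t) (hRd : R = 8 * X) (hl : l = 8 / ε) (hl' : l' = 10 * L)
    (hμ : μ = 2 * (l * (34 * B * R ^ k))) (hτ : τ = l' * B * (μ + 2 * B) + 4 * l' ^ 2 * B ^ 2)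
    (hbig : (20 * l + 440) * (34 * 8 ^ k) * L ^ 3 ≤ y ^ (γ / 2)) :
    l * (34 * B * R ^ k) ≤ 1 / 3 ∧ 2 * l' * B ≤ 1 ∧ τ * t * Real.log X ≤ 1 := by
  have hy0 : 0 < y := by linarith
  have hX1 : 1 ≤ X := by rw [hXd]; exact Real.one_le_rpow hy hε.le
  have ht0 : 0 < t := lt_of_lt_of_le (Real.rpow_pos_of_pos hy0 _) ht
  have hlogX : Real.log X = ε * L := by rw [hXd, hLd, Real.log_rpow hy0]
  have hl0 : 0 < l := by rw [hl]; positivity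
  have hB0 : 0 < B := by rw [hBd]; positivity
  have hR1 : 1 ≤ R := by linarith
  set J := 34 * B * R ^ k with hJ
  have hBJ : B ≤ J := by
    have : 1 ≤ R ^ k := one_le_pow₀ hR1
    rw [hJ]; nlinarith
  have hJ0 : 0 < J := by linarith
  set z := y ^ (γ / 2) with hz
  have hz0 : 0 < z := Real.rpow_pos_of_pos hy0 _
  have hXJ : X * J * z ≤ 34 * 8 ^ k := by
    have e1 : X ^ (k + 2) ≤ z := by
      rw [hXd, hz, ← Real.rpow_natCast, ← Real.rpow_mul hy0.le]
      apply Real.rpow_le_rpow_of_exponent_le hy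
      push_cast
      linarith
    have e2 : z * z ≤ t := by
      rw [hz, ← Real.rpow_add hy0]
      have : γ / 2 + γ / 2 = γ := by ring
      rw [this]; exact ht
    have e3 : X * J * z = 34 * 8 ^ k * (X ^ (k + 2) * z / t) := by
      rw [hJ, hBd, hRd, mul_pow]; ring
    rw [e3]
    have e4 : X ^ (k + 2) * z / t ≤ 1 := by
      rw [div_le_one ht0]
      exact (mul_le_mul_of_nonneg_right e1 hz0.le).trans e2
    have : (0 : ℝ) < 34 * 8 ^ k := by positivity
    nlinarith
  have hmain : (20 * l + 440) * L ^ 3 * (X * J) ≤ 1 := by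
    have e0 : 0 < X * J := by positivity
    have e1 := mul_le_mul_of_nonneg_right hbig e0.le
    have e2 : z * (X * J) ≤ 34 * 8 ^ k := by rw [mul_comm]; exact hXJ
    have e3 : (0 : ℝ) < 34 * 8 ^ k := by positivity
    have e4 : (34 * 8 ^ k) * ((20 * l + 440) * L ^ 3 * (X * J)) ≤ (34 * 8 ^ k) * 1 := by
      calc _ = (20 * l + 440) * (34 * 8 ^ k) * L ^ 3 * (X * J) := by ring
        _ ≤ _ := e1
        _ ≤ _ := e2
        _ = _ := (mul_one _).symm
    exact le_of_mul_le_mul_left e4 e3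
  have hL3 : L ≤ L ^ 3 := le_self_pow₀ hL (by norm_num)
  have hL23 : L ^ 2 ≤ L ^ 3 := pow_le_pow_right₀ hL (by norm_num)
  have hJX : J ≤ X * J := by nlinarith
  have hW : ∀ a c : ℝ, 0 ≤ a → a ≤ (20 * l + 440) * L ^ 3 → c ≤ X * J → 0 ≤ c → a * c ≤ 1 := by
    intro a c h1 h2 h3 h4
    exact (mul_le_mul h2 h3 h4 (by positivity)).trans hmain
  refine ⟨?_, ?_, ?_⟩
  · have := hW (3 * l) J (by positivity) (by nlinarith [mul_pos hl0 (by linarith : (0:ℝ) < L)]) hJX hJ0.le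
    linarith
  · rw [hl']
    have := hW (20 * L) B (by positivity) (by nlinarith [mul_pos hl0 (by linarith : (0:ℝ) < L)])
      (hBJ.trans hJX) hB0.le
    linarith
  · rw [hlogX]
    have hBt : B * t = X := by rw [hBd]; field_simp
    have e1 : τ * t = l' * X * (μ + 2 * B) + 4 * l' ^ 2 * (X * B) := by
      rw [hτ, ← hBt]; ring
    have e2 : τ * t ≤ (20 * L * (l + 1) + 400 * L ^ 2) * (X * J) := by
      rw [e1, hμ, hl']
      have f1 : 10 * L * X * (2 * (l * J) + 2 * B) ≤ 10 * L * X * (2 * (l * J) + 2 * J) := by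
        have : 0 ≤ 10 * L * X := by positivity
        exact mul_le_mul_of_nonneg_left (by linarith) this
      have f2 : 4 * (10 * L) ^ 2 * (X * B) ≤ 4 * (10 * L) ^ 2 * (X * J) := by gcongr
      refine (add_le_add f1 f2).trans (le_of_eq ?_)
      ring
    have e3 : τ * t * (ε * L) ≤ (20 * L * (l + 1) + 400 * L ^ 2) * (X * J) * (1 * L) := by
      have g1 : 0 ≤ ε * L := by positivity
      have g2 : ε * L ≤ 1 * L := by nlinarith
      exact (mul_le_mul_of_nonneg_right e2 g1).trans (mul_le_mul_of_nonneg_left g2 (by positivity))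
    refine e3.trans ?_
    have := hW ((20 * L * (l + 1) + 400 * L ^ 2) * L) (X * J) (by positivity) (by
      have : (20 * L * (l + 1) + 400 * L ^ 2) * L = 20 * (l + 1) * L ^ 2 + 400 * L ^ 3 := by ring
      rw [this]
      have : 20 * (l + 1) * L ^ 2 ≤ 20 * (l + 1) * L ^ 3 := by gcongr; 
      nlinarith [mul_pos hl0 (by positivity : (0:ℝ) < L ^ 3), (by positivity : (0:ℝ) < L ^ 3)]) le_rfl (by positivity)
    linarith

end Numeric

section Final

lemma aux1 {y : ℝ} (hy : 8 ≤ y) : y ^ 2 * 4 ≤ 1 * y ^ 4 := by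
  have h2 : 4 ≤ y ^ 2 := by nlinarith
  nlinarith

lemma aux2 {y t : ℝ} (hy : 8 ≤ y) (ht : t ≤ 2 * y) : y ^ 2 * t * 4 ≤ 1 * y ^ 4 := by
  have e2 : y ^ 2 * t ≤ y ^ 2 * (2 * y) := mul_le_mul_of_nonneg_left ht (by positivity)
  have e3 : y ^ 3 * 8 ≤ y ^ 3 * y := mul_le_mul_of_nonneg_left hy (by positivity)
  nlinarith

lemma aux3 {a b T ε L : ℝ} (hL : 0 ≤ L) (h : 32 * (a * b) ≤ T * ε) :
    8 * L * a * b ≤ ε / 4 * L * T := by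
  have := mul_le_mul_of_nonneg_left h hL
  linarith

lemma aux4 {M L : ℝ} (hL : 0 ≤ L) (h : 6 * L ≤ M) : 3 * L ≤ M * Real.log 2 := by
  have h1 := Real.log_two_gt_d9
  have h2 : 6 * L * (1 / 2) ≤ M * Real.log 2 :=
    mul_le_mul h (by linarith) (by norm_num) (by linarith)
  linarith

lemma aux5 {L : ℝ} (hL : 1 ≤ L) : ∀ c z : ℝ, 0 ≤ c → c * L ≤ z → c ≤ z := by
  intro c z h1 h2; nlinarith

set_option maxHeartbeats 1000000 in
theorem main_num {p q s : ℕ} (hp : 3 ≤ p) (hs : 0 < s) (hnd : ¬ s ∣ (p - 2))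
    (hq : s + q = p.choose 2 + 1) :
    ∃ C : ℝ, 0 < C ∧ ∃ N0 : ℕ, ∀ n : ℕ, N0 ≤ n →
      (fRamsey n p q : ℝ) ≤ C * ((n : ℝ) ^ ((p : ℝ) - 2) / Real.log n) ^ (1 / (s : ℝ)) := by
  obtain ⟨N, hN⟩ : ∃ N, N = p - 2 := ⟨_, rfl⟩
  have hN0 : 0 < N := by omega
  have hsR : (1 : ℝ) ≤ s := by exact_mod_cast hs
  have hNR : (1 : ℝ) ≤ N := by exact_mod_cast hN0
  have hpR : (3 : ℝ) ≤ p := by exact_mod_cast hp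
  obtain ⟨Pr, hPr⟩ : ∃ Pr : ℝ, Pr = ((4 * p : ℕ) : ℝ) := ⟨_, rfl⟩
  have hPr1 : 1 ≤ Pr := by rw [hPr]; push_cast; linarith
  obtain ⟨ρ, hρ⟩ : ∃ ρ : ℝ, ρ = 2 * Pr ^ 2 := ⟨_, rfl⟩
  have hρ1 : 1 ≤ ρ := by rw [hρ]; nlinarith
  obtain ⟨A, hA⟩ : ∃ A : ℝ, A = 2 ^ ((4 * p) ^ 2) := ⟨_, rfl⟩
  have hA0 : 0 < A := by rw [hA]; positivity
  obtain ⟨k, hk⟩ : ∃ k : ℕ, k = p ^ 2 := ⟨_, rfl⟩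
  obtain ⟨J0, hJ0⟩ : ∃ J0 : ℕ, J0 = s * (4 * p) + 1 := ⟨_, rfl⟩
  have hJR : (1 : ℝ) ≤ J0 := by rw [hJ0]; push_cast; nlinarith
  obtain ⟨γ, hγ⟩ : ∃ γ : ℝ, γ = 1 / (4 * s * J0) := ⟨_, rfl⟩
  have hγ0 : 0 < γ := by rw [hγ]; positivity
  have hγJ : 2 * γ * J0 = 1 / (2 * s) := by rw [hγ]; field_simp; norm_num
  have hγs : 4 * γ ≤ 1 / s := by
    have : 2 * γ * 1 ≤ 2 * γ * J0 := mul_le_mul_of_nonneg_left hJR (by positivity)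
    have e5 : 1 / (s : ℝ) = 2 * (1 / (2 * s)) := by field_simp
    rw [e5]; linarith
  have hs1 : 1 / (s : ℝ) ≤ 1 := by rw [div_le_one (by linarith)]; exact hsR
  obtain ⟨x, hx⟩ : ∃ x : ℝ, x = (N : ℝ) / s := ⟨_, rfl⟩
  have hxs : 1 / (s : ℝ) ≤ x := by
    rw [hx]; exact div_le_div_of_nonneg_right hNR (by linarith)
  have hx2 : 0 < x - 2 * γ := by linarith
  obtain ⟨ε, hε⟩ : ∃ ε : ℝ, ε = γ / (4 * (k + 1)) := ⟨_, rfl⟩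
  have hε0 : 0 < ε := by rw [hε]; positivity
  have hε4 : ε * (4 * (k + 1)) = γ := by rw [hε]; field_simp
  have hk0 : (0 : ℝ) ≤ k := Nat.cast_nonneg _
  have hε1 : ε ≤ 1 := by nlinarith
  have hεγ : (k + 2) * ε ≤ γ / 2 := by nlinarith
  obtain ⟨A1, hA1⟩ : ∃ A1 : ℝ, A1 = 4 ^ k * (p + 1) * (2 * Real.exp 1 * (A * ρ ^ s)) := ⟨_, rfl⟩
  have hA10 : 0 < A1 := by rw [hA1]; positivity
  obtain ⟨K, hK⟩ : ∃ K : ℝ, K = 1 + 4 * A1 / ε := ⟨_, rfl⟩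
  have hK1 : 1 ≤ K := by
    have : 0 ≤ 4 * A1 / ε := by positivity
    linarith
  have hA1K : A1 / K ≤ ε / 4 := by
    rw [div_le_div_iff₀ (by linarith) (by norm_num), hK]
    have : ε * (1 + 4 * A1 / ε) = ε + 4 * A1 := by field_simp
    rw [this]; linarith
  obtain ⟨l, hl⟩ : ∃ l : ℝ, l = 8 / ε := ⟨_, rfl⟩
  have hl0 : 0 < l := by rw [hl]; positivity
  refine ⟨4 * K, by linarith, ?_⟩
  have a1 : ∀ᶠ n : ℕ in Filter.atTop, (1 : ℝ) ≤ Real.log n :=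
    (Real.tendsto_log_atTop.comp tendsto_natCast_atTop_atTop).eventually_ge_atTop 1
  have b1 := ev_log γ 1 hγ0
  have b2 := ev_log (1 / (2 * (s : ℝ))) (2 * Pr * (A * ρ ^ J0)) (by positivity)
  have b3 := ev_log (x - 2 * γ) ρ hx2
  have b4 := ev_log γ (32 * (4 ^ k * (p + 1)) / ε) hγ0
  have b5 := ev_log (γ / 2) ((20 * l + 440) * (34 * 8 ^ k)) (by positivity)
  have hall := (((((a1.and b1).and b2).and b3).and b4).and b5).and
    (Filter.eventually_ge_atTop (p + 8))
  obtain ⟨N0, hN0'⟩ := Filter.eventually_atTop.1 hall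
  refine ⟨N0, fun n hn => ?_⟩
  obtain ⟨⟨⟨⟨⟨⟨a1, b1⟩, b2⟩, b3⟩, b4⟩, b5⟩, a2⟩ := hN0' n hn
  clear hN0' hall
  have hnR : (p : ℝ) + 8 ≤ n := by exact_mod_cast a2
  obtain ⟨y, hy⟩ : ∃ y : ℝ, y = (n : ℝ) := ⟨_, rfl⟩
  obtain ⟨L, hL⟩ : ∃ L : ℝ, L = Real.log y := ⟨_, rfl⟩
  rw [← hy] at a1 b1 b2 b3 b4 b5 hnR ⊢
  rw [← hL] at a1 b1 b2 b3 b4 b5 ⊢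
  have hy1 : 1 ≤ y := by linarith
  have hy8 : 8 ≤ y := by linarith
  have hy0 : 0 < y := by linarith
  have hL0 : 0 < L := by linarith
  have hL3 : L ≤ L ^ 3 := le_self_pow₀ a1 (by norm_num)
  have hL31 : 1 ≤ L ^ 3 := by linarith
  have hdrop : ∀ c z : ℝ, 0 ≤ c → c * L ^ 3 ≤ z → c ≤ z := aux5 hL31
  have c2 := hdrop _ _ (by positivity) b2
  have c3 := hdrop _ _ (by positivity) b3
  have c4 := hdrop _ _ (by positivity) b4
  have hLs1 : 1 ≤ L ^ (1 / (s : ℝ)) := Real.one_le_rpow a1 (by positivity)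
  have hLsL : L ^ (1 / (s : ℝ)) ≤ L := by
    calc L ^ (1 / (s : ℝ)) ≤ L ^ (1 : ℝ) := Real.rpow_le_rpow_of_exponent_le a1 hs1
      _ = L := Real.rpow_one L
  have hLs0 : 0 < L ^ (1 / (s : ℝ)) := by linarith
  have hyg : 1 ≤ y ^ γ := Real.one_le_rpow hy1 hγ0.le
  have hLyg : L ^ (1 / (s : ℝ)) ≤ y ^ γ := by linarith
  -- the numbers of colours
  obtain ⟨r0, hr0⟩ : ∃ r0 : ℝ, r0 = K * y ^ (x - γ) / L ^ (1 / (s : ℝ)) := ⟨_, rfl⟩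
  have hr0x : y ^ (x - 2 * γ) ≤ r0 := by
    rw [hr0, le_div_iff₀ hLs0]
    have e1 : y ^ (x - γ) = y ^ (x - 2 * γ) * y ^ γ := by
      rw [← Real.rpow_add hy0]; congr 1; ring
    have e2 : 0 < y ^ (x - 2 * γ) := Real.rpow_pos_of_pos hy0 _
    calc y ^ (x - 2 * γ) * L ^ (1 / (s : ℝ)) ≤ y ^ (x - 2 * γ) * y ^ γ :=
          mul_le_mul_of_nonneg_left hLyg e2.le
      _ = 1 * y ^ (x - γ) := by rw [e1, one_mul]
      _ ≤ K * y ^ (x - γ) := mul_le_mul_of_nonneg_right hK1 (Real.rpow_nonneg hy0.le _)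
  have hr01 : 1 ≤ r0 := (Real.one_le_rpow hy1 hx2.le).trans hr0x
  obtain ⟨r, hr⟩ : ∃ r : ℕ, r = ⌈r0⌉₊ := ⟨_, rfl⟩
  have hr1 : r0 ≤ r := by rw [hr]; exact Nat.le_ceil _
  have hr2 : (r : ℝ) ≤ 2 * r0 := by
    have := Nat.ceil_lt_add_one (a := r0) (by linarith)
    rw [← hr] at this
    linarith
  have hrpos : 0 < r := by
    have : (0 : ℝ) < r := by linarith
    exact_mod_cast this
  obtain ⟨t, ht⟩ : ∃ t : ℕ, t = ⌈y ^ γ⌉₊ := ⟨_, rfl⟩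
  have ht1 : y ^ γ ≤ t := by rw [ht]; exact Nat.le_ceil _
  have ht2 : (t : ℝ) ≤ 2 * y ^ γ := by
    have := Nat.ceil_lt_add_one (a := y ^ γ) (by linarith)
    rw [← ht] at this
    linarith
  have ht1' : (1 : ℝ) ≤ t := by linarith
  have htpos : 0 < t := by
    have : (0 : ℝ) < t := by linarith
    exact_mod_cast this
  have hprod : r0 * y ^ γ = K * y ^ x / L ^ (1 / (s : ℝ)) := by
    have e1 : y ^ x = y ^ (x - γ) * y ^ γ := by
      rw [← Real.rpow_add hy0]; congr 1; ring
    rw [hr0, e1]; ring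
  have hrt : K * y ^ ((N : ℝ) / s) / L ^ (1 / (s : ℝ)) ≤ (r : ℝ) * t := by
    rw [← hx, ← hprod]
    exact mul_le_mul hr1 ht1 (by linarith) (by linarith)
  have hrt2 : (r : ℝ) * t ≤ 4 * K * (y ^ x / L ^ (1 / (s : ℝ))) := by
    calc (r : ℝ) * t ≤ (2 * r0) * (2 * y ^ γ) := mul_le_mul hr2 ht2 (by linarith) (by linarith)
      _ = 4 * (r0 * y ^ γ) := by ring
      _ = _ := by rw [hprod]; ring
  have hfin : (y ^ ((p : ℝ) - 2) / L) ^ (1 / (s : ℝ)) = y ^ x / L ^ (1 / (s : ℝ)) := by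
    rw [Real.div_rpow (Real.rpow_nonneg hy0.le _) hL0.le, ← Real.rpow_mul hy0.le]
    congr 2
    have : (N : ℝ) = (p : ℝ) - 2 := by
      rw [hN, Nat.cast_sub (by omega)]; norm_num
    rw [hx, this]; ring
  rw [hfin]
  refine le_trans ?_ hrt2
  have hgoal : fRamsey n p q ≤ r * t := by
    obtain ⟨X, hX⟩ : ∃ X : ℝ, X = y ^ ε := ⟨_, rfl⟩
    obtain ⟨B, hB⟩ : ∃ B : ℝ, B = X / t := ⟨_, rfl⟩
    obtain ⟨R, hR⟩ : ∃ R : ℝ, R = 8 * X := ⟨_, rfl⟩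
    obtain ⟨l', hl'⟩ : ∃ l' : ℝ, l' = 10 * L := ⟨_, rfl⟩
    obtain ⟨μ, hμ⟩ : ∃ μ : ℝ, μ = 2 * (l * (34 * B * R ^ k)) := ⟨_, rfl⟩
    obtain ⟨τ, hτ⟩ : ∃ τ : ℝ, τ = l' * B * (μ + 2 * B) + 4 * l' ^ 2 * B ^ 2 := ⟨_, rfl⟩
    obtain ⟨g1, g2, g3⟩ := phase_num hy1 hL a1 hε0 hε1 hεγ ht1 hX hB hR hl hl' hμ hτ b5
    obtain ⟨M0, hM0⟩ : ∃ M0 : ℕ, M0 = ⌈6 * L⌉₊ := ⟨_, rfl⟩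
    have hM01 : 6 * L ≤ M0 := by rw [hM0]; exact Nat.le_ceil _
    have hM02 : (M0 : ℝ) ≤ 6 * L + 1 := by
      have := Nat.ceil_lt_add_one (a := 6 * L) (by linarith)
      rw [← hM0] at this
      linarith
    have hexp4 : Real.exp (-4 * L) = (y ^ 4)⁻¹ := by
      rw [hL]
      have : -4 * Real.log y = -(((4 : ℕ) : ℝ) * Real.log y) := by push_cast; ring
      rw [this, Real.exp_neg, Real.exp_nat_mul, Real.exp_log hy0]
    have hlogX : Real.log X = ε * L := by rw [hX, hL, Real.log_rpow hy0]
    subst hN hPr hk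
    refine core (n := n) (D0 := ε / 2 * L) hp hs hnd hq hrpos htpos ?_ ?_
      (fun m => ⌈2 * Real.exp 1 * (y ^ (m - 2) * (A * (ρ / r) ^ (s * (m - 2) / (p - 2))))⌉₊ + M0)
      ?_ ?_ (X := X) (B := B) (R := R) (l := l) (l' := l') (μ := μ) (τ := τ)
      (by rw [hX]; exact Real.one_le_rpow hy1 hε0.le) hl0 (by rw [hl']; positivity)
      hB hR hμ hτ g1 g2 g3 ?_ ?_ (by positivity) ?_
    · rw [← hρ, div_le_one (by linarith)]
      linarith
    · intro m hm2 hm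
      rw [← hρ, ← hy, ← hA]
      apply rosH (N := p - 2) (s := s) (J0 := J0) (γ := γ) hy1 hs hγ0.le hγJ.le hA0.le hρ1
        (by linarith) (by rw [← hx]; linarith) _ _ c2
      · rw [hJ0]
        apply Nat.add_le_add_right
        refine (Nat.div_le_self _ _).trans ?_
        exact Nat.mul_le_mul_left _ (by omega)
      · exact Nat.lt_mul_div_succ _ hN0
    · intro m hm
      rw [← hρ, ← hy, ← hA]
      push_cast
      have := Nat.le_ceil (2 * Real.exp 1 * (y ^ (m - 2) * (A * (ρ / r) ^ (s * (m - 2) / (p - 2)))))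
      have h0 : (0 : ℝ) ≤ M0 := Nat.cast_nonneg _
      linarith
    · intro m hm
      rw [← hy]
      have e1 : y ^ 3 ≤ (2 : ℝ) ^ M0 := by
        have f1 : (2 : ℝ) ^ M0 = Real.exp (M0 * Real.log 2) := by
          rw [Real.exp_nat_mul, Real.exp_log (by norm_num)]
        have f2 : y ^ 3 = Real.exp (3 * L) := by
          rw [hL]
          have : 3 * Real.log y = ((3 : ℕ) : ℝ) * Real.log y := by push_cast; ring
          rw [this, Real.exp_nat_mul, Real.exp_log hy0]
        rw [f1, f2]
        apply Real.exp_le_exp.2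
        exact aux4 hL0.le hM01
      calc y ^ 2 * (p + 1) < y ^ 2 * y := mul_lt_mul_of_pos_left (by linarith) (by positivity)
        _ = y ^ 3 := by ring
        _ ≤ 2 ^ M0 := e1
        _ ≤ _ := pow_le_pow_right₀ (by norm_num) (Nat.le_add_left _ _)
    · rw [← hy]
      have e1 : Real.exp (1 - l' / 2) ≤ (y ^ 4)⁻¹ := by
        rw [← hexp4]
        apply Real.exp_le_exp.2
        rw [hl']; linarith
      refine (mul_le_mul_of_nonneg_left e1 (by positivity)).trans ?_
      rw [← div_eq_mul_inv, div_le_div_iff₀ (by positivity) (by norm_num)]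
      exact aux1 hy8
    · rw [← hy, hlogX]
      have e0 : l * (ε / 2 * L - ε * L) = -4 * L := by
        rw [hl]; field_simp; ring
      rw [e0, hexp4]
      have e1 : y ^ γ ≤ y := by
        calc y ^ γ ≤ y ^ (1 : ℝ) := Real.rpow_le_rpow_of_exponent_le hy1 (by linarith)
          _ = y := Real.rpow_one y
      rw [← div_eq_mul_inv, div_le_div_iff₀ (by positivity) (by norm_num)]
      exact aux2 hy8 (by linarith)
    · intro m hm3 hm ν hν h1 h2
      have hdiv : s * (m - 2) / (p - 2) = ν := Nat.div_eq_of_eq_mul_right hN0 hν.symm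
      rw [hdiv]
      push_cast
      have hrR : (0 : ℝ) < r := by linarith
      have htR : (0 : ℝ) < t := by linarith
      have hQ := Qbound (m := m) hy1 hs a1 hK1 hρ1 hrR htR hν h1 h2 hrt
      obtain ⟨Q, hQd⟩ : ∃ Q : ℝ, Q = y ^ (m - 2) * (ρ / r) ^ ν / (t : ℝ) ^ ν := ⟨_, rfl⟩
      rw [← hQd] at hQ
      have hceil := (Nat.ceil_lt_add_one (a := 2 * Real.exp 1 * (y ^ (m - 2) * (A * (ρ / r) ^ ν)))
        (by positivity)).le
      have htν : y ^ γ ≤ (t : ℝ) ^ ν := ht1.trans (le_self_pow₀ ht1' (by omega))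
      have htν0 : 0 < (t : ℝ) ^ ν := by positivity
      have e1 : ((⌈2 * Real.exp 1 * (y ^ (m - 2) * (A * (ρ / r) ^ ν))⌉₊ : ℝ) + M0) ≤
          2 * Real.exp 1 * (y ^ (m - 2) * (A * (ρ / r) ^ ν)) + 8 * L := by linarith
      have e2 : 8 * L * (4 ^ (p ^ 2) / (t : ℝ) ^ ν) ≤ ε / 4 * L / (p + 1) := by
        have f1 : 32 * (4 ^ p ^ 2 * ((p : ℝ) + 1)) / ε ≤ (t : ℝ) ^ ν := c4.trans htν
        rw [div_le_iff₀ hε0] at f1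
        rw [mul_div_assoc', div_le_div_iff₀ htν0 (by positivity)]
        exact aux3 hL0.le f1
      have e3 : 2 * Real.exp 1 * (y ^ (m - 2) * (A * (ρ / r) ^ ν)) * (4 ^ (p ^ 2) / (t : ℝ) ^ ν) ≤
          ε / 4 * L / (p + 1) := by
        have f1 : 2 * Real.exp 1 * (y ^ (m - 2) * (A * (ρ / r) ^ ν)) * (4 ^ (p ^ 2) / (t : ℝ) ^ ν) =
            4 ^ (p ^ 2) * (2 * Real.exp 1 * A) * Q := by rw [hQd]; ring
        rw [f1]
        calc _ ≤ 4 ^ (p ^ 2) * (2 * Real.exp 1 * A) * (ρ ^ s / K * L) :=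
              mul_le_mul_of_nonneg_left hQ (by positivity)
          _ = A1 / K * L / (p + 1) := by
              rw [hA1]; field_simp
          _ ≤ _ := by
              apply div_le_div_of_nonneg_right _ (by positivity)
              exact mul_le_mul_of_nonneg_right hA1K hL0.le
      calc _ ≤ (2 * Real.exp 1 * (y ^ (m - 2) * (A * (ρ / r) ^ ν)) + 8 * L) *
            (4 ^ (p ^ 2) / (t : ℝ) ^ ν) := mul_le_mul_of_nonneg_right e1 (by positivity)
        _ ≤ ε / 4 * L / (p + 1) + ε / 4 * L / (p + 1) := by rw [add_mul]; exact add_le_add e3 e2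
        _ = _ := by ring
  exact_mod_cast hgoal

end Final

/-- Theorem 1.3: for fixed positive `p, q` with `p - 2` not divisible by
`C(p,2) - q + 1`, `f(n,p,q) = O((n^{p-2}/log n)^{1/(C(p,2)-q+1)})`. -/
theorem stmt15 (p q : ℕ) (hp : 1 ≤ p) (hq : 1 ≤ q)
    (hnd : ¬ ((p.choose 2 - q + 1) ∣ (p - 2))) :
    ∃ C : ℝ, 0 < C ∧ ∃ N : ℕ, ∀ n : ℕ, N ≤ n →
      (fRamsey n p q : ℝ) ≤
        C * ((n : ℝ) ^ ((p : ℝ) - 2) / Real.log n) ^ (1 / ((p.choose 2 : ℝ) - q + 1)) := by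
  have hp3 : 3 ≤ p := by
    by_contra h
    apply hnd
    have : p - 2 = 0 := by omega
    rw [this]; exact dvd_zero _
  have hqc : q ≤ p.choose 2 := by
    by_contra h
    apply hnd
    have : p.choose 2 - q + 1 = 1 := by omega
    rw [this]; exact one_dvd _
  have h := main_num hp3 (s := p.choose 2 - q + 1) (q := q) (by omega) hnd (by omega)
  have hc : ((p.choose 2 - q + 1 : ℕ) : ℝ) = (p.choose 2 : ℝ) - q + 1 := by
    push_cast [Nat.cast_sub hqc]; ring
  rw [hc] at h
  exact h
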